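/- arXiv:0807.2849 — 3 statements merged into one kernel-verified Lean document; each statement's English description precedes it below -/
import Mathlib

section
/- Let q be an odd prime power, Q a non-degenerate quadratic form on F_q², and a ∈ F_q, a ≠ 0. Let E_q(Q,a) be the graph with vertex set F_q² in which distinct vertices x, y are adjacent iff Q(x−y) = a. Then E_q(Q,a) is regular of valency d for some d ∈ {q−1, q+1}, and every eigenvalue μ of the real adjacency matrix of E_q(Q,a) with μ ≠ d satisfies |μ| ≤ 2√q. -/
open Matrix

open Polynomial in
lemma biv_eval_ne {L : Type*} [Field L] (M : ℕ) :
    ∀ (n : ℕ) (A : L[X][X]), A.natDegree ≤ n → (∀ k, (A.coeff k).natDegree < M) →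
      A.eval (X ^ M : L[X]) = 0 → A = 0 := by
  intro n
  induction n with
  | zero =>
    intro A hA _ h
    rw [Polynomial.eq_C_of_natDegree_le_zero hA] at h ⊢
    simpa using h
  | succ n ih =>
    intro A hA hc h
    have h1 := Polynomial.divX_mul_X_add A
    have h2 : (X ^ M : L[X]) ∣ A.coeff 0 := by
      rw [← h1] at h
      simp only [eval_add, eval_mul, eval_X, eval_C] at h
      exact ⟨-(A.divX.eval (X ^ M)), by linear_combination h⟩
    have h3 : A.coeff 0 = 0 := by
      by_contra hne
      have := Polynomial.natDegree_le_of_dvd h2 hne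
      have := hc 0
      simp at *
      omega
    have hM : 0 < M := lt_of_le_of_lt (Nat.zero_le _) (hc 0)
    have h4 : A.divX = 0 := by
      apply ih
      · rw [Polynomial.natDegree_divX_eq_natDegree_tsub_one]; omega
      · intro k; rw [Polynomial.coeff_divX]; exact hc _
      · rw [← h1, h3] at h
        simpa [hM.ne'] using h
    rw [← h1, h3, h4]; simp

open Polynomial in
lemma biv_mul_deg {L : Type*} [Field L] {A B : L[X][X]} {a b : ℕ}
    (hA : ∀ k, (A.coeff k).natDegree ≤ a) (hB : ∀ k, (B.coeff k).natDegree ≤ b) :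
    ∀ k, ((A * B).coeff k).natDegree ≤ a + b := by
  intro k
  rw [Polynomial.coeff_mul]
  apply Polynomial.natDegree_sum_le_of_forall_le
  intro i _
  exact Polynomial.natDegree_mul_le.trans (add_le_add (hA _) (hB _))

open Polynomial in
lemma square_of_mul_sq {L : Type*} [Field L] {D P R : L[X]} (hR : R ≠ 0)
    (h : P ^ 2 = D * R ^ 2) : IsSquare D := by
  have h1 : R ^ 2 ∣ P ^ 2 := ⟨D, by rw [h, mul_comm]⟩
  have h2 : R ∣ P := (IsIntegrallyClosed.pow_dvd_pow_iff two_ne_zero).1 h1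
  obtain ⟨g, rfl⟩ := h2
  refine ⟨g, ?_⟩
  have : R ^ 2 ≠ 0 := pow_ne_zero _ hR
  apply mul_right_cancel₀ this
  rw [← h]; ring

open Polynomial in
/-- Nonvanishing of the auxiliary polynomial. -/
lemma aux_ne_zero {L : Type*} [Field L] (p n e l m : ℕ) [Fact p.Prime] [CharP L p]
    (D : L[X]) (hD : D.Monic) (hdeg : D.natDegree = 2 * e) (hns : ¬ IsSquare D)
    (hM : 2 * l + 2 * e < p ^ n)
    (hodd : Odd (p ^ n))
    (P R : Fin m → L[X]) (hP : ∀ i, (P i).natDegree ≤ l) (hR : ∀ i, (R i).natDegree ≤ l)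
    (h : ∑ i : Fin m, (P i + R i * D ^ ((p ^ n + 1) / 2)) * X ^ ((i : ℕ) * p ^ n) = 0) :
    (∀ i, P i = 0) ∧ (∀ i, R i = 0) := by
  set M := p ^ n with hMdef
  have : ExpChar L p := ExpChar.prime Fact.out
  let PP : L[X][X] := ∑ i : Fin m, C (P i) * X ^ (i : ℕ)
  let RR : L[X][X] := ∑ i : Fin m, C (R i) * X ^ (i : ℕ)
  let DD : L[X][X] := (D.map (iterateFrobenius L p n)).map C
  have coeffs : ∀ (S : Fin m → L[X]) (j : Fin m),
      (∑ i : Fin m, C (S i) * X ^ (i : ℕ) : L[X][X]).coeff j = S j := by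
    intro S j
    simp [Polynomial.coeff_X_pow, Fin.val_inj]
  have degs : ∀ (S : Fin m → L[X]), (∀ i, (S i).natDegree ≤ l) → ∀ k,
      ((∑ i : Fin m, C (S i) * X ^ (i : ℕ) : L[X][X]).coeff k).natDegree ≤ l := by
    intro S hS k
    rw [Polynomial.finsetSum_coeff]
    apply Polynomial.natDegree_sum_le_of_forall_le
    intro i _
    rw [Polynomial.coeff_C_mul_X_pow]
    split_ifs
    · exact hS i
    · simp
  have hPP : PP.eval (X ^ M) = ∑ i : Fin m, P i * X ^ ((i : ℕ) * M) := by
    simp [PP, eval_finsetSum, ← pow_mul, mul_comm M]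
  have hRR : RR.eval (X ^ M) = ∑ i : Fin m, R i * X ^ ((i : ℕ) * M) := by
    simp [RR, eval_finsetSum, ← pow_mul, mul_comm M]
  have hDD : DD.eval (X ^ M) = D ^ M := by
    have := Polynomial.map_iterateFrobenius_expand p D n
    rw [← this, Polynomial.expand_eq_comp_X_pow, Polynomial.map_comp]
    simp [DD, Polynomial.eval_map, Polynomial.comp, hMdef]
  have hDDm : DD.Monic := (hD.map _).map _
  have hEM : (D ^ ((M + 1) / 2)) ^ 2 = D * D ^ M := by
    obtain ⟨k, hk⟩ := hodd
    rw [← pow_mul, ← pow_succ']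
    congr 1; omega
  have key : PP ^ 2 - C D * DD * RR ^ 2 = 0 := by
    apply biv_eval_ne M _ _ le_rfl
    · intro k
      have h1 : ((PP ^ 2).coeff k).natDegree ≤ l + l := by
        rw [pow_two]; exact biv_mul_deg (degs P hP) (degs P hP) k
      have h2 : ((C D * DD * RR ^ 2).coeff k).natDegree ≤ (2 * e + 0) + (l + l) := by
        refine biv_mul_deg (biv_mul_deg ?_ ?_) ?_ k
        · intro k; rw [coeff_C]; split_ifs <;> simp [hdeg]
        · intro k; simp [DD]
        · rw [pow_two]; exact biv_mul_deg (degs R hR) (degs R hR)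
      rw [coeff_sub]
      refine lt_of_le_of_lt (natDegree_sub_le _ _) ?_
      apply max_lt <;> omega
    · simp only [eval_sub, eval_pow, eval_mul, eval_C, hDD]
      have : PP.eval (X ^ M) + RR.eval (X ^ M) * D ^ ((M + 1) / 2) = 0 := by
        rw [hPP, hRR, ← h, Finset.sum_mul, ← Finset.sum_add_distrib]
        refine Finset.sum_congr rfl fun i _ => by ring
      rw [← hEM]
      linear_combination (PP.eval (X ^ M) - RR.eval (X ^ M) * D ^ ((M + 1) / 2)) * this
  have hRR0 : RR = 0 := by
    by_contra hne
    apply hns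
    apply square_of_mul_sq (P := PP.leadingCoeff) (leadingCoeff_ne_zero.2 hne)
    rw [← leadingCoeff_pow, sub_eq_zero.1 key, leadingCoeff_mul, leadingCoeff_mul,
      leadingCoeff_C, hDDm.leadingCoeff, leadingCoeff_pow, mul_one]
  have hPP0 : PP = 0 := by
    rw [hRR0] at key
    simpa using key
  exact ⟨fun i => by rw [← coeffs P i]; show PP.coeff i = 0; simp [hPP0],
    fun i => by rw [← coeffs R i]; show RR.coeff i = 0; simp [hRR0]⟩

open Polynomial in
lemma exists_aux {L : Type*} [Field L] (M e l m : ℕ) (E : L[X]) (hE : E.natDegree ≤ e * (M + 1))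
    (hm : 0 < m)
    (hcount : l * M + e * (M + 1) + m < 2 * (l * m)) (ε : L) :
    ∃ P R : Fin m → L[X], (∀ i, (P i).natDegree ≤ l) ∧ (∀ i, (R i).natDegree ≤ l) ∧
      ¬ ((∀ i, P i = 0) ∧ (∀ i, R i = 0)) ∧
      ∑ i : Fin m, (expand L M (P i) + C ε * (expand L M (R i) * E)) * X ^ (i : ℕ) = 0 := by
  let N := l * M + e * (M + 1) + m
  let T : ((Fin m → degreeLT L l) × (Fin m → degreeLT L l)) →ₗ[L] (Fin N → L) :=
    { toFun := fun v k => (∑ i : Fin m, (expand L M (v.1 i : L[X]) +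
        C ε * (expand L M (v.2 i : L[X]) * E)) * X ^ (i : ℕ)).coeff k
      map_add' := by
        intro v w
        funext k
        rw [Pi.add_apply, ← coeff_add, ← Finset.sum_add_distrib]
        congr 1
        refine Finset.sum_congr rfl fun i _ => ?_
        simp
        ring
      map_smul' := by
        intro a v
        funext k
        simp only [Pi.smul_apply, RingHom.id_apply]
        rw [← coeff_smul, Finset.smul_sum]
        congr 1
        refine Finset.sum_congr rfl fun i _ => ?_
        simp [smul_eq_C_mul]
        ring }
  have e1 : Module.finrank L (degreeLT L l) = l := by
    rw [(degreeLTEquiv L l).finrank_eq]; simp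
  have hfin : Module.Finite L (degreeLT L l) := Module.Finite.equiv (degreeLTEquiv L l).symm
  have hk : LinearMap.ker T ≠ ⊥ := by
    apply LinearMap.ker_ne_bot_of_finrank_lt
    have e2 : Module.finrank L (Fin m → degreeLT L l) = m * l := by
      rw [Module.finrank_pi_fintype]; simp [e1]
    rw [Module.finrank_prod, e2, Module.finrank_fintype_fun_eq_card, Fintype.card_fin]
    simp only [N]
    nlinarith
  obtain ⟨v, hv, hv0⟩ := (Submodule.ne_bot_iff _).1 hk
  have hdeg : ∀ p : degreeLT L l, (p : L[X]).natDegree ≤ l := fun p =>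
    natDegree_le_of_degree_le (mem_degreeLT.1 p.2).le
  refine ⟨fun i => v.1 i, fun i => v.2 i, fun i => hdeg _, fun i => hdeg _, ?_, ?_⟩
  · rintro ⟨h1, h2⟩
    apply hv0
    refine Prod.ext ?_ ?_
    · funext i; exact Subtype.ext (h1 i)
    · funext i; exact Subtype.ext (h2 i)
  · ext k
    by_cases hkN : k < N
    · exact congrFun (LinearMap.mem_ker.1 hv) ⟨k, hkN⟩
    · rw [coeff_zero]
      apply coeff_eq_zero_of_natDegree_lt
      refine lt_of_le_of_lt ?_ (lt_of_lt_of_le (?_ : N - 1 < N) (not_lt.1 hkN))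
      · apply natDegree_sum_le_of_forall_le
        intro i _
        have hi := i.2
        have h1 : (expand L M (v.1 i : L[X])).natDegree ≤ l * M := by
          rw [natDegree_expand]; exact Nat.mul_le_mul_right _ (hdeg _)
        have h2 : (expand L M (v.2 i : L[X])).natDegree ≤ l * M := by
          rw [natDegree_expand]; exact Nat.mul_le_mul_right _ (hdeg _)
        have h3 : (C ε * (expand L M (v.2 i : L[X]) * E)).natDegree ≤ l * M + e * (M + 1) :=
          (natDegree_C_mul_le _ _).trans (natDegree_mul_le.trans (add_le_add h2 hE))
        have h4 := natDegree_add_le_of_degree_le (h1.trans (Nat.le_add_right _ _)) h3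
        refine (natDegree_mul_le.trans (add_le_add h4 (natDegree_X_pow_le _))).trans ?_
        simp only [N]
        omega
      · simp only [N]; omega

open Polynomial in
lemma stepanov {L : Type*} [Field L] [Fintype L] [DecidableEq L] (p n e : ℕ) [Fact p.Prime]
    [CharP L p]
    (hcard : Fintype.card L = (p ^ n) ^ 2) (hodd : Odd (p ^ n)) (he : 1 ≤ e)
    (hbig : 8 * e + 8 ≤ p ^ n)
    (D : L[X]) (hD : D.Monic) (hdeg : D.natDegree = 2 * e) (hns : ¬ IsSquare D)
    (ε : L) :
    2 * (Finset.univ.filter fun y : L => (D.eval y) ^ (Fintype.card L / 2) = ε).card ≤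
      (p ^ n) ^ 2 + (6 * e + 2) * p ^ n := by
  have : ExpChar L p := ExpChar.prime Fact.out
  set M := p ^ n with hMdef
  obtain ⟨k, hk⟩ := hodd
  obtain ⟨l, hl⟩ : ∃ l, l + e = k := ⟨k - e, by omega⟩
  set m := k + 1 + 2 * e with hm
  have hk2 : (M + 1) / 2 = k + 1 := by omega
  set E := D ^ (k + 1) with hEdef
  have hE : E.natDegree ≤ e * (M + 1) := by
    rw [hEdef, hD.natDegree_pow, hdeg, hk]; apply le_of_eq; ring
  have hcount : l * M + e * (M + 1) + m < 2 * (l * m) := by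
    rw [hm, hk]; subst hl
    have : 3 * e + 3 ≤ l := by omega
    nlinarith
  obtain ⟨P, R, hP, hR, hne, hW⟩ := exists_aux M e l m E hE (by omega) hcount ε
  let φ := iterateFrobenius L p n
  have hφ : ∀ x, φ x = x ^ M := fun x => iterateFrobenius_def p n x
  have hφφ : ∀ x, φ (φ x) = x := fun x => by
    rw [hφ, hφ, ← pow_mul, ← pow_two, ← hcard, FiniteField.pow_card]
  set H : L[X] := ∑ i : Fin m, ((P i).map φ + (R i).map φ * E) * X ^ ((i : ℕ) * M) with hHdef
  have hH : H ≠ 0 := by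
    intro h0
    apply hne
    have := aux_ne_zero p n e l m D hD hdeg hns (by omega) ⟨k, hk⟩
      (fun i => (P i).map φ) (fun i => (R i).map φ)
      (fun i => natDegree_map_le.trans (hP i))
      (fun i => natDegree_map_le.trans (hR i))
      (by rw [← hMdef, hk2]; exact h0)
    simpa [Polynomial.map_eq_zero] using this
  have hHdeg : H.natDegree ≤ l + e * (M + 1) + m * M := by
    apply natDegree_sum_le_of_forall_le
    intro i _
    have h1 : ((R i).map φ * E).natDegree ≤ l + e * (M + 1) :=
      natDegree_mul_le.trans (add_le_add (natDegree_map_le.trans (hR i)) hE)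
    have h2 := natDegree_add_le_of_degree_le
      ((natDegree_map_le (f := φ)).trans ((hP i).trans (Nat.le_add_right _ (e * (M + 1))))) h1
    refine natDegree_mul_le.trans (add_le_add h2 ((natDegree_X_pow_le _).trans ?_))
    exact Nat.mul_le_mul_right _ i.2.le
  have hsub : (Finset.univ.filter fun y : L => (D.eval y) ^ (Fintype.card L / 2) = ε) ⊆
      H.roots.toFinset := by
    intro y hy
    rw [Finset.mem_filter] at hy
    rw [Multiset.mem_toFinset, mem_roots hH, IsRoot]
    have hy2 := hy.2
    apply φ.injective
    rw [map_zero]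
    have hEy : φ (E.eval y) = ε * E.eval y := by
      rw [hφ, hEdef, eval_pow, ← pow_mul, ← hy2, ← pow_add]
      congr 1
      have : Fintype.card L / 2 = 2 * k ^ 2 + 2 * k := by
        rw [hcard, hk]
        have : (2 * k + 1) ^ 2 = 2 * (2 * k ^ 2 + 2 * k) + 1 := by ring
        omega
      rw [this, hk]; ring
    have h0 := congrArg (eval y) hW
    rw [eval_zero] at h0
    rw [← h0, hHdef, eval_finsetSum, eval_finsetSum, map_sum]
    refine Finset.sum_congr rfl fun i _ => ?_
    have ev : ∀ q : L[X], φ ((q.map φ).eval y) = q.eval (y ^ M) := by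
      intro q
      have h1 : q.eval (y ^ M) = ((q.map φ).map φ).eval (φ y) := by
        rw [Polynomial.map_map, hφ]
        congr 1
        ext j; simp [hφφ]
      rw [h1, eval_map_apply]
    simp only [eval_mul, eval_add, map_mul, map_add, ev, hEy, expand_eval, eval_C, eval_pow,
      eval_X]
    have : φ (y ^ ((i : ℕ) * M)) = y ^ (i : ℕ) := by
      rw [mul_comm, pow_mul, ← hφ, map_pow, hφφ]
    rw [this]
    ring
  have hc := (Finset.card_le_card hsub).trans
    ((Multiset.toFinset_card_le _).trans (card_roots' H))
  have := hc.trans hHdeg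
  have h3 : 2 * (l + e * (M + 1) + m * M) ≤ M ^ 2 + (6 * e + 2) * M := by
    rw [hm, hk]; subst hl; ring_nf; nlinarith
  omega

open Polynomial in
lemma charsum_bound {L : Type*} [Field L] [Fintype L] [DecidableEq L] (p n e : ℕ) [Fact p.Prime]
    [CharP L p]
    (hcard : Fintype.card L = (p ^ n) ^ 2) (hodd : Odd (p ^ n)) (he : 1 ≤ e)
    (hchar : ringChar L ≠ 2)
    (hbig : 8 * e + 8 ≤ p ^ n)
    (D : L[X]) (hD : D.Monic) (hdeg : D.natDegree = 2 * e) (hns : ¬ IsSquare D) :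
    |∑ y : L, quadraticChar L (D.eval y)| ≤ (8 * e + 2) * (p ^ n : ℕ) := by
  have h1 := stepanov p n e hcard hodd he hbig D hD hdeg hns 1
  have h2 := stepanov p n e hcard hodd he hbig D hD hdeg hns (-1)
  set a := (Finset.univ.filter fun y : L => quadraticChar L (D.eval y) = 1).card with ha
  set b := (Finset.univ.filter fun y : L => quadraticChar L (D.eval y) = -1).card with hb
  set z := (Finset.univ.filter fun y : L => quadraticChar L (D.eval y) = 0).card with hz
  have ha' : a ≤ (Finset.univ.filter fun y : L => (D.eval y) ^ (Fintype.card L / 2) = 1).card := by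
    apply Finset.card_le_card
    intro y hy
    simp only [Finset.mem_filter, Finset.mem_univ, true_and] at hy ⊢
    rw [← quadraticChar_eq_pow_of_char_ne_two' hchar, hy]; simp
  have hb' : b ≤ (Finset.univ.filter fun y : L => (D.eval y) ^ (Fintype.card L / 2) = -1).card := by
    apply Finset.card_le_card
    intro y hy
    simp only [Finset.mem_filter, Finset.mem_univ, true_and] at hy ⊢
    rw [← quadraticChar_eq_pow_of_char_ne_two' hchar, hy]; simp
  have hz' : z ≤ 2 * e := by
    rw [← hdeg]
    refine le_trans (Finset.card_le_card ?_)
      ((Multiset.toFinset_card_le D.roots).trans (card_roots' D))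
    intro y hy
    simp only [Finset.mem_filter, Finset.mem_univ, true_and, quadraticChar_eq_zero_iff] at hy
    rw [Multiset.mem_toFinset, mem_roots hD.ne_zero]
    exact hy
  have key : ∀ t : ℤ, (t = 0 ∨ t = 1 ∨ t = -1) →
      t = (if t = 1 then 1 else 0) - (if t = -1 then 1 else 0) ∧
      (1 : ℤ) = (if t = 1 then 1 else 0) + (if t = -1 then 1 else 0) + (if t = 0 then 1 else 0) := by
    rintro t (rfl | rfl | rfl) <;> simp
  have hsum : ∑ y : L, quadraticChar L (D.eval y) = (a : ℤ) - b := by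
    rw [Finset.sum_congr rfl fun y _ =>
      (key _ (quadraticChar_isQuadratic L (D.eval y))).1, Finset.sum_sub_distrib]
    simp [ha, hb]
  have htot : (Fintype.card L : ℤ) = a + b + z := by
    have : (Fintype.card L : ℤ) = ∑ y : L, (1 : ℤ) := by simp
    rw [this, Finset.sum_congr rfl fun y _ =>
      (key _ (quadraticChar_isQuadratic L (D.eval y))).2, Finset.sum_add_distrib,
      Finset.sum_add_distrib]
    simp [ha, hb, hz]
  rw [hcard] at htot
  rw [hsum, abs_le]
  generalize p ^ n = M at *
  zify at *
  constructor <;> nlinarith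

open Polynomial in
lemma D_props {L : Type*} [Field L] (q : ℕ) (hq : 2 ≤ q) (u c : L) (hc : c ≠ 0)
    (h2 : (2 : L) ≠ 0) :
    ((X ^ q - X + C u) ^ 2 - C (4 * c) : L[X]).Monic ∧
    ((X ^ q - X + C u) ^ 2 - C (4 * c) : L[X]).natDegree = 2 * q ∧
    ¬ IsSquare ((X ^ q - X + C u) ^ 2 - C (4 * c) : L[X]) := by
  have hU : (X ^ q - X + C u : L[X]).Monic := by
    rw [sub_add]
    apply monic_X_pow_sub
    exact lt_of_le_of_lt (degree_X_sub_C_le u) (by exact_mod_cast hq)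
  have hUd : (X ^ q - X + C u : L[X]).natDegree = q := by
    rw [sub_add, natDegree_sub_eq_left_of_natDegree_lt, natDegree_X_pow]
    rw [natDegree_X_pow, natDegree_X_sub_C]; omega
  set U : L[X] := X ^ q - X + C u
  have hU2 : (U ^ 2).natDegree = 2 * q := by rw [hU.natDegree_pow, hUd]
  refine ⟨?_, ?_, ?_⟩
  · apply (hU.pow 2).sub_of_left
    apply degree_lt_degree
    rw [hU2, natDegree_C]; omega
  · rw [natDegree_sub_C, hU2]
  · rintro ⟨g, hg⟩
    have h4 : (4 * c) ≠ 0 := mul_ne_zero (by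
      have : (4 : L) = 2 * 2 := by norm_num
      rw [this]; exact mul_ne_zero h2 h2) hc
    have h : (U - g) * (U + g) = C (4 * c) := by linear_combination hg
    have hu : IsUnit ((U - g) * (U + g)) := by rw [h]; exact isUnit_C.2 h4.isUnit
    have d1 := natDegree_eq_zero_of_isUnit (isUnit_of_mul_isUnit_left hu)
    have d2 := natDegree_eq_zero_of_isUnit (isUnit_of_mul_isUnit_right hu)
    have d3 : (C 2 * U).natDegree = q := by rw [natDegree_C_mul h2, hUd]
    have d4 : (C 2 * U) = (U - g) + (U + g) := by rw [C_ofNat]; ring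
    have := natDegree_add_le_of_degree_le d1.le d2.le
    rw [← d4, d3] at this
    omega

lemma card_quadratic {L : Type*} [Field L] [Fintype L] [DecidableEq L] (hchar : ringChar L ≠ 2)
    (A B C : L) (hA : A ≠ 0) :
    ((Finset.univ.filter fun x : L => A * x ^ 2 + B * x + C = 0).card : ℤ) =
      quadraticChar L (B ^ 2 - 4 * A * C) + 1 := by
  have h2 : (2 : L) ≠ 0 := Ring.two_ne_zero hchar
  rw [← quadraticChar_card_sqrts hchar]
  congr 1
  apply Finset.card_nbij' (fun x => 2 * A * x + B) (fun z => (z - B) / (2 * A))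
  · intro x hx
    simp at hx ⊢
    linear_combination 4 * A * hx
  · intro z hz
    simp at hz ⊢
    field_simp
    linear_combination hz
  · intro x _; field_simp; ring
  · intro x _; field_simp; ring

/-- Kloosterman sum. -/
noncomputable def Kl {L : Type*} [Field L] [Fintype L] [DecidableEq L] (ψ : AddChar L ℂ) (c : L) : ℂ :=
  ∑ x : L, if x = 0 then 0 else ψ (x + c / x)

lemma count_xcx {L : Type*} [Field L] [Fintype L] [DecidableEq L] (hchar : ringChar L ≠ 2)
    (g : L → ℂ) (c : L) (hc : c ≠ 0) :
    (∑ x : L, if x = 0 then 0 else g (x + c / x)) =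
      ∑ u : L, ((quadraticChar L (u ^ 2 - 4 * c) : ℂ) + 1) * g u := by
  have h : ∀ u : L, ((quadraticChar L (u ^ 2 - 4 * c) : ℂ) + 1) * g u =
      ∑ x : L, if 1 * x ^ 2 + (-u) * x + c = 0 then g u else 0 := by
    intro u
    have := card_quadratic hchar 1 (-u) c one_ne_zero
    have h2 : ((Finset.univ.filter fun x : L => 1 * x ^ 2 + (-u) * x + c = 0).card : ℂ) =
      (quadraticChar L (u ^ 2 - 4 * c) : ℂ) + 1 := by
      rw [neg_sq, mul_one] at this
      exact_mod_cast this
    rw [← h2, ← Finset.sum_filter, Finset.sum_const, nsmul_eq_mul]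
  rw [Finset.sum_congr rfl fun u _ => h u, Finset.sum_comm]
  refine Finset.sum_congr rfl fun x _ => ?_
  by_cases hx : x = 0
  · simp [hx, hc]
  · rw [if_neg hx, Finset.sum_eq_single (x + c / x)]
    · rw [if_pos]; field_simp; ring
    · intro u _ hu
      rw [if_neg]
      intro h0
      apply hu
      field_simp
      linear_combination -h0
    · simp

lemma Kl_eq {L : Type*} [Field L] [Fintype L] [DecidableEq L] (hchar : ringChar L ≠ 2)
    (ψ : AddChar L ℂ) (hψ : ψ ≠ 1) (c : L) (hc : c ≠ 0) :
    Kl ψ c = ∑ u : L, (quadraticChar L (u ^ 2 - 4 * c) : ℂ) * ψ u := by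
  rw [Kl, count_xcx hchar _ c hc]
  simp only [add_mul, one_mul, Finset.sum_add_distrib, AddChar.sum_eq_zero_of_ne_one hψ, add_zero]

lemma jacobsthal {L : Type*} [Field L] [Fintype L] [DecidableEq L] (hchar : ringChar L ≠ 2)
    (c : L) (hc : c ≠ 0) :
    ∑ u : L, (quadraticChar L (u ^ 2 - 4 * c) : ℤ) = -1 := by
  have h := count_xcx hchar (fun _ => 1) c hc
  have h1 : (∑ x : L, if x = 0 then (0 : ℂ) else 1) = Fintype.card L - 1 := by
    have : ∀ x : L, (if x = 0 then (0 : ℂ) else 1) = 1 - if x = 0 then 1 else 0 := by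
      intro x; split_ifs <;> simp
    simp [this]
  rw [h1] at h
  simp only [mul_one, Finset.sum_add_distrib, Finset.sum_const, Finset.card_univ, nsmul_eq_mul] at h
  have : ((∑ u : L, (quadraticChar L (u ^ 2 - 4 * c) : ℤ) : ℤ) : ℂ) = ((-1 : ℤ) : ℂ) := by
    push_cast
    linear_combination -h
  exact_mod_cast this

/-- lifted character -/
noncomputable def lift (k L : Type*) [Field k] [Field L] [Algebra k L] (ψ : AddChar k ℂ) :
    AddChar L ℂ := ψ.compAddMonoidHom (Algebra.trace k L).toAddMonoidHom

lemma lift_apply (k L : Type*) [Field k] [Field L] [Algebra k L] (ψ : AddChar k ℂ) (x : L) :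
    lift k L ψ x = ψ (Algebra.trace k L x) := rfl

lemma lift_ne_one (k L : Type*) [Field k] [Field L] [Algebra k L] [Finite k] [Finite L]
    (ψ : AddChar k ℂ) (hψ : ψ ≠ 1) : lift k L ψ ≠ 1 := by
  obtain ⟨x, hx⟩ := AddChar.ne_one_iff.1 hψ
  obtain ⟨y, rfl⟩ := Algebra.trace_surjective k L x
  exact AddChar.ne_one_iff.2 ⟨y, hx⟩

open Polynomial in
lemma Kl_bound (k L : Type*) [Field k] [Fintype k] [Field L] [Fintype L] [DecidableEq L]
    [Algebra k L] (ψ : AddChar k ℂ) (hψ : ψ ≠ 1) (c : L) (hc : c ≠ 0)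
    (p n : ℕ) [Fact p.Prime] [CharP L p]
    (hcard : Fintype.card L = (p ^ n) ^ 2) (hodd : Odd (p ^ n))
    (hchar : ringChar L ≠ 2) (hbig : 8 * Fintype.card k + 8 ≤ p ^ n) :
    ‖Kl (lift k L ψ) c‖ ≤ (8 * Fintype.card k + 2) * (p ^ n : ℕ) := by
  set q := Fintype.card k with hq
  have hq2 : 2 ≤ q := Fintype.one_lt_card
  have htr : ∀ y : L, Algebra.trace k L (y ^ q - y) = 0 := by
    intro y
    have := Algebra.trace_eq_of_algEquiv (FiniteField.frobeniusAlgEquivOfAlgebraic k L) y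
    rw [FiniteField.coe_frobeniusAlgEquivOfAlgebraic] at this
    rw [map_sub, sub_eq_zero]
    exact this
  rw [Kl_eq hchar _ (lift_ne_one k L ψ hψ) c hc]
  set K := ∑ u : L, (quadraticChar L (u ^ 2 - 4 * c) : ℂ) * (lift k L ψ) u with hK
  have h1 : ∀ y : L, K = ∑ u : L,
      (quadraticChar L ((y ^ q - y + u) ^ 2 - 4 * c) : ℂ) * (lift k L ψ) u := by
    intro y
    rw [hK, ← Equiv.sum_comp (Equiv.addLeft (y ^ q - y))]
    refine Finset.sum_congr rfl fun u _ => ?_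
    simp only [Equiv.coe_addLeft]
    congr 1
    rw [lift_apply, map_add, htr, zero_add, lift_apply]
  have h2 : (Fintype.card L : ℂ) * K = ∑ u : L,
      ((∑ y : L, quadraticChar L ((y ^ q - y + u) ^ 2 - 4 * c) : ℤ) : ℂ) * (lift k L ψ) u := by
    have : (Fintype.card L : ℂ) * K = ∑ y : L, K := by simp
    rw [this, Finset.sum_congr rfl fun y _ => h1 y, Finset.sum_comm]
    refine Finset.sum_congr rfl fun u _ => ?_
    push_cast
    rw [Finset.sum_mul]
  have h3 : (Fintype.card L : ℝ) * ‖K‖ ≤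
      Fintype.card L * ((8 * q + 2) * (p ^ n : ℕ)) := by
    have h4 : ‖(Fintype.card L : ℂ) * K‖ = (Fintype.card L : ℝ) * ‖K‖ := by simp
    rw [← h4, h2]
    refine (norm_sum_le _ _).trans ?_
    have h5 : ∀ u ∈ (Finset.univ : Finset L),
        ‖((∑ y : L, quadraticChar L ((y ^ q - y + u) ^ 2 - 4 * c) : ℤ) : ℂ) * (lift k L ψ) u‖ ≤
        ((8 * q + 2) * (p ^ n : ℕ) : ℝ) := by
      intro u _
      rw [norm_mul, AddChar.norm_apply, mul_one, Complex.norm_intCast]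
      obtain ⟨a1, a2, a3⟩ := D_props q hq2 u c hc (Ring.two_ne_zero hchar)
      have := charsum_bound p n q hcard hodd (by omega) hchar hbig _ a1 a2 a3
      simp only [eval_sub, eval_pow, eval_add, eval_X, eval_C] at this
      exact_mod_cast this
    refine (Finset.sum_le_sum h5).trans ?_
    simp
  exact le_of_mul_le_mul_left h3 (by exact_mod_cast Fintype.card_pos)

lemma sum_sq_nonsq {L : Type*} [Field L] [Fintype L] [DecidableEq L] (hchar : ringChar L ≠ 2)
    (η : L) (hη : ¬ IsSquare η) (G : L → ℂ) :
    ∑ v : L, G (v ^ 2) + ∑ v : L, G (η * v ^ 2) = 2 * ∑ w : L, G w := by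
  have hη0 : η ≠ 0 := by rintro rfl; exact hη (IsSquare.zero)
  have hs : ∀ A : L, A ≠ 0 → ∑ v : L, G (A * v ^ 2) =
      ∑ w : L, ((quadraticChar L (A * w) : ℂ) + 1) * G w := by
    intro A hA
    have h : ∀ w : L, ((quadraticChar L (A * w) : ℂ) + 1) * G w =
        ∑ v : L, if A * v ^ 2 + 0 * v + (-w) = 0 then G w else 0 := by
      intro w
      have := card_quadratic hchar A 0 (-w) hA
      have h2 : ((Finset.univ.filter fun v : L => A * v ^ 2 + 0 * v + (-w) = 0).card : ℂ) =
        (quadraticChar L (A * w) : ℂ) + 1 := by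
        have e : (0 : L) ^ 2 - 4 * A * (-w) = 2 ^ 2 * (A * w) := by ring
        rw [e, map_mul, quadraticChar_sq_one' (Ring.two_ne_zero hchar), one_mul] at this
        exact_mod_cast this
      rw [← h2, ← Finset.sum_filter, Finset.sum_const, nsmul_eq_mul]
    rw [Finset.sum_congr rfl fun w _ => h w, Finset.sum_comm]
    refine Finset.sum_congr rfl fun v _ => ?_
    rw [Finset.sum_eq_single (A * v ^ 2)]
    · rw [if_pos]; ring
    · intro w _ hw
      rw [if_neg]
      intro h0
      exact hw (by linear_combination -h0)
    · simp
  have h1 := hs 1 one_ne_zero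
  have h2 := hs η hη0
  simp only [one_mul] at h1
  rw [h1, h2, ← Finset.sum_add_distrib, Finset.mul_sum]
  refine Finset.sum_congr rfl fun w _ => ?_
  rw [map_mul, quadraticChar_neg_one_iff_not_isSquare.2 hη]
  push_cast
  ring

/-- The common summand as a function of half-trace and norm. -/
lemma sum_main {L : Type*} [Field L] [Fintype L] [DecidableEq L] (hchar : ringChar L ≠ 2)
    (ψ : AddChar L ℂ) (hψ : ψ ≠ 1) (c : L) (hc : c ≠ 0) :
    (∑ u : L, ∑ w : L, if u ^ 2 - w = 0 then 0 else ψ (2 * u + c * (2 * u) / (u ^ 2 - w))) =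
      Fintype.card L := by
  have h2 : (2 : L) ≠ 0 := Ring.two_ne_zero hchar
  have h1 : ∀ u : L, (∑ w : L, if u ^ 2 - w = 0 then 0
      else ψ (2 * u + c * (2 * u) / (u ^ 2 - w))) =
      ∑ t : L, if t = 0 then 0 else ψ (2 * u + c * (2 * u) / t) := by
    intro u
    exact Equiv.sum_comp (Equiv.subLeft (u ^ 2))
      (fun t => if t = 0 then (0 : ℂ) else ψ (2 * u + c * (2 * u) / t))
  rw [Finset.sum_congr rfl fun u _ => h1 u, Finset.sum_comm]
  rw [Finset.sum_eq_single (-c)]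
  · simp only [neg_eq_zero, hc, if_false]
    rw [Finset.sum_congr rfl (g := fun _ => (1 : ℂ))]
    · simp
    · intro u _
      have : 2 * u + c * (2 * u) / -c = 0 := by field_simp; ring
      rw [this, AddChar.map_zero_eq_one]
  · intro t _ ht
    by_cases h0 : t = 0
    · simp [h0]
    · simp only [h0, if_false]
      have hne : 2 * (1 + c / t) ≠ 0 := by
        refine mul_ne_zero h2 ?_
        intro h
        apply ht
        field_simp at h
        linear_combination h
      have hp : AddChar.mulShift ψ (2 * (1 + c / t)) ≠ 1 := (AddChar.IsPrimitive.of_ne_one hψ) hne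
      rw [← AddChar.sum_eq_zero_of_ne_one hp]
      refine Finset.sum_congr rfl fun u _ => ?_
      rw [AddChar.mulShift_apply]
      congr 1
      field_simp
  · simp

lemma Kl_sq {L : Type*} [Field L] [Fintype L] [DecidableEq L] (hchar : ringChar L ≠ 2)
    (ψ : AddChar L ℂ) (c : L) :
    Kl ψ c ^ 2 = ∑ u : L, ∑ v : L, if u ^ 2 - v ^ 2 = 0 then 0 else
      ψ (2 * u + c * (2 * u) / (u ^ 2 - v ^ 2)) := by
  have h2 : (2 : L) ≠ 0 := Ring.two_ne_zero hchar
  rw [pow_two, Kl, Finset.sum_mul_sum, ← Fintype.sum_prod_type', ← Fintype.sum_prod_type']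
  let e : L × L ≃ L × L :=
    { toFun := fun z => (z.1 + z.2, z.1 - z.2)
      invFun := fun z => ((z.1 + z.2) / 2, (z.1 - z.2) / 2)
      left_inv := by
        rintro ⟨x, y⟩
        ext <;> simp <;> field_simp <;> ring
      right_inv := by
        rintro ⟨x, y⟩
        ext <;> simp <;> field_simp <;> ring }
  rw [← Equiv.sum_comp e]
  refine Finset.sum_congr rfl fun z _ => ?_
  obtain ⟨u, v⟩ := z
  simp only [e, Equiv.coe_fn_mk]
  have hf : u ^ 2 - v ^ 2 = (u + v) * (u - v) := by ring
  by_cases h3 : u + v = 0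
  · simp [hf, h3]
  by_cases h4 : u - v = 0
  · simp [hf, h4]
  rw [if_neg h3, if_neg h4, if_neg (by rw [hf]; exact mul_ne_zero h3 h4), ← AddChar.map_add_eq_mul]
  congr 1
  rw [hf]
  field_simp
  ring

lemma quad_trace {L : Type*} [Field L] (η : L) (z : QuadraticAlgebra L η 0) :
    Algebra.trace L (QuadraticAlgebra L η 0) z = 2 * z.re := by
  rw [Algebra.trace_eq_matrix_trace (QuadraticAlgebra.basis η 0), Matrix.trace_fin_two,
    Algebra.leftMulMatrix_eq_repr_mul, Algebra.leftMulMatrix_eq_repr_mul]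
  simp [QuadraticAlgebra.basis]
  ring

lemma quad_step (k : Type) [Field k] (ψ : AddChar k ℂ) (c : k) (hc : c ≠ 0) [Finite k]
    (hψ : ψ ≠ 1)
    (L : Type) [Field L] [Fintype L] [DecidableEq L] [Algebra k L] (hchar : ringChar L ≠ 2) :
    ∃ (L' : Type) (_ : Field L') (_ : Fintype L') (_ : DecidableEq L') (_ : Algebra k L'),
      Fintype.card L' = Fintype.card L ^ 2 ∧
      Kl (lift k L' ψ) (algebraMap k L' c) =
        2 * Fintype.card L - Kl (lift k L ψ) (algebraMap k L c) ^ 2 := by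
  obtain ⟨η, hη⟩ := FiniteField.exists_nonsquare hchar
  have hfact : Fact (∀ r : L, r ^ 2 ≠ η + 0 * r) := ⟨fun r hr => hη ⟨r, by
    rw [← pow_two, hr]; ring⟩⟩
  let e := QuadraticAlgebra.equivProd η (0 : L)
  let ft : Fintype (QuadraticAlgebra L η 0) := Fintype.ofEquiv _ e.symm
  let de : DecidableEq (QuadraticAlgebra L η 0) := Classical.decEq _
  refine ⟨QuadraticAlgebra L η 0, inferInstance, ft, de, inferInstance, ?_, ?_⟩
  · rw [Fintype.card_congr e, Fintype.card_prod, pow_two]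
  · set c' := algebraMap k L c with hc'
    have hc'0 : c' ≠ 0 := by simpa [hc'] using hc
    have h1 := sum_main hchar (lift k L ψ) (lift_ne_one k L ψ hψ) c' hc'0
    have h2 := Kl_sq hchar (lift k L ψ) c'
    have h3 : Kl (lift k (QuadraticAlgebra L η 0) ψ) (algebraMap k (QuadraticAlgebra L η 0) c) =
        ∑ u : L, ∑ v : L, if u ^ 2 - η * v ^ 2 = 0 then 0 else
        lift k L ψ (2 * u + c' * (2 * u) / (u ^ 2 - η * v ^ 2)) := by
      rw [Kl, ← Fintype.sum_prod_type', ← Equiv.sum_comp e.symm]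
      refine Finset.sum_congr rfl fun z _ => ?_
      obtain ⟨u, v⟩ := z
      set z : QuadraticAlgebra L η 0 := e.symm (u, v) with hz
      have hzn : z.norm = u ^ 2 - η * v ^ 2 := by
        simp [hz, e, QuadraticAlgebra.norm_def]; ring
      have hz0 : z = 0 ↔ u ^ 2 - η * v ^ 2 = 0 := by
        rw [← hzn]; exact QuadraticAlgebra.norm_eq_zero_iff_eq_zero.symm
      by_cases h0 : z = 0
      · rw [if_pos h0, if_pos (hz0.1 h0)]
      rw [if_neg h0, if_neg (mt hz0.2 h0), lift_apply, lift_apply,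
        ← Algebra.trace_trace (S := L), quad_trace]
      congr 2
      rw [IsScalarTower.algebraMap_apply k L (QuadraticAlgebra L η 0) c, ← hc',
        div_eq_mul_inv, ← Algebra.smul_def]
      simp [QuadraticAlgebra.re_inv, hzn]
      simp [hz, e]
      ring
    rw [h3, h2, ← h1, eq_sub_iff_add_eq, ← Finset.sum_add_distrib, Finset.mul_sum]
    refine Finset.sum_congr rfl fun u _ => ?_
    rw [add_comm]
    exact sum_sq_nonsq hchar η hη (fun w => if u ^ 2 - w = 0 then 0 else
      lift k L ψ (2 * u + c' * (2 * u) / (u ^ 2 - w)))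

lemma tower (k : Type) [Field k] [Fintype k] [DecidableEq k] (hk : Odd (Fintype.card k))
    (ψ : AddChar k ℂ) (c : k) (hc : c ≠ 0)
    (hψ : ψ ≠ 1) (t : ℝ) (ht : 0 ≤ t)
    (h : ‖Kl ψ c‖ ≥ (2 + t) * Real.sqrt (Fintype.card k)) (m : ℕ) :
    ∃ (L : Type) (_ : Field L) (_ : Fintype L) (_ : DecidableEq L) (_ : Algebra k L),
      Fintype.card L = Fintype.card k ^ (2 ^ m) ∧
      ‖Kl (lift k L ψ) (algebraMap k L c)‖ ≥ (2 + 4 ^ m * t) * Real.sqrt (Fintype.card L) := by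
  induction m with
  | zero =>
    refine ⟨k, inferInstance, inferInstance, inferInstance, inferInstance, by simp, ?_⟩
    have : lift k k ψ = ψ := by ext x; rw [lift_apply]; simp
    rw [this]
    simpa using h
  | succ m ih =>
    obtain ⟨L, i1, i2, i3, i4, hcard, hK⟩ := ih
    have hchar : ringChar L ≠ 2 := by
      intro h2
      have := FiniteField.even_card_iff_char_two.1 h2
      have h3 := hk.pow (n := 2 ^ m)
      rw [← hcard] at h3
      rw [Nat.odd_iff] at h3
      omega
    obtain ⟨L', j1, j2, j3, j4, hcard', hK'⟩ := quad_step k ψ c hc hψ L hchar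
    refine ⟨L', j1, j2, j3, j4, ?_, ?_⟩
    · rw [hcard', hcard, ← pow_mul, pow_succ]
    · rw [hK', hcard']
      set Q : ℝ := (Fintype.card L : ℝ)
      have hQ : 0 ≤ Q := by positivity
      have e1 : Real.sqrt ((Fintype.card L ^ 2 : ℕ) : ℝ) = Q := by
        push_cast; exact Real.sqrt_sq hQ
      rw [e1]
      set x := Kl (lift k L ψ) (algebraMap k L c)
      have h1 : ‖x‖ ^ 2 ≥ (2 + 4 ^ m * t) ^ 2 * Q := by
        have := pow_le_pow_left₀ (by positivity) hK 2
        rwa [mul_pow, Real.sq_sqrt hQ] at this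
      have h2 : ‖(2 * (Fintype.card L : ℂ) - x ^ 2)‖ ≥ ‖x‖ ^ 2 - 2 * Q := by
        rw [norm_sub_rev]
        refine le_trans (le_of_eq ?_) (norm_sub_norm_le _ _)
        simp [Q]
      refine le_trans ?_ h2
      have : 0 ≤ (4 ^ m * t) ^ 2 * Q := by positivity
      rw [pow_succ]
      nlinarith

theorem weil (k : Type) [Field k] [Fintype k] [DecidableEq k] (hk : Odd (Fintype.card k))
    (ψ : AddChar k ℂ) (c : k) (hc : c ≠ 0) (hψ : ψ ≠ 1) :
    ‖Kl ψ c‖ ≤ 2 * Real.sqrt (Fintype.card k) := by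
  by_contra! hlt
  set q := Fintype.card k with hq
  have hq2 : 2 ≤ q := Fintype.one_lt_card
  have hs : 0 < Real.sqrt q := Real.sqrt_pos.2 (by positivity)
  obtain ⟨t, ht, h⟩ : ∃ t : ℝ, 0 < t ∧ ‖Kl ψ c‖ ≥ (2 + t) * Real.sqrt q := by
    refine ⟨‖Kl ψ c‖ / Real.sqrt q - 2, ?_, ?_⟩
    · rw [sub_pos, lt_div_iff₀ hs]; exact hlt
    · apply le_of_eq; field_simp; ring
  obtain ⟨m0, hm0⟩ := pow_unbounded_of_one_lt ((8 * q + 2) / t) (by norm_num : (1 : ℝ) < 4)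
  set m := m0 + (8 * q + 8) with hm
  have hm4 : 8 * q + 2 < 4 ^ (m + 1) * t := by
    rw [div_lt_iff₀ ht] at hm0
    refine hm0.trans_le ?_
    apply mul_le_mul_of_nonneg_right _ ht.le
    apply pow_le_pow_right₀ (by norm_num); omega
  obtain ⟨L, i1, i2, i3, i4, hcard, hK⟩ := tower k hk ψ c hc hψ t ht.le h (m + 1)
  have hoddL : Odd (Fintype.card L) := by rw [hcard]; exact hk.pow
  have hchar : ringChar L ≠ 2 := by
    intro h2
    have := FiniteField.even_card_iff_char_two.1 h2
    rw [Nat.odd_iff] at hoddL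
    omega
  obtain ⟨p, hp⟩ := CharP.exists k
  obtain ⟨n, hpp, hn⟩ := FiniteField.card k p
  have : Fact p.Prime := ⟨hpp⟩
  have : CharP L p := charP_of_injective_algebraMap (algebraMap k L).injective p
  have hpn : p ^ ((n : ℕ) * 2 ^ m) = q ^ (2 ^ m) := by rw [pow_mul, ← hn]
  have hcL : Fintype.card L = (p ^ ((n : ℕ) * 2 ^ m)) ^ 2 := by
    rw [hpn, hcard, ← pow_mul, pow_succ]
  have hbig : 8 * q + 8 ≤ p ^ ((n : ℕ) * 2 ^ m) := by
    rw [hpn]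
    calc 8 * q + 8 ≤ m := by omega
      _ ≤ 2 ^ m := Nat.lt_two_pow_self.le
      _ ≤ 2 ^ (2 ^ m) := Nat.lt_two_pow_self.le
      _ ≤ q ^ (2 ^ m) := Nat.pow_le_pow_left hq2 _
  have hb := Kl_bound k L ψ hψ (algebraMap k L c) (by simpa using hc) p _ hcL
    (by rw [hpn]; exact hk.pow) hchar hbig
  have hsq : Real.sqrt (Fintype.card L) = (p ^ ((n : ℕ) * 2 ^ m) : ℕ) := by
    rw [hcL]; push_cast; apply Real.sqrt_sq; positivity
  rw [hsq] at hK
  have := hK.le.trans hb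
  have hpos : (0 : ℝ) < (p ^ ((n : ℕ) * 2 ^ m) : ℕ) := by
    have : 0 < p ^ ((n : ℕ) * 2 ^ m) := by omega
    exact_mod_cast this
  have := le_of_mul_le_mul_right this hpos
  linarith

lemma sphere_sum {F : Type} [Field F] [Fintype F] [DecidableEq F] (hchar : ringChar F ≠ 2)
    (α β γ a : F) (ha : a ≠ 0) (hΔ : β ^ 2 - 4 * α * γ ≠ 0) :
    (∀ g : F → ℂ, (∑ t : F, ∑ s : F, if α * t ^ 2 + β * t * s + γ * s ^ 2 = a then g t else 0) =
      ∑ t : F, if t = 0 then 0 else g t) ∨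
    ∃ c : F, c ≠ 0 ∧ ∃ ε : ℤ, (ε = 1 ∨ ε = -1) ∧ ∀ g : F → ℂ,
      (∑ t : F, ∑ s : F, if α * t ^ 2 + β * t * s + γ * s ^ 2 = a then g t else 0) =
      ∑ t : F, (((ε * quadraticChar F (t ^ 2 - 4 * c) : ℤ) : ℂ) + 1) * g t := by
  by_cases hγ : γ = 0
  · left
    intro g
    have hβ : β ≠ 0 := by
      rintro rfl; apply hΔ; rw [hγ]; ring
    refine Finset.sum_congr rfl fun t _ => ?_
    by_cases ht : t = 0
    · simp [ht, hγ, ha.symm]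
    · rw [if_neg ht, Finset.sum_eq_single ((a - α * t ^ 2) / (β * t))]
      · rw [if_pos]; rw [hγ]; field_simp; ring
      · intro s _ hs
        rw [if_neg]
        intro h
        apply hs
        rw [hγ] at h
        field_simp
        linear_combination h
      · simp
  · right
    set Δ := β ^ 2 - 4 * α * γ with hΔd
    refine ⟨-(a * γ) / Δ, div_ne_zero (neg_ne_zero.2 (mul_ne_zero ha hγ)) hΔ, quadraticChar F Δ,
      quadraticChar_dichotomy hΔ, fun g => ?_⟩
    refine Finset.sum_congr rfl fun t _ => ?_
    have h1 := card_quadratic hchar γ (β * t) (α * t ^ 2 - a) hγ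
    have h2 : (β * t) ^ 2 - 4 * γ * (α * t ^ 2 - a) = Δ * (t ^ 2 - 4 * (-(a * γ) / Δ)) := by
      field_simp
      rw [hΔd]; ring
    rw [h2, map_mul] at h1
    have h3 : ((Finset.univ.filter fun s : F => γ * s ^ 2 + β * t * s + (α * t ^ 2 - a) = 0).card : ℂ)
      = ((quadraticChar F Δ * quadraticChar F (t ^ 2 - 4 * (-(a * γ) / Δ)) : ℤ) : ℂ) + 1 := by
      exact_mod_cast h1
    rw [← h3, ← Finset.sum_filter, Finset.sum_const, nsmul_eq_mul]
    congr 3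
    ext s
    simp only [Finset.mem_filter, Finset.mem_univ, true_and]
    constructor <;> intro h <;> linear_combination h

lemma form_sum {F : Type} [Field F] [Fintype F] [DecidableEq F] (hchar : ringChar F ≠ 2)
    (Q : QuadraticForm F (Fin 2 → F))
    (hQ : ∀ x : Fin 2 → F, (∀ y : Fin 2 → F, Q (x + y) - Q x - Q y = 0) → x = 0)
    (a : F) (ha : a ≠ 0) (b e : Fin 2 → F) (hbe : e 0 * b 0 + e 1 * b 1 = 1) :
    (∀ g : F → ℂ, (∑ z : Fin 2 → F, if Q z = a then g (b 0 * z 0 + b 1 * z 1) else 0) =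
      ∑ t : F, if t = 0 then 0 else g t) ∨
    ∃ c : F, c ≠ 0 ∧ ∃ ε : ℤ, (ε = 1 ∨ ε = -1) ∧ ∀ g : F → ℂ,
      (∑ z : Fin 2 → F, if Q z = a then g (b 0 * z 0 + b 1 * z 1) else 0) =
      ∑ t : F, (((ε * quadraticChar F (t ^ 2 - 4 * c) : ℤ) : ℂ) + 1) * g t := by
  have h2 : (2 : F) ≠ 0 := Ring.two_ne_zero hchar
  set f : Fin 2 → F := ![-b 1, b 0] with hf
  have hform : ∀ t s : F, Q (t • e + s • f) =
      Q e * t ^ 2 + QuadraticMap.polar Q e f * t * s + Q f * s ^ 2 := by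
    intro t s
    rw [QuadraticMap.map_add (⇑Q) (t • e) (s • f), QuadraticMap.map_smul, QuadraticMap.map_smul,
      QuadraticMap.polar_smul_left, QuadraticMap.polar_smul_right]
    simp only [smul_eq_mul]
    ring
  let E : F × F ≃ (Fin 2 → F) :=
    { toFun := fun w => w.1 • e + w.2 • f
      invFun := fun z => (b 0 * z 0 + b 1 * z 1, e 0 * z 1 - e 1 * z 0)
      left_inv := by
        rintro ⟨t, s⟩
        ext
        · simp [hf]; linear_combination t * hbe
        · simp [hf]; linear_combination s * hbe
      right_inv := by
        intro z
        ext i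
        fin_cases i
        · simp [hf]; linear_combination z 0 * hbe
        · simp [hf]; linear_combination z 1 * hbe }
  have hEb : ∀ w : F × F, b 0 * (E w) 0 + b 1 * (E w) 1 = w.1 := fun w =>
    congrArg Prod.fst (E.left_inv w)
  have hE0 : ∀ w : F × F, E w = 0 → w = 0 := by
    intro w hw
    apply E.injective
    rw [hw]; simp [E]
  set α := Q e
  set β := QuadraticMap.polar Q e f
  set γ := Q f
  have hQE : ∀ w : F × F, Q (E w) = α * w.1 ^ 2 + β * w.1 * w.2 + γ * w.2 ^ 2 := fun w =>
    hform _ _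
  have hrad : ∀ w : F × F, 2 * α * w.1 + β * w.2 = 0 → β * w.1 + 2 * γ * w.2 = 0 → w = 0 := by
    intro w h3 h4
    apply hE0
    apply hQ
    intro y
    obtain ⟨u, rfl⟩ := E.surjective y
    have hadd : E w + E u = E (w + u) := by
      simp only [E, Equiv.coe_fn_mk, Prod.fst_add, Prod.snd_add, add_smul]; abel
    rw [hadd, hQE, hQE, hQE]
    simp only [Prod.fst_add, Prod.snd_add]
    linear_combination u.1 * h3 + u.2 * h4
  have hΔ : β ^ 2 - 4 * α * γ ≠ 0 := by
    intro h0
    have h3 := hrad (2 * γ, -β) (by simp only; linear_combination -h0) (by simp only; ring)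
    have hγ : γ = 0 := by
      have := congrArg Prod.fst h3
      simpa [h2] using this
    have hβ : β = 0 := by
      have := congrArg Prod.snd h3
      simpa using this
    have h4 := hrad (0, 1) (by simp [hβ]) (by simp [hγ])
    have := congrArg Prod.snd h4
    simp at this
  have hsum : ∀ g : F → ℂ, (∑ z : Fin 2 → F, if Q z = a then g (b 0 * z 0 + b 1 * z 1) else 0) =
      (∑ t : F, ∑ s : F, if α * t ^ 2 + β * t * s + γ * s ^ 2 = a then g t else 0) := by
    intro g
    rw [← Equiv.sum_comp E, Fintype.sum_prod_type]
    refine Finset.sum_congr rfl fun t _ => Finset.sum_congr rfl fun s _ => ?_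
    rw [hEb, hQE]
  simp only [hsum]
  exact sphere_sum hchar α β γ a ha hΔ

lemma fourier_inj_aux {F : Type} [Field F] [Fintype F] [DecidableEq F] (ψ : AddChar F ℂ) (hψ : ψ ≠ 1)
    (v : (Fin 2 → F) → ℂ)
    (h : ∀ b : Fin 2 → F, ∑ x, v x * ψ (b 0 * x 0 + b 1 * x 1) = 0) : v = 0 := by
  funext y
  have h1 : ∑ b : Fin 2 → F, (∑ x, v x * ψ (b 0 * x 0 + b 1 * x 1)) *
      ψ (-(b 0 * y 0 + b 1 * y 1)) = 0 := by simp [h]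
  have h2 : ∀ u : Fin 2 → F, ∑ b : Fin 2 → F, ψ (b 0 * u 0 + b 1 * u 1) =
      if u = 0 then (Fintype.card F : ℂ) ^ 2 else 0 := by
    intro u
    have e1 : ∑ b : Fin 2 → F, ψ (b 0 * u 0 + b 1 * u 1) =
        (∑ s : F, ψ (s * u 0)) * (∑ s : F, ψ (s * u 1)) := by
      rw [Finset.sum_mul_sum, ← Fintype.sum_prod_type', ← Equiv.sum_comp (finTwoArrowEquiv F)]
      refine Finset.sum_congr rfl fun b _ => ?_
      simp [AddChar.map_add_eq_mul]
    rw [e1, AddChar.sum_mulShift _ (AddChar.IsPrimitive.of_ne_one hψ),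
      AddChar.sum_mulShift _ (AddChar.IsPrimitive.of_ne_one hψ)]
    have : u = 0 ↔ u 0 = 0 ∧ u 1 = 0 := by
      rw [funext_iff, Fin.forall_fin_two]; rfl
    by_cases h0 : u 0 = 0 <;> by_cases h1 : u 1 = 0 <;> simp [this, h0, h1, pow_two]
  have h3 : ∑ b : Fin 2 → F, (∑ x, v x * ψ (b 0 * x 0 + b 1 * x 1)) *
      ψ (-(b 0 * y 0 + b 1 * y 1)) = (Fintype.card F : ℂ) ^ 2 * v y := by
    simp only [Finset.sum_mul]
    rw [Finset.sum_comm]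
    have : ∀ x, ∑ b : Fin 2 → F, v x * ψ (b 0 * x 0 + b 1 * x 1) * ψ (-(b 0 * y 0 + b 1 * y 1)) =
        v x * if x - y = 0 then (Fintype.card F : ℂ) ^ 2 else 0 := by
      intro x
      rw [← h2, Finset.mul_sum]
      refine Finset.sum_congr rfl fun b _ => ?_
      rw [mul_assoc, ← AddChar.map_add_eq_mul]
      congr 2
      simp only [Pi.sub_apply]; ring
    simp only [this, sub_eq_zero, mul_ite, mul_zero]
    simp [mul_comm]
  rw [h3] at h1
  have hq : (Fintype.card F : ℂ) ^ 2 ≠ 0 := by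
    apply pow_ne_zero; exact_mod_cast Fintype.card_ne_zero
  simpa [hq] using h1

theorem stmt_12 (F : Type) [Field F] [Fintype F] (hq : Odd (Fintype.card F))
    (Q : QuadraticForm F (Fin 2 → F))
    (hQ : ∀ x : Fin 2 → F, (∀ y : Fin 2 → F, Q (x + y) - Q x - Q y = 0) → x = 0)
    (a : F) (ha : a ≠ 0) (G : SimpleGraph (Fin 2 → F)) [DecidableRel G.Adj]
    (hAdj : ∀ x y : Fin 2 → F, G.Adj x y ↔ x ≠ y ∧ Q (x - y) = a) :
    ∃ d : ℕ, (d = Fintype.card F - 1 ∨ d = Fintype.card F + 1) ∧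
      G.IsRegularOfDegree d ∧
      ∀ (μ : ℝ) (v : (Fin 2 → F) → ℝ), v ≠ 0 →
        (G.adjMatrix ℝ) *ᵥ v = μ • v → μ ≠ (d : ℝ) →
        |μ| ≤ 2 * Real.sqrt (Fintype.card F) := by
  classical
  have hchar : ringChar F ≠ 2 := by
    intro h2
    have := FiniteField.even_card_iff_char_two.1 h2
    rw [Nat.odd_iff] at hq
    omega
  have hadj : ∀ x y : Fin 2 → F, G.Adj x y ↔ Q (x - y) = a := by
    intro x y
    rw [hAdj]
    refine ⟨fun h => h.2, fun h => ⟨?_, h⟩⟩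
    rintro rfl
    rw [sub_self, QuadraticMap.map_zero] at h
    exact ha h.symm
  have hq1 : 1 ≤ Fintype.card F := Fintype.card_pos
  set d := (Finset.univ.filter fun z : Fin 2 → F => Q z = a).card with hd
  have hdC : (d : ℂ) = ∑ z : Fin 2 → F, if Q z = a then (1 : ℂ) else 0 := by
    rw [hd]; simp
  refine ⟨d, ?_, ?_, ?_⟩
  · rcases form_sum hchar Q hQ a ha ![1, 0] ![1, 0] (by simp) with h | ⟨c, hc, ε, hε, h⟩
    · left
      have := h (fun _ => 1)
      rw [← hdC] at this
      have h1 : (∑ x : F, if x = 0 then (0 : ℂ) else 1) = Fintype.card F - 1 := by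
        have : ∀ x : F, (if x = 0 then (0 : ℂ) else 1) = 1 - if x = 0 then 1 else 0 := by
          intro x; split_ifs <;> simp
        simp [this]
      rw [h1] at this
      have h2 : ((d + 1 : ℕ) : ℂ) = (Fintype.card F : ℕ) := by push_cast; linear_combination this
      have h3 : d + 1 = Fintype.card F := by exact_mod_cast h2
      omega
    · have := h (fun _ => 1)
      rw [← hdC] at this
      simp only [mul_one, Finset.sum_add_distrib, Finset.sum_const, Finset.card_univ,
        nsmul_eq_mul] at this
      rw [← Int.cast_sum, ← Finset.mul_sum, jacobsthal hchar c hc] at this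
      have h3 : (d : ℤ) = ε * (-1) + Fintype.card F := by exact_mod_cast this
      rcases hε with rfl | rfl <;> omega
  · intro x
    rw [← SimpleGraph.card_neighborFinset_eq_degree, hd]
    apply Finset.card_nbij' (fun y => x - y) (fun z => x - z)
    · intro y hy; simpa [hadj] using hy
    · intro z hz; simpa [hadj] using hz
    · intro y _; simp
    · intro y _; simp
  · intro μ v hv hμv hμd
    obtain ⟨ψ, hψ1⟩ := (AddChar.exists_apply_ne_zero (a := (1 : F))).2 one_ne_zero
    have hψ : ψ ≠ 1 := AddChar.ne_one_iff.2 ⟨1, hψ1⟩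
    obtain ⟨b, hb⟩ : ∃ b : Fin 2 → F, ∑ x, (v x : ℂ) * ψ (b 0 * x 0 + b 1 * x 1) ≠ 0 := by
      by_contra! hcon
      apply hv
      have := fourier_inj_aux ψ hψ (fun x => (v x : ℂ)) hcon
      funext x
      have h0 : (v x : ℂ) = 0 := congrFun this x
      exact Complex.ofReal_eq_zero.1 h0
    set S := ∑ x, (v x : ℂ) * ψ (b 0 * x 0 + b 1 * x 1) with hS
    set lam := ∑ z : Fin 2 → F, if Q z = a then ψ (b 0 * z 0 + b 1 * z 1) else 0 with hlam
    have hev : ∀ x, (μ : ℂ) * v x = ∑ y, if Q (x - y) = a then (v y : ℂ) else 0 := by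
      intro x
      have := congrFun hμv x
      simp only [Matrix.mulVec, dotProduct, SimpleGraph.adjMatrix_apply, hadj, ite_mul, one_mul,
        zero_mul, Pi.smul_apply, smul_eq_mul] at this
      rw [← Complex.ofReal_mul, ← this]
      push_cast
      refine Finset.sum_congr rfl fun y _ => ?_
      split_ifs <;> simp
    have hmul : (μ : ℂ) * S = lam * S := by
      have e1 : (μ : ℂ) * S = ∑ x, ∑ y, (if Q (x - y) = a then (v y : ℂ) else 0) *
          ψ (b 0 * x 0 + b 1 * x 1) := by
        rw [hS, Finset.mul_sum]
        refine Finset.sum_congr rfl fun x _ => ?_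
        rw [← mul_assoc, hev, Finset.sum_mul]
      rw [e1, Finset.sum_comm, hS, Finset.mul_sum]
      refine Finset.sum_congr rfl fun y _ => ?_
      rw [← Equiv.sum_comp (Equiv.addRight y), hlam, Finset.sum_mul]
      refine Finset.sum_congr rfl fun z _ => ?_
      simp only [Equiv.coe_addRight, add_sub_cancel_right, Pi.add_apply]
      split_ifs
      · have : b 0 * (z 0 + y 0) + b 1 * (z 1 + y 1) =
          (b 0 * z 0 + b 1 * z 1) + (b 0 * y 0 + b 1 * y 1) := by ring
        rw [this, AddChar.map_add_eq_mul]; ring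
      · simp
    have hμ : (μ : ℂ) = lam := mul_right_cancel₀ hb hmul
    have hb0 : b ≠ 0 := by
      rintro rfl
      apply hμd
      have : (μ : ℂ) = (d : ℂ) := by
        rw [hμ, hlam, hdC]; simp
      exact_mod_cast this
    obtain ⟨e, he⟩ : ∃ e : Fin 2 → F, e 0 * b 0 + e 1 * b 1 = 1 := by
      by_cases h0 : b 0 = 0
      · have h1 : b 1 ≠ 0 := by
          intro h1; apply hb0; funext i; fin_cases i <;> simp [h0, h1]
        exact ⟨![0, (b 1)⁻¹], by simp [h1]⟩
      · exact ⟨![(b 0)⁻¹, 0], by simp [h0]⟩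
    have hnorm : |μ| = ‖lam‖ := by rw [← hμ, Complex.norm_real, Real.norm_eq_abs]
    rw [hnorm]
    rcases form_sum hchar Q hQ a ha b e he with h | ⟨c, hc, ε, hε, h⟩
    · have h1 := h ψ
      have h2 : (∑ t : F, if t = 0 then (0 : ℂ) else ψ t) = -1 := by
        have : ∀ t : F, (if t = 0 then (0 : ℂ) else ψ t) = ψ t - if t = 0 then 1 else 0 := by
          intro t; split_ifs with ht <;> simp [ht]
        simp [this, AddChar.sum_eq_zero_of_ne_one hψ]
      rw [hlam, h1, h2, norm_neg, norm_one]
      have : (1 : ℝ) ≤ Real.sqrt (Fintype.card F) := by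
        rw [Real.one_le_sqrt]; exact_mod_cast hq1
      linarith
    · have h1 := h ψ
      have h2 : lam = ε * Kl ψ c := by
        rw [hlam, h1, Kl_eq hchar ψ hψ c hc, Finset.mul_sum]
        simp only [add_mul, one_mul, Finset.sum_add_distrib, AddChar.sum_eq_zero_of_ne_one hψ,
          add_zero]
        refine Finset.sum_congr rfl fun t _ => ?_
        push_cast; ring
      have h3 : ‖(ε : ℂ)‖ = 1 := by rcases hε with rfl | rfl <;> simp
      rw [h2, norm_mul, h3, one_mul]
      exact weil F hq ψ c hc hψ
end

section
/- Let q be an odd prime power, E ⊆ F_q², and a, b ∈ F_q with a ≠ 0 and b ≠ 0. Then the number N of ordered triples (x,y,z) ∈ E × E × E with ‖x−y‖ = a and ‖x−z‖ = b satisfies |N − |E|³/q²| ≤ (4√q·(q+1)/q²)·|E|² + 4q·|E|. -/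
/-- The norm `‖x‖ = x₁² + x₂²` on `F_q²`. -/
def fnorm {F : Type*} [Field F] (x : Fin 2 → F) : F := x 0 ^ 2 + x 1 ^ 2
open Polynomial in
theorem stepanov_core {L : Type} [Field L] [Fintype L] [DecidableEq L] (p D : ℕ) [Fact p.Prime] [CharP L p]
    (m : ℕ) (hr : p ^ m = p * D) (hD : 0 < D) (hc : Fintype.card L = (p * D) ^ 2)
    (H : L[X]) (hH : H.natDegree = 2 * D) (u : L) (h : L → L) (S : Finset L)
    (hS0 : ∀ x ∈ S, x ≠ 0) (hSe : ∀ x ∈ S, H.eval x = x ^ D * h x)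
    (hSu : ∀ x ∈ S, h x ^ (p * D) = u - h x) : S.card ≤ p * D ^ 2 + 5 * (p * D) := by
  have hp : p.Prime := Fact.out
  have hp2 := hp.two_le
  have hH0 : H ≠ 0 := by
    rintro rfl
    simp at hH; omega
  set r := p * D with hrdef
  have hDr : D ≤ r := Nat.le_mul_of_pos_left D (by omega)
  have hDp : D * (p - 1) ≤ r := by rw [hrdef, mul_comm p]; gcongr; omega
  have h2Dr : 2 * D ≤ r := by rw [hrdef]; gcongr
  let ι := Fin D × Fin (D + 3) × Fin p
  let T : ι → L[X] := fun i => X ^ (i.1.1 * r + i.2.1.1) * (C u * X ^ D - H) ^ i.2.2.1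
      * X ^ (D * (p - 1 - i.2.2.1))
  let U : ι → L[X] := fun i => X ^ (i.1.1 + i.2.1.1 * r) * H ^ i.2.2.1
      * X ^ (D * (p - 1 - i.2.2.1))
  let M := (D - 1) * r + (D + 3) + 2 * D * (p - 1)
  have hj : ∀ j : Fin p, 2 * D * j.1 + D * (p - 1 - j.1) = D * j.1 + D * (p - 1) := by
    intro j
    obtain ⟨k, hk⟩ : ∃ k, p - 1 = j.1 + k := ⟨p - 1 - j.1, by have := j.2; omega⟩
    rw [hk]; simp; ring
  have hj2 : ∀ j : Fin p, D * j.1 ≤ D * (p - 1) := by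
    intro j; gcongr; have := j.2; omega
  have hTdeg : ∀ i, T i ∈ degreeLT L M := by
    intro i
    rw [mem_degreeLT]
    have hsub : (C u * X ^ D - H).natDegree ≤ 2 * D := by
      refine (natDegree_sub_le _ _).trans (max_le ?_ hH.le)
      exact (natDegree_C_mul_X_pow_le _ _).trans (by omega)
    have : (T i).natDegree ≤ (i.1.1 * r + i.2.1.1) + i.2.2.1 * (2 * D) + D * (p - 1 - i.2.2.1) := by
      refine natDegree_mul_le.trans (add_le_add (natDegree_mul_le.trans (add_le_add ?_ ?_)) ?_)
      · exact natDegree_X_pow_le _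
      · exact natDegree_pow_le.trans (by gcongr)
      · exact natDegree_X_pow_le _
    refine (degree_le_natDegree).trans_lt ?_
    have h1 : i.1.1 * r ≤ (D - 1) * r := by gcongr; have := i.1.2; omega
    have h2 := i.2.1.2
    have h3 := hj i.2.2
    have h4 := hj2 i.2.2
    have : (T i).natDegree < M := by
      have e1 : i.2.2.1 * (2 * D) = 2 * D * i.2.2.1 := mul_comm _ _
      have e2 : 2 * D * (p - 1) = D * (p - 1) + D * (p - 1) := by ring
      omega
    exact_mod_cast this
  have hdep : ¬ LinearIndependent L (fun i => (⟨T i, hTdeg i⟩ : degreeLT L M)) := by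
    intro hli
    have : FiniteDimensional L (degreeLT L M) := LinearEquiv.finiteDimensional (degreeLTEquiv L M).symm
    have := hli.fintype_card_le_finrank
    rw [(degreeLTEquiv L M).finrank_eq] at this
    simp only [ι, Fintype.card_prod, Fintype.card_fin, Module.finrank_fin_fun] at this
    obtain ⟨D', rfl⟩ : ∃ D', D = D' + 1 := ⟨D - 1, by omega⟩
    obtain ⟨p', rfl⟩ : ∃ p', p = p' + 2 := ⟨p - 2, by omega⟩
    simp only [M, hrdef, Nat.add_sub_cancel] at this
    have e : p' + 2 - 1 = p' + 1 := by omega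
    rw [e] at this
    nlinarith [Nat.zero_le (D' * p'), Nat.zero_le (D' * D')]
  rw [Fintype.not_linearIndependent_iff] at hdep
  obtain ⟨c, hc0, i0, hi0⟩ := hdep
  have hc0' : ∑ i, c i • T i = 0 := by
    have := congrArg Subtype.val hc0
    simpa using this
  have hU : ∀ i, (U i).natDegree = i.1.1 + i.2.1.1 * r + D * i.2.2.1 + D * (p - 1) := by
    intro i
    simp only [U]
    rw [natDegree_mul (by simp [hH0]) (by simp), natDegree_mul (by simp) (by simp [hH0]),
      natDegree_X_pow, natDegree_X_pow, natDegree_pow, hH]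
    have h3 := hj i.2.2
    have e1 : i.2.2.1 * (2 * D) = 2 * D * i.2.2.1 := mul_comm _ _
    omega
  have hU0 : ∀ i, U i ≠ 0 := by
    intro i; simp [U, hH0]
  have hUinj : Function.Injective (fun i => (U i).natDegree) := by
    rintro ⟨e, a, j⟩ ⟨e', a', j'⟩ hh
    simp only [hU] at hh
    have he := e.2
    have he' := e'.2
    have h1 : e.1 + D * (j.1 + p * a.1) = e'.1 + D * (j'.1 + p * a'.1) := by
      rw [hrdef] at hh; linarith
    have h2 : e.1 = e'.1 := by
      have := congrArg (· % D) h1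
      simpa [Nat.add_mul_mod_self_left, Nat.mod_eq_of_lt he, Nat.mod_eq_of_lt he'] using this
    have h3 : j.1 + p * a.1 = j'.1 + p * a'.1 := by
      rw [h2] at h1
      exact Nat.eq_of_mul_eq_mul_left hD (by omega)
    have h4 : j.1 = j'.1 := by
      have := congrArg (· % p) h3
      simpa [Nat.add_mul_mod_self_left, Nat.mod_eq_of_lt j.2, Nat.mod_eq_of_lt j'.2] using this
    have h5 : a.1 = a'.1 := by
      rw [h4] at h3
      exact Nat.eq_of_mul_eq_mul_left hp.pos (by omega)
    ext <;> simp [h2, h4, h5]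
  let d : ι → L := fun i => c i ^ r
  have hd : ∀ i, d i ^ r = c i := by
    intro i
    simp only [d]
    rw [← pow_mul, ← sq, ← hc, FiniteField.pow_card]
  let G : L[X] := ∑ i, d i • U i
  have hG0 : G ≠ 0 := by
    have hli : degree G = _ := degree_sum_eq_of_disjoint (fun i => d i • U i) Finset.univ (by
      rintro i ⟨-, hi⟩ j ⟨-, hj⟩ hij
      simp only [Function.onFun, Function.comp]
      have hdi : d i ≠ 0 := by rintro h; simp [h] at hi
      have hdj : d j ≠ 0 := by rintro h; simp [h] at hj
      rw [degree_smul_of_smul_regular _ (IsSMulRegular.of_ne_zero hdi),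
        degree_smul_of_smul_regular _ (IsSMulRegular.of_ne_zero hdj),
        degree_eq_natDegree (hU0 i), degree_eq_natDegree (hU0 j)]
      exact fun hh => hij (hUinj (by exact_mod_cast hh)))
    intro hG
    rw [hG, degree_zero] at hli
    have hle := Finset.le_sup (f := fun i => degree (d i • U i)) (Finset.mem_univ i0)
    rw [← hli, le_bot_iff, degree_eq_bot, smul_eq_zero] at hle
    rcases hle with h | h
    · have := hd i0
      rw [h, zero_pow (by omega)] at this
      exact hi0 this.symm
    · exact hU0 _ h
  have hGdeg : G.natDegree ≤ p * D ^ 2 + 5 * (p * D) := by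
    refine natDegree_sum_le_of_forall_le _ _ (fun i _ => ?_)
    refine (natDegree_smul_le _ _).trans ?_
    rw [hU]
    have h1 : i.2.1.1 * r ≤ (D + 2) * r := by gcongr; have := i.2.1.2; omega
    have h2 := i.1.2
    have h4 := hj2 i.2.2
    have e : (D + 2) * r = p * D ^ 2 + 2 * r := by rw [hrdef]; ring
    rw [← hrdef]
    omega
  refine le_trans (card_le_degree_of_subset_roots (p := G) ?_) hGdeg
  intro x hx
  rw [Finset.mem_val] at hx
  rw [mem_roots hG0, IsRoot.def]
  refine eq_zero_of_pow_eq_zero (n := r) ?_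
  have hx0 := hS0 x hx
  have hxe := hSe x hx
  have hxu := hSu x hx
  have hxQ : (x ^ r) ^ r = x := by rw [← pow_mul, ← sq, ← hc, FiniteField.pow_card]
  have key : ∀ i, (d i • U i).eval x ^ r = x ^ (D * (p - 1) * (r - 1)) * (c i • T i).eval x := by
    intro i
    simp only [U, T, eval_smul, eval_mul, eval_pow, eval_X, eval_sub, eval_C, smul_eq_mul, hxe,
      mul_pow, hd]
    have e1 : u * x ^ D - x ^ D * h x = x ^ D * (u - h x) := by ring
    rw [e1, ← hxu]
    obtain ⟨k, hk⟩ : ∃ k, p - 1 = i.2.2.1 + k := ⟨p - 1 - i.2.2.1, by have := i.2.2.2; omega⟩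
    obtain ⟨s, hs⟩ : ∃ s, r = s + 1 := ⟨r - 1, by omega⟩
    have e2 : p - 1 - i.2.2.1 = k := by omega
    have e3 : (x ^ (i.1.1 + i.2.1.1 * r)) ^ r = x ^ (i.1.1 * r + i.2.1.1) := by
      rw [pow_add, mul_pow, pow_add, pow_mul, pow_mul' x i.2.1.1 r, ← pow_mul (x ^ r), mul_comm i.2.1.1 r,
        pow_mul (x ^ r), hxQ]
      rw [← pow_mul, ← pow_mul]
    rw [e3, e2, hk]
    have e4 : r - 1 = s := by omega
    rw [e4]
    have e5 : ∀ y : L, y ^ r = y * y ^ s := by intro y; rw [hs, pow_succ']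
    rw [e5 (x ^ (D * k)), e5 ((x ^ D) ^ i.2.2.1)]
    ring
  have hfrob : G.eval x ^ r = ∑ i, (d i • U i).eval x ^ r := by
    rw [eval_finsetSum, ← hr, sum_pow_char_pow]
  rw [hfrob, Finset.sum_congr rfl (fun i _ => key i), ← Finset.mul_sum, ← eval_finsetSum, hc0']
  simp

open Polynomial in
theorem stepanov_count {L : Type} [Field L] [Fintype L] [DecidableEq L] (p n : ℕ) [Fact p.Prime] [CharP L p]
    (hc : Fintype.card L = (p ^ (n + 1)) ^ 2) (α β u : L) (hα : α ≠ 0) (S : Finset L)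
    (hS0 : ∀ x ∈ S, x ≠ 0)
    (hS : ∀ x ∈ S, ∑ i ∈ Finset.range (2 * (n + 1)), (α * x + β * x⁻¹) ^ p ^ i = u) :
    S.card ≤ p * (p ^ n) ^ 2 + 5 * (p * p ^ n) := by
  have hp : p.Prime := Fact.out
  let D := p ^ n
  have hD : 0 < D := pow_pos hp.pos _
  let H : L[X] := ∑ i ∈ Finset.range (n + 1),
    (C (α ^ p ^ i) * X ^ (D + p ^ i) + C (β ^ p ^ i) * X ^ (D - p ^ i))
  have hle : ∀ i ∈ Finset.range (n + 1), p ^ i ≤ D := by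
    intro i hi
    exact Nat.pow_le_pow_right hp.pos (by simpa [Nat.lt_succ_iff] using hi)
  have hpow : p ^ (n + 1) = p * D := by simp only [D]; ring
  have hH : H.natDegree = 2 * D := by
    refine natDegree_eq_of_le_of_coeff_ne_zero ?_ ?_
    · refine natDegree_sum_le_of_forall_le _ _ (fun i hi => ?_)
      have := hle i hi
      refine (natDegree_add_le _ _).trans (max_le ?_ ?_)
      · exact (natDegree_C_mul_X_pow_le _ _).trans (by omega)
      · exact (natDegree_C_mul_X_pow_le _ _).trans (by omega)
    · have : H.coeff (2 * D) = α ^ D := by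
        simp only [H, finsetSum_coeff, coeff_add, coeff_C_mul_X_pow]
        rw [Finset.sum_eq_single n]
        · have h1 : 2 * D = D + p ^ n := by simp only [D]; ring
          have h2 : ¬ (2 * D = D - p ^ n) := by omega
          rw [if_pos h1, if_neg h2, add_zero]
        · intro i hi hin
          have h0 : i < n := by
            have := Finset.mem_range.1 hi; omega
          have h3 : p ^ i < D := Nat.pow_lt_pow_right hp.one_lt h0
          rw [if_neg (by omega), if_neg (by omega), add_zero]
        · intro hn; simp at hn
      rw [this]; exact pow_ne_zero _ hα
  let h : L → L := fun x => ∑ i ∈ Finset.range (n + 1), (α * x + β * x⁻¹) ^ p ^ i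
  refine stepanov_core p D (n + 1) hpow hD (by rw [hc, hpow]) H hH u h S hS0 ?_ ?_
  · intro x hx
    have hx0 := hS0 x hx
    simp only [H, h, eval_finsetSum, Finset.mul_sum]
    refine Finset.sum_congr rfl (fun i hi => ?_)
    have := hle i hi
    simp only [eval_add, eval_mul, eval_C, eval_pow, eval_X]
    rw [add_pow_char_pow, mul_add, mul_pow, mul_pow, pow_add, pow_sub₀ _ hx0 this, inv_pow]
    ring
  · intro x hx
    have h1 := hS x hx
    rw [two_mul, Finset.sum_range_add] at h1
    rw [← h1, ← hpow]
    simp only [h]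
    rw [sum_pow_char_pow, add_sub_cancel_left]
    refine Finset.sum_congr rfl (fun i hi => ?_)
    rw [← pow_mul, ← pow_add, add_comm i]

/-- Kloosterman sum. -/
noncomputable def kloo {F : Type} [Field F] [Fintype F] (ψ : AddChar F ℂ) (a b : F) : ℂ :=
  open Classical in ∑ x : F, if x = 0 then 0 else ψ (a * x + b * x⁻¹)

theorem exists_trace_char {L : Type} [Field L] [Fintype L] (p : ℕ) [Fact p.Prime]
    [CharP L p] [Algebra (ZMod p) L] (ψ : AddChar L ℂ) (hψ : ψ ≠ 1) :
    ∃ (e : AddChar (ZMod p) ℂ) (d : L), e ≠ 1 ∧ d ≠ 0 ∧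
      ∀ x, ψ x = e (Algebra.trace (ZMod p) L (d * x)) := by
  have hp : p.Prime := Fact.out
  obtain ⟨e, he⟩ : ∃ e : AddChar (ZMod p) ℂ, e ≠ 1 := by
    obtain ⟨e, he⟩ := (AddChar.exists_apply_ne_zero (α := ZMod p) (a := 1)).2 one_ne_zero
    exact ⟨e, fun h => he (by rw [h]; rfl)⟩
  let ψ0 : AddChar L ℂ := e.compAddMonoidHom (Algebra.trace (ZMod p) L).toAddMonoidHom
  have hψ0 : ψ0 ≠ 1 := by
    obtain ⟨y, hy⟩ := AddChar.ne_one_iff.1 he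
    obtain ⟨x, hx⟩ := Algebra.trace_surjective (ZMod p) L y
    refine AddChar.ne_one_iff.2 ⟨x, ?_⟩
    simpa [ψ0, hx] using hy
  have hinj := AddChar.to_mulShift_inj_of_isPrimitive (AddChar.IsPrimitive.of_ne_one hψ0)
  have hbij := (Fintype.bijective_iff_injective_and_card ψ0.mulShift).2 ⟨hinj, by simp⟩
  obtain ⟨d, hd⟩ := hbij.2 ψ
  refine ⟨e, d, he, ?_, ?_⟩
  · rintro rfl
    rw [AddChar.mulShift_zero] at hd
    exact hψ hd.symm
  · intro x
    rw [← hd]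
    simp [ψ0]

theorem kloo_weak {L : Type} [Field L] [Fintype L] (p n : ℕ) [Fact p.Prime] [CharP L p]
    (hc : Fintype.card L = (p ^ (n + 1)) ^ 2) (ψ : AddChar L ℂ) (hψ : ψ ≠ 1) (a b : L)
    (ha : a ≠ 0) : ‖kloo ψ a b‖ ≤ (5 * p + 1) * (p : ℝ) ^ (n + 1) := by
  classical
  have hp : p.Prime := Fact.out
  let _ : Algebra (ZMod p) L := ZMod.algebra L p
  obtain ⟨e, d, he, hd, hψe⟩ := exists_trace_char p ψ hψ
  let f : L → ZMod p := fun x => Algebra.trace (ZMod p) L (d * (a * x + b * x⁻¹))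
  let S : ZMod p → Finset L := fun u => {x ∈ Finset.univ.erase 0 | f x = u}
  have hfin : Module.finrank (ZMod p) L = 2 * (n + 1) := by
    have h1 := Module.card_eq_pow_finrank (K := ZMod p) (V := L)
    rw [hc, ZMod.card, ← pow_mul] at h1
    have := Nat.pow_right_injective hp.two_le h1
    omega
  have hScard : ∀ u, ((S u).card : ℝ) ≤ p * (p ^ n) ^ 2 + 5 * (p * p ^ n) := by
    intro u
    have := stepanov_count p n hc (d * a) (d * b) (algebraMap (ZMod p) L u) (mul_ne_zero hd ha) (S u)
      (by intro x hx; simp [S] at hx; exact hx.1) (by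
        intro x hx
        simp only [S, Finset.mem_filter] at hx
        rw [← hx.2]
        simp only [f]
        rw [FiniteField.algebraMap_trace_eq_sum_pow, hfin]
        simp only [Nat.card_zmod]
        refine Finset.sum_congr rfl (fun i _ => ?_)
        congr 1; ring)
    exact_mod_cast this
  have hSsum : ∑ u, ((S u).card : ℝ) = (p ^ (n + 1)) ^ 2 - 1 := by
    have h1 : (Finset.univ.erase (0 : L)).card = ∑ u, (S u).card :=
      Finset.card_eq_sum_card_fiberwise (f := f) (t := Finset.univ) (by intro x _; simp)
    have h2 : (Finset.univ.erase (0 : L)).card + 1 = (p ^ (n + 1)) ^ 2 := by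
      rw [Finset.card_erase_add_one (Finset.mem_univ _), Finset.card_univ, hc]
    rw [h1] at h2
    have h3 : ((∑ u, (S u).card : ℕ) : ℝ) + 1 = (p ^ (n + 1)) ^ 2 := by exact_mod_cast h2
    push_cast at h3
    linarith
  have hk : kloo ψ a b = ∑ u, e u * ((S u).card : ℂ) := by
    have h1 : kloo ψ a b = ∑ x ∈ Finset.univ.erase (0 : L), e (f x) := by
      unfold kloo
      rw [← Finset.add_sum_erase _ _ (Finset.mem_univ (0 : L))]
      simp only [if_true, zero_add]
      refine Finset.sum_congr rfl (fun x hx => ?_)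
      rw [if_neg (Finset.ne_of_mem_erase hx), hψe]
    rw [h1, ← Finset.sum_fiberwise (Finset.univ.erase (0 : L)) f]
    refine Finset.sum_congr rfl (fun u _ => ?_)
    rw [Finset.sum_congr rfl (g := fun _ => e u)]
    · simp [S, mul_comm]
    · intro x hx
      rw [(Finset.mem_filter.1 hx).2]
  set B : ℝ := p * (p ^ n) ^ 2 + 5 * (p * p ^ n) with hB
  have hk2 : kloo ψ a b = - ∑ u, e u * ((B - (S u).card : ℝ) : ℂ) := by
    rw [hk]
    push_cast
    simp only [mul_sub, Finset.sum_sub_distrib, ← Finset.sum_mul]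
    rw [AddChar.sum_eq_zero_of_ne_one he]
    simp
  rw [hk2, norm_neg]
  calc _ ≤ ∑ u, ‖e u * ((B - (S u).card : ℝ) : ℂ)‖ := norm_sum_le _ _
    _ = ∑ u, (B - (S u).card) := by
        refine Finset.sum_congr rfl (fun u _ => ?_)
        rw [norm_mul, AddChar.norm_apply, one_mul, Complex.norm_real, Real.norm_of_nonneg]
        linarith [hScard u]
    _ = p * B - ((p ^ (n + 1)) ^ 2 - 1) := by
        rw [Finset.sum_sub_distrib, hSsum]; simp
    _ = 5 * p * p ^ (n + 1) + 1 := by rw [hB]; ring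
    _ ≤ _ := by
        have : (1 : ℝ) ≤ (p : ℝ) ^ (n + 1) := one_le_pow₀ (by exact_mod_cast hp.one_lt.le)
        linarith

theorem sum_comp_sq {F : Type} [Field F] [Fintype F] [DecidableEq F] (hF : ringChar F ≠ 2)
    (g : F → ℂ) : ∑ y, g (y ^ 2) = ∑ w, ((quadraticChar F w : ℤ) + 1 : ℂ) * g w := by
  rw [← Finset.sum_fiberwise Finset.univ (fun y : F => y ^ 2)]
  refine Finset.sum_congr rfl (fun w _ => ?_)
  have h := quadraticChar_card_sqrts hF w
  have h2 : ((quadraticChar F w : ℤ) + 1 : ℂ) = (Finset.univ.filter (fun y : F => y ^ 2 = w)).card := by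
    have h3 : ({x : F | x ^ 2 = w}.toFinset) = Finset.univ.filter (fun y : F => y ^ 2 = w) := by
      ext; simp
    rw [h3] at h
    exact_mod_cast h.symm
  rw [h2, Finset.sum_congr rfl (g := fun _ => g w)]
  · simp
  · intro x hx
    rw [(Finset.mem_filter.1 hx).2]

theorem sum_sq_add {F : Type} [Field F] [Fintype F] (hF : ringChar F ≠ 2)
    (δ : F) (hδ : ¬ IsSquare δ) (g : F → ℂ) :
    ∑ y, g (y ^ 2) + ∑ y, g (δ * y ^ 2) = 2 * ∑ w, g w := by
  classical
  have hδ0 : δ ≠ 0 := by rintro rfl; exact hδ (IsSquare.zero)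
  rw [sum_comp_sq hF, sum_comp_sq hF (fun w => g (δ * w))]
  have hb := (Equiv.mulLeft₀ δ hδ0)
  rw [← Equiv.sum_comp (Equiv.mulLeft₀ δ hδ0), ← Equiv.sum_comp (Equiv.mulLeft₀ δ hδ0) g,
    ← Finset.sum_add_distrib, Finset.mul_sum]
  refine Finset.sum_congr rfl (fun w _ => ?_)
  have : quadraticChar F δ = -1 := quadraticChar_neg_one_iff_not_isSquare.2 hδ
  simp only [show ∀ v, (Equiv.mulLeft₀ δ hδ0) v = δ * v from fun _ => rfl, map_mul, this]
  push_cast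
  ring

theorem kloo_aux {F : Type} [Field F] [Fintype F] [DecidableEq F] (hF : ringChar F ≠ 2)
    (ψ : AddChar F ℂ) (hψ : ψ ≠ 1) (a b : F) (ha : a ≠ 0) (hb : b ≠ 0) (δ : F) (hδ : ¬ IsSquare δ)
    (φ : F → F → ℂ)
    (hφ : ∀ x w, φ x w = if x ^ 2 - w = 0 then 0 else ψ (2 * (a * x + b * (x * (x ^ 2 - w)⁻¹)))) :
    ∑ x, ∑ y, φ x (δ * y ^ 2) = 2 * (Fintype.card F : ℂ) - kloo ψ a b ^ 2 := by
  have h2 : (2 : F) ≠ 0 := Ring.two_ne_zero hF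
  have h1 : kloo ψ a b ^ 2 = ∑ x, ∑ y, φ x (y ^ 2) := by
    rw [sq]
    unfold kloo
    rw [Finset.sum_mul_sum, ← Fintype.sum_prod_type', ← Fintype.sum_prod_type']
    symm
    let e : F × F ≃ F × F :=
      { toFun := fun z => (z.1 + z.2, z.1 - z.2)
        invFun := fun z => ((z.1 + z.2) / 2, (z.1 - z.2) / 2)
        left_inv := by intro z; ext <;> simp <;> field_simp <;> ring
        right_inv := by intro z; ext <;> simp <;> field_simp <;> ring }
    refine Fintype.sum_equiv e _ _ ?_
    rintro ⟨x, y⟩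
    simp only [e, Equiv.coe_fn_mk, hφ]
    have hf : x ^ 2 - y ^ 2 = (x + y) * (x - y) := by ring
    rw [hf]
    by_cases hu : x + y = 0
    · simp [hu]
    by_cases hv : x - y = 0
    · simp [hv]
    rw [if_neg hu, if_neg hv, if_neg (mul_ne_zero hu hv), ← AddChar.map_add_eq_mul]
    congr 1
    field_simp
    ring
  have h3 : ∑ x, ∑ w, φ x w = (Fintype.card F : ℂ) := by
    have : ∀ x, ∑ w, φ x w = ∑ c, if c = 0 then 0 else ψ (x * (2 * (a + b * c⁻¹))) := by
      intro x
      rw [← Equiv.sum_comp (Equiv.subLeft (x ^ 2))]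
      refine Finset.sum_congr rfl (fun c _ => ?_)
      simp only [hφ, Equiv.subLeft_apply, sub_sub_cancel]
      split_ifs
      · rfl
      · congr 1; ring
    rw [Finset.sum_congr rfl (fun x _ => this x), Finset.sum_comm]
    rw [Finset.sum_eq_single (-(b / a))]
    · have h0 : -(b / a) ≠ 0 := neg_ne_zero.2 (div_ne_zero hb ha)
      have h4 : a + b * (-(b / a))⁻¹ = 0 := by field_simp; ring
      rw [h4]
      simp [hb, ha]
    · intro c _ hc
      by_cases hc0 : c = 0
      · simp [hc0]
      simp only [if_neg hc0]
      rw [AddChar.sum_mulShift _ (AddChar.IsPrimitive.of_ne_one hψ), if_neg, Nat.cast_zero]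
      intro h
      rcases mul_eq_zero.1 h with h | h
      · exact h2 h
      · apply hc
        field_simp at h ⊢
        linear_combination h
    · simp
  have h4 : ∑ x, ∑ y, φ x (y ^ 2) + ∑ x, ∑ y, φ x (δ * y ^ 2) = 2 * ∑ x, ∑ w, φ x w := by
    rw [← Finset.sum_add_distrib, Finset.mul_sum]
    exact Finset.sum_congr rfl (fun x _ => sum_sq_add hF δ hδ (φ x))
  rw [h1, ← h3, ← h4]
  ring

theorem exists_quad {F : Type} [Field F] [Fintype F] (p : ℕ) [CharP F p] (hp2 : p ≠ 2)
    (ψ : AddChar F ℂ) (hψ : ψ ≠ 1) (a b : F) (ha : a ≠ 0) (hb : b ≠ 0) :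
    ∃ (L : Type) (_ : Field L) (_ : Fintype L) (_ : CharP L p) (ψ' : AddChar L ℂ) (a' b' : L),
      ψ' ≠ 1 ∧ a' ≠ 0 ∧ b' ≠ 0 ∧ Fintype.card L = Fintype.card F ^ 2 ∧
      kloo ψ' a' b' = 2 * (Fintype.card F : ℂ) - kloo ψ a b ^ 2 := by
  classical
  have hF : ringChar F ≠ 2 := by rwa [ringChar.eq F p]
  have h2 : (2 : F) ≠ 0 := Ring.two_ne_zero hF
  obtain ⟨δ, hδ⟩ := FiniteField.exists_nonsquare hF
  have hfact : Fact (∀ r : F, r ^ 2 ≠ δ + 0 * r) := ⟨by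
    intro r hr
    exact hδ ⟨r, by rw [← sq, hr]; ring⟩⟩
  let L := QuadraticAlgebra F δ 0
  let _ : Fintype L := Fintype.ofEquiv (F × F) (QuadraticAlgebra.equivProd δ 0).symm
  have hchar : CharP L p := charP_of_injective_algebraMap (algebraMap F L).injective p
  let tr : L →+ F :=
    { toFun := fun z => 2 * z.re
      map_zero' := mul_zero 2
      map_add' := fun x y => mul_add 2 x.re y.re }
  let ψ' : AddChar L ℂ := ψ.compAddMonoidHom tr
  refine ⟨L, inferInstance, inferInstance, hchar, ψ', algebraMap F L a, algebraMap F L b, ?_, ?_, ?_,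
    ?_, ?_⟩
  · obtain ⟨y, hy⟩ := AddChar.ne_one_iff.1 hψ
    refine AddChar.ne_one_iff.2 ⟨algebraMap F L (y / 2), ?_⟩
    have : tr (algebraMap F L (y / 2)) = y := by
      simp only [tr, AddMonoidHom.coe_mk, ZeroHom.coe_mk]
      change 2 * (y / 2) = y
      field_simp
    simp only [ψ', AddChar.compAddMonoidHom_apply, this]
    exact hy
  · simpa using ha
  · simpa using hb
  · rw [Fintype.card_congr (QuadraticAlgebra.equivProd δ 0), Fintype.card_prod, sq]
  · rw [← kloo_aux hF ψ hψ a b ha hb δ hδ _ (fun x w => rfl)]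
    unfold kloo
    rw [← Fintype.sum_prod_type']
    refine Fintype.sum_equiv (QuadraticAlgebra.equivProd δ 0) _ _ ?_
    intro z
    have hn : z.re ^ 2 - δ * z.im ^ 2 = QuadraticAlgebra.norm z := by
      rw [QuadraticAlgebra.norm_def]; ring
    change _ = if z.re ^ 2 - δ * z.im ^ 2 = 0 then (0 : ℂ)
      else ψ (2 * (a * z.re + b * (z.re * (z.re ^ 2 - δ * z.im ^ 2)⁻¹)))
    rw [hn]
    have hz : (z = 0) ↔ QuadraticAlgebra.norm z = 0 := QuadraticAlgebra.norm_eq_zero_iff_eq_zero.symm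
    by_cases h : z = 0
    · rw [if_pos h, if_pos (hz.1 h)]
    · rw [if_neg h, if_neg (fun h' => h (hz.2 h'))]
      simp only [ψ', AddChar.compAddMonoidHom_apply, tr, AddMonoidHom.coe_mk, ZeroHom.coe_mk]
      congr 2
      rw [QuadraticAlgebra.re_add, QuadraticAlgebra.re_mul, QuadraticAlgebra.re_mul]
      change a * z.re + δ * 0 * z.im + (b * ((QuadraticAlgebra.norm z)⁻¹ * (z.re + 0 * z.im)) +
        δ * 0 * ((QuadraticAlgebra.norm z)⁻¹ * (-z.im))) = _
      ring

theorem kloo_eps (p : ℕ) [Fact p.Prime] (hp2 : p ≠ 2) (k : ℕ) : ∀ (F : Type) [Field F] [Fintype F] [CharP F p]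
    (ψ : AddChar F ℂ) (_ : ψ ≠ 1) (a b : F) (_ : a ≠ 0) (_ : b ≠ 0),
    ‖kloo ψ a b‖ ≤ (2 + (5 * p + 3) / 2 ^ k) * √(Fintype.card F : ℝ) := by
  induction k with
  | zero =>
    intro F _ _ _ ψ hψ a b ha hb
    obtain ⟨L, _, _, _, ψ', a', b', hψ', ha', hb', hcard, hk⟩ := exists_quad p hp2 ψ hψ a b ha hb
    obtain ⟨n, -, hn⟩ := FiniteField.card F p
    obtain ⟨n, rfl⟩ : ∃ n' : ℕ, n = n'.succPNat := ⟨n.natPred, by simp⟩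
    have h := kloo_weak p n (by rw [hcard, hn]; rfl) ψ' hψ' a' b' ha'
    set q : ℝ := (Fintype.card F : ℝ) with hq
    have hq' : (p : ℝ) ^ (n + 1) = q := by rw [hq, hn]; push_cast; rfl
    have hq0 : 0 ≤ q := by positivity
    rw [hq'] at h
    have h1 : kloo ψ a b ^ 2 = 2 * (Fintype.card F : ℂ) - kloo ψ' a' b' := by rw [hk]; ring
    have h2 : ‖kloo ψ a b‖ ^ 2 ≤ 2 * q + (5 * p + 1) * q := by
      rw [← norm_pow, h1]
      refine (norm_sub_le _ _).trans (add_le_add ?_ h)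
      simp [hq]
    refine abs_le_of_sq_le_sq' ?_ (by positivity) |>.2
    rw [mul_pow, Real.sq_sqrt hq0]
    have : (0 : ℝ) ≤ p := by positivity
    refine h2.trans ?_
    nlinarith [mul_nonneg hq0 this, mul_nonneg (mul_nonneg hq0 this) this]
  | succ k ih =>
    intro F _ _ _ ψ hψ a b ha hb
    obtain ⟨L, _, _, _, ψ', a', b', hψ', ha', hb', hcard, hk⟩ := exists_quad p hp2 ψ hψ a b ha hb
    have h := ih L ψ' hψ' a' b' ha' hb'
    set q : ℝ := (Fintype.card F : ℝ) with hq
    have hq0 : 0 ≤ q := by positivity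
    rw [hcard] at h
    push_cast at h
    rw [Real.sqrt_sq hq0] at h
    have h1 : kloo ψ a b ^ 2 = 2 * (Fintype.card F : ℂ) - kloo ψ' a' b' := by rw [hk]; ring
    have h2 : ‖kloo ψ a b‖ ^ 2 ≤ 2 * q + (2 + (5 * p + 3) / 2 ^ k) * q := by
      rw [← norm_pow, h1]
      refine (norm_sub_le _ _).trans (add_le_add ?_ h)
      simp [hq]
    refine abs_le_of_sq_le_sq' ?_ (by positivity) |>.2
    rw [mul_pow, Real.sq_sqrt hq0]
    refine h2.trans ?_
    have e : ((5 * p + 3 : ℝ)) / 2 ^ k = 2 * ((5 * p + 3) / 2 ^ (k + 1)) := by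
      rw [pow_succ]; field_simp
    rw [e]
    have hε : (0 : ℝ) ≤ (5 * p + 3 : ℝ) / 2 ^ (k + 1) := by positivity
    generalize (5 * p + 3 : ℝ) / 2 ^ (k + 1) = ε at hε ⊢
    nlinarith [mul_nonneg hq0 (sq_nonneg ε), mul_nonneg hq0 hε]

theorem kloo_weil {F : Type} [Field F] [Fintype F] (hF : ringChar F ≠ 2)
    (ψ : AddChar F ℂ) (hψ : ψ ≠ 1) (a b : F) (ha : a ≠ 0) (hb : b ≠ 0) :
    ‖kloo ψ a b‖ ≤ 2 * √(Fintype.card F : ℝ) := by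
  have : Fact (ringChar F).Prime := ⟨CharP.char_is_prime F _⟩
  have h := fun k => kloo_eps (ringChar F) hF k F ψ hψ a b ha hb
  have hl : Filter.Tendsto (fun k : ℕ => (2 + (5 * (ringChar F : ℝ) + 3) / 2 ^ k) * √(Fintype.card F : ℝ))
      Filter.atTop (nhds ((2 + 0) * √(Fintype.card F : ℝ))) := by
    refine Filter.Tendsto.mul_const _ (Filter.Tendsto.const_add _ ?_)
    exact tendsto_const_nhds.div_atTop (tendsto_pow_atTop_atTop_of_one_lt (by norm_num))
  have := ge_of_tendsto' hl h
  simpa using this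

theorem kloo_zero {F : Type} [Field F] [Fintype F]
    (ψ : AddChar F ℂ) (hψ : ψ ≠ 1) (a : F) (ha : a ≠ 0) : kloo ψ a 0 = -1 := by
  classical
  unfold kloo
  have h := AddChar.sum_mulShift a (AddChar.IsPrimitive.of_ne_one hψ)
  rw [if_neg ha, ← Finset.add_sum_erase _ _ (Finset.mem_univ (0 : F))] at h
  rw [← Finset.add_sum_erase _ _ (Finset.mem_univ (0 : F))]
  simp only [if_true, zero_add]
  rw [Finset.sum_congr rfl (g := fun x => ψ (x * a))]
  · simp only [zero_mul, AddChar.map_zero_eq_one, Nat.cast_zero] at h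
    linear_combination h
  · intro x hx
    rw [if_neg (Finset.ne_of_mem_erase hx)]
    congr 1; ring

theorem gauss_sq {F : Type} [Field F] [Fintype F] [DecidableEq F] (hF : ringChar F ≠ 2)
    (ψ : AddChar F ℂ) (hψ : ψ ≠ 1) (t : F) (ht : t ≠ 0) :
    (∑ x : F, ψ (t * x ^ 2)) ^ 2 = (quadraticChar F (-1) : ℤ) * (Fintype.card F : ℂ) := by
  have hprim := AddChar.IsPrimitive.of_ne_one hψ
  let χ : MulChar F ℂ := (quadraticChar F).ringHomComp (Int.castRingHom ℂ)
  have hχ1 : χ ≠ 1 := (MulChar.ringHomComp_ne_one_iff (RingHom.injective_int _)).2 (quadraticChar_ne_one hF)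
  have hχ2 : χ.IsQuadratic := (quadraticChar_isQuadratic F).comp _
  have h1 : (∑ x : F, ψ (t * x ^ 2)) = gaussSum χ (ψ.mulShift t) := by
    rw [sum_comp_sq hF (fun w => ψ (t * w))]
    simp only [add_mul, one_mul, Finset.sum_add_distrib]
    have h2 : ∑ w, ψ (t * w) = 0 := by
      have h := AddChar.sum_mulShift t hprim
      rw [if_neg ht] at h
      simpa [mul_comm] using h
    rw [h2, add_zero]
    rfl
  rw [h1, gaussSum_sq hχ1 hχ2]
  · rfl
  · exact AddChar.IsPrimitive.of_ne_one (hprim ht)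

theorem gauss_shift {F : Type} [Field F] [Fintype F] (hF : ringChar F ≠ 2)
    (ψ : AddChar F ℂ) (t : F) (ht : t ≠ 0) (m : F) :
    ∑ x : F, ψ (t * x ^ 2 + m * x) = ψ (-(m ^ 2 / 4) * t⁻¹) * ∑ x : F, ψ (t * x ^ 2) := by
  have h2 : (2 : F) ≠ 0 := Ring.two_ne_zero hF
  have h4 : (4 : F) ≠ 0 := by
    have : (4 : F) = 2 * 2 := by norm_num
    rw [this]; exact mul_ne_zero h2 h2
  rw [← Equiv.sum_comp (Equiv.subRight (m / (2 * t))), Finset.mul_sum]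
  refine Finset.sum_congr rfl (fun x _ => ?_)
  rw [← AddChar.map_add_eq_mul]
  congr 1
  simp only [Equiv.subRight_apply]
  have e4 : (4 : F) = 2 * 2 := by norm_num
  rw [e4]
  field_simp
  ring

theorem sum_fin2 {F : Type} [Fintype F] (g : (Fin 2 → F) → ℂ) :
    ∑ x, g x = ∑ u, ∑ v, g ![u, v] := by
  rw [← Fintype.sum_prod_type']
  exact Fintype.sum_equiv (finTwoArrowEquiv F) _ _ (fun x => by
    congr 1; ext i; fin_cases i <;> simp)

theorem sum_char2 {F : Type} [Field F] [Fintype F] [DecidableEq F] 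
    (ψ : AddChar F ℂ) (hψ : ψ ≠ 1) (m : Fin 2 → F) :
    ∑ x : Fin 2 → F, ψ (m 0 * x 0 + m 1 * x 1) = if m = 0 then (Fintype.card F : ℂ) ^ 2 else 0 := by
  have hprim := AddChar.IsPrimitive.of_ne_one hψ
  rw [sum_fin2]
  simp only [AddChar.map_add_eq_mul, Matrix.cons_val_zero, Matrix.cons_val_one]
  rw [← Finset.sum_mul_sum]
  have h1 := AddChar.sum_mulShift (m 0) hprim
  have h2 := AddChar.sum_mulShift (m 1) hprim
  simp only [mul_comm _ (m 0)] at h1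
  simp only [mul_comm _ (m 1)] at h2
  rw [h1, h2]
  by_cases a0 : m 0 = 0
  · by_cases a1 : m 1 = 0
    · have : m = 0 := by ext i; fin_cases i <;> simp [a0, a1]
      simp [this, sq]
    · have : m ≠ 0 := fun h => a1 (by simp [h])
      simp [this, a1]
  · have : m ≠ 0 := fun h => a0 (by simp [h])
    simp [this, a0]

/-- Fourier transform of the circle. -/
noncomputable def circ {F : Type} [Field F] [Fintype F] (ψ : AddChar F ℂ) (a : F) (m : Fin 2 → F) : ℂ :=
  open Classical in ∑ x : Fin 2 → F, if fnorm x = a then ψ (m 0 * x 0 + m 1 * x 1) else 0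

theorem circ_eq {F : Type} [Field F] [Fintype F] [DecidableEq F] (hF : ringChar F ≠ 2)
    (ψ : AddChar F ℂ) (hψ : ψ ≠ 1) (a : F) (m : Fin 2 → F) :
    circ ψ a m = (if m = 0 then (Fintype.card F : ℂ) else 0) +
      (quadraticChar F (-1) : ℤ) * kloo ψ (-a) (-(fnorm m / 4)) := by
  have hprim := AddChar.IsPrimitive.of_ne_one hψ
  have hq : (Fintype.card F : ℂ) ≠ 0 := by simp
  have h1 : (Fintype.card F : ℂ) * circ ψ a m =
      ∑ t : F, ∑ x : Fin 2 → F, ψ (t * (fnorm x - a) + (m 0 * x 0 + m 1 * x 1)) := by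
    unfold circ
    rw [Finset.sum_comm, Finset.mul_sum]
    refine Finset.sum_congr rfl (fun x _ => ?_)
    simp only [AddChar.map_add_eq_mul ψ (_ * _) (_ + _)]
    rw [← Finset.sum_mul, AddChar.sum_mulShift _ hprim]
    by_cases h : fnorm x = a
    · simp [h]
    · simp [h, sub_eq_zero]
  apply mul_left_cancel₀ hq
  rw [h1]
  have h2 : ∀ t : F, t ≠ 0 → ∑ x : Fin 2 → F, ψ (t * (fnorm x - a) + (m 0 * x 0 + m 1 * x 1)) =
      (quadraticChar F (-1) : ℤ) * (Fintype.card F : ℂ) * ψ (-a * t + -(fnorm m / 4) * t⁻¹) := by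
    intro t ht
    rw [sum_fin2]
    have : ∀ u v : F, ψ (t * (fnorm ![u, v] - a) + (m 0 * ![u, v] 0 + m 1 * ![u, v] 1)) =
        ψ (-a * t) * (ψ (t * u ^ 2 + m 0 * u) * ψ (t * v ^ 2 + m 1 * v)) := by
      intro u v
      rw [← AddChar.map_add_eq_mul, ← AddChar.map_add_eq_mul]
      congr 1
      simp [fnorm]
      ring
    simp only [this, ← Finset.mul_sum]
    rw [← Finset.sum_mul, gauss_shift hF ψ t ht, gauss_shift hF ψ t ht, ← gauss_sq hF ψ hψ t ht]
    have e : -a * t + -(fnorm m / 4) * t⁻¹ = -a * t + (-(m 0 ^ 2 / 4) * t⁻¹ + -(m 1 ^ 2 / 4) * t⁻¹) := by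
      simp [fnorm]; ring
    rw [e, AddChar.map_add_eq_mul, AddChar.map_add_eq_mul]
    ring
  rw [← Finset.add_sum_erase _ _ (Finset.mem_univ (0 : F))]
  rw [Finset.sum_congr rfl (fun t ht => h2 t (Finset.ne_of_mem_erase ht))]
  have hk : kloo ψ (-a) (-(fnorm m / 4)) =
      ∑ t ∈ Finset.univ.erase (0 : F), ψ (-a * t + -(fnorm m / 4) * t⁻¹) := by
    unfold kloo
    rw [← Finset.add_sum_erase _ _ (Finset.mem_univ (0 : F))]
    simp only [if_true, zero_add]
    refine Finset.sum_congr rfl (fun t ht => ?_)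
    rw [if_neg (Finset.ne_of_mem_erase ht)]
  rw [hk]
  simp only [zero_mul, zero_add, sum_char2 ψ hψ, ← Finset.mul_sum]
  split_ifs <;> ring

theorem circ_bound {F : Type} [Field F] [Fintype F] (hF : ringChar F ≠ 2)
    (ψ : AddChar F ℂ) (hψ : ψ ≠ 1) (a : F) (ha : a ≠ 0) (m : Fin 2 → F) (hm : m ≠ 0) :
    ‖circ ψ a m‖ ≤ 2 * √(Fintype.card F : ℝ) := by
  classical
  have h2 : (2 : F) ≠ 0 := Ring.two_ne_zero hF
  have h4 : (4 : F) ≠ 0 := by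
    have : (4 : F) = 2 * 2 := by norm_num
    rw [this]; exact mul_ne_zero h2 h2
  rw [circ_eq hF ψ hψ, if_neg hm, zero_add, norm_mul]
  have hε : ‖((quadraticChar F (-1) : ℤ) : ℂ)‖ = 1 := by
    rcases quadraticChar_dichotomy (F := F) (a := -1) (by simp) with h | h <;> simp [h]
  rw [hε, one_mul]
  by_cases hz : fnorm m = 0
  · rw [hz, zero_div, neg_zero, kloo_zero ψ hψ _ (neg_ne_zero.2 ha), norm_neg, norm_one]
    have : (1 : ℝ) ≤ √(Fintype.card F : ℝ) := Real.one_le_sqrt.2 (by exact_mod_cast Fintype.card_pos)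
    linarith
  · exact kloo_weil hF ψ hψ _ _ (neg_ne_zero.2 ha) (neg_ne_zero.2 (div_ne_zero hz h4))

theorem circ_zero {F : Type} [Field F] [Fintype F] (hF : ringChar F ≠ 2)
    (ψ : AddChar F ℂ) (hψ : ψ ≠ 1) : ∃ ε : ℝ, (ε = 1 ∨ ε = -1) ∧ ∀ a : F, a ≠ 0 →
    circ ψ a 0 = ((Fintype.card F + ε : ℝ) : ℂ) := by
  classical
  refine ⟨-((quadraticChar F (-1) : ℤ) : ℝ), ?_, ?_⟩
  · rcases quadraticChar_dichotomy (F := F) (a := -1) (by simp) with h | h <;> simp [h]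
  · intro a ha
    rw [circ_eq hF ψ hψ]
    have : fnorm (0 : Fin 2 → F) = 0 := by simp [fnorm]
    rw [this, zero_div, neg_zero, kloo_zero ψ hψ _ (neg_ne_zero.2 ha)]
    simp

/-- Fourier transform on the plane. -/
noncomputable def hatF {F : Type} [Field F] [Fintype F] (ψ : AddChar F ℂ) (g : (Fin 2 → F) → ℂ)
    (m : Fin 2 → F) : ℂ := ∑ x : Fin 2 → F, g x * ψ (m 0 * x 0 + m 1 * x 1)

theorem parseval2 {F : Type} [Field F] [Fintype F] (ψ : AddChar F ℂ) (hψ : ψ ≠ 1)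
    (g : (Fin 2 → F) → ℂ) :
    ∑ m, ‖hatF ψ g m‖ ^ 2 = (Fintype.card F : ℝ) ^ 2 * ∑ x, ‖g x‖ ^ 2 := by
  classical
  apply Complex.ofReal_injective
  push_cast
  simp only [← Complex.mul_conj']
  have h : ∀ m, hatF ψ g m * (starRingEnd ℂ) (hatF ψ g m) =
      ∑ x, ∑ y, g x * (starRingEnd ℂ) (g y) *
        ψ ((x - y) 0 * m 0 + (x - y) 1 * m 1) := by
    intro m
    unfold hatF
    rw [map_sum, Finset.sum_mul_sum]
    refine Finset.sum_congr rfl (fun x _ => Finset.sum_congr rfl (fun y _ => ?_))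
    rw [map_mul, ← AddChar.map_neg_eq_conj]
    have e : (x - y) 0 * m 0 + (x - y) 1 * m 1 =
      (m 0 * x 0 + m 1 * x 1) + -(m 0 * y 0 + m 1 * y 1) := by
      simp only [Pi.sub_apply]; ring
    rw [e, AddChar.map_add_eq_mul ψ (m 0 * x 0 + m 1 * x 1)]
    ring
  simp only [h]
  rw [Finset.sum_comm, Finset.mul_sum]
  refine Finset.sum_congr rfl (fun x _ => ?_)
  rw [Finset.sum_comm]
  simp only [← Finset.mul_sum, sum_char2 ψ hψ, sub_eq_zero]
  rw [Finset.sum_eq_single x]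
  · simp; ring
  · intro y _ hy
    simp [Ne.symm hy]
  · simp

/-- Circular sums. -/
noncomputable def csum {F : Type} [Field F] [Fintype F] (a : F) (g : (Fin 2 → F) → ℝ)
    (x : Fin 2 → F) : ℝ := open Classical in ∑ y, if fnorm (x - y) = a then g y else 0

theorem csum_hat {F : Type} [Field F] [Fintype F] (ψ : AddChar F ℂ) (a : F)
    (g : (Fin 2 → F) → ℝ) (m : Fin 2 → F) :
    hatF ψ (fun x => (csum a g x : ℂ)) m = circ ψ a m * hatF ψ (fun x => (g x : ℂ)) m := by
  classical
  unfold hatF circ csum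
  rw [Finset.sum_mul_sum]
  push_cast
  simp only [Finset.sum_mul]
  rw [Finset.sum_comm]
  conv_rhs => rw [Finset.sum_comm]
  refine Finset.sum_congr rfl (fun y _ => ?_)
  rw [← Equiv.sum_comp (Equiv.addRight y)]
  refine Finset.sum_congr rfl (fun z _ => ?_)
  have e : m 0 * (z + y) 0 + m 1 * (z + y) 1 =
      (m 0 * z 0 + m 1 * z 1) + (m 0 * y 0 + m 1 * y 1) := by
    simp only [Pi.add_apply]; ring
  have e2 : Equiv.addRight y z = z + y := rfl
  rw [e2, e, add_sub_cancel_right, AddChar.map_add_eq_mul ψ (m 0 * z 0 + m 1 * z 1)]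
  by_cases hz : fnorm z = a
  · simp only [hz, if_true]
    ring
  · simp only [hz, if_false, Complex.ofReal_zero, zero_mul]

theorem csum_l2 {F : Type} [Field F] [Fintype F] (hF : ringChar F ≠ 2)
    (ψ : AddChar F ℂ) (hψ : ψ ≠ 1) (a : F) (ha : a ≠ 0) (g : (Fin 2 → F) → ℝ)
    (hg : ∑ x, g x = 0) :
    ∑ x, csum a g x ^ 2 ≤ 4 * (Fintype.card F : ℝ) * ∑ x, g x ^ 2 := by
  have h1 := parseval2 ψ hψ (fun x => (csum a g x : ℂ))
  have h2 := parseval2 ψ hψ (fun x => (g x : ℂ))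
  simp only [Complex.norm_real, Real.norm_eq_abs, sq_abs] at h1 h2
  have hq : (0 : ℝ) < (Fintype.card F : ℝ) ^ 2 := by
    have : (0 : ℝ) < Fintype.card F := by exact_mod_cast Fintype.card_pos
    positivity
  refine le_of_mul_le_mul_left ?_ hq
  rw [← h1]
  have : (Fintype.card F : ℝ) ^ 2 * (4 * (Fintype.card F : ℝ) * ∑ x, g x ^ 2) =
    4 * (Fintype.card F : ℝ) * ((Fintype.card F : ℝ) ^ 2 * ∑ x, g x ^ 2) := by ring
  rw [this, ← h2, Finset.mul_sum]
  refine Finset.sum_le_sum (fun m _ => ?_)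
  rw [csum_hat, norm_mul, mul_pow]
  by_cases hm : m = 0
  · have : hatF ψ (fun x => (g x : ℂ)) m = 0 := by
      unfold hatF
      simp only [hm, Pi.zero_apply, zero_mul, add_zero, AddChar.map_zero_eq_one, mul_one]
      rw [← Complex.ofReal_sum, hg, Complex.ofReal_zero]
    simp [this]
  · refine mul_le_mul_of_nonneg_right ?_ (by positivity)
    have h := circ_bound hF ψ hψ a ha m hm
    have h' := pow_le_pow_left₀ (norm_nonneg _) h 2
    rw [mul_pow, Real.sq_sqrt (by positivity)] at h'
    linarith

theorem csum_one {F : Type} [Field F] [Fintype F] (ψ : AddChar F ℂ) (a : F) (s : ℝ)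
    (hs : circ ψ a 0 = (s : ℂ)) (x : Fin 2 → F) : csum a (fun _ => 1) x = s := by
  classical
  apply Complex.ofReal_injective
  rw [← hs]
  unfold csum circ
  rw [Complex.ofReal_sum]
  simp only [Pi.zero_apply, zero_mul, add_zero, AddChar.map_zero_eq_one]
  exact Fintype.sum_equiv (Equiv.subLeft x) _ _ (fun y => by
    by_cases h : fnorm (x - y) = a <;> simp [h])

theorem csum_sum {F : Type} [Field F] [Fintype F] (ψ : AddChar F ℂ) (a : F) (s : ℝ)
    (hs : circ ψ a 0 = (s : ℂ)) (g : (Fin 2 → F) → ℝ) : ∑ x, csum a g x = s * ∑ x, g x := by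
  apply Complex.ofReal_injective
  have := csum_hat ψ a g 0
  rw [hs] at this
  unfold hatF at this
  simp only [Pi.zero_apply, zero_mul, add_zero, AddChar.map_zero_eq_one, mul_one] at this
  push_cast
  exact this

theorem final_arith (q r s ε n δ v A B C : ℝ) (hq : 1 ≤ q) (hr : 1 ≤ r) (hr2 : r ^ 2 = q)
    (hε : ε = 1 ∨ ε = -1) (hs : s = q + ε) (hn : 0 ≤ n) (hδ : q ^ 2 * δ = n)
    (hδ0 : 0 ≤ δ) (hv : v = n * (1 - δ)) (hv0 : 0 ≤ v)
    (hA : |A| ≤ 2 * r * v) (hB : |B| ≤ 2 * r * v) (hC : |C| ≤ 4 * q * v) :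
    |s ^ 2 * δ ^ 2 * n + s * δ * (A + B) + C - n ^ 3 / q ^ 2| ≤
      4 * r * (q + 1) / q ^ 2 * n ^ 2 + 4 * q * n := by
  have hq0 : q ≠ 0 := by positivity
  have hs0 : 0 ≤ s := by rcases hε with h | h <;> rw [hs, h] <;> linarith
  have hs1 : s ≤ q + 1 := by rcases hε with h | h <;> rw [hs, h] <;> linarith
  have e1 : n ^ 3 / q ^ 2 = q ^ 2 * δ ^ 2 * n := by rw [← hδ]; field_simp
  have e2 : 4 * r * (q + 1) / q ^ 2 * n ^ 2 = 4 * r * (q + 1) * (δ * n) := by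
    rw [← hδ]; field_simp
  rw [e1, e2]
  have h1 : |(s ^ 2 - q ^ 2) * (δ ^ 2 * n)| ≤ 4 * r * (q + 1) * (δ ^ 2 * n) := by
    rw [abs_mul, abs_of_nonneg (by positivity : 0 ≤ δ ^ 2 * n)]
    refine mul_le_mul_of_nonneg_right ?_ (by positivity)
    have h3 : q + 1 ≤ r * (q + 1) := le_mul_of_one_le_left (by linarith) hr
    rw [hs, abs_le]
    rcases hε with h | h <;> rw [h] <;> constructor <;> nlinarith
  have h2 : |s * δ * (A + B)| ≤ (q + 1) * δ * (4 * r * v) := by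
    rw [abs_mul, abs_of_nonneg (by positivity : 0 ≤ s * δ)]
    have : |A + B| ≤ 4 * r * v := (abs_add_le A B).trans (by linarith)
    gcongr
  have e3 : s ^ 2 * δ ^ 2 * n + s * δ * (A + B) + C - q ^ 2 * δ ^ 2 * n =
    (s ^ 2 - q ^ 2) * (δ ^ 2 * n) + s * δ * (A + B) + C := by ring
  rw [e3]
  have h4 : 4 * q * v ≤ 4 * q * n := by
    have : v ≤ n := by rw [hv]; nlinarith
    gcongr
  have e5 : (q + 1) * δ * (4 * r * v) = 4 * r * (q + 1) * (δ * n) - 4 * r * (q + 1) * (δ ^ 2 * n) := by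
    rw [hv]; ring
  have h6 := abs_add_three ((s ^ 2 - q ^ 2) * (δ ^ 2 * n)) (s * δ * (A + B)) C
  linarith

theorem csum_lin {F : Type} [Field F] [Fintype F] (a : F) (g : (Fin 2 → F) → ℝ) (d : ℝ)
    (x : Fin 2 → F) : csum a g x = d * csum a (fun _ => 1) x + csum a (fun y => g y - d) x := by
  classical
  unfold csum
  rw [Finset.mul_sum, ← Finset.sum_add_distrib]
  refine Finset.sum_congr rfl (fun y _ => ?_)
  split_ifs <;> ring

theorem triple_count {F : Type} [Field F] [Fintype F] (E : Set (Fin 2 → F)) (a b : F) :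
    (Set.ncard {t : (Fin 2 → F) × (Fin 2 → F) × (Fin 2 → F) |
          t.1 ∈ E ∧ t.2.1 ∈ E ∧ t.2.2 ∈ E ∧
          fnorm (t.1 - t.2.1) = a ∧ fnorm (t.1 - t.2.2) = b} : ℝ) =
    open Classical in
    ∑ x, (if x ∈ E then (1 : ℝ) else 0) * (csum a (fun y => if y ∈ E then (1 : ℝ) else 0) x *
      csum b (fun y => if y ∈ E then (1 : ℝ) else 0) x) := by
  classical
  rw [Set.ncard_eq_toFinset_card', Set.toFinset_setOf, Finset.card_filter, Nat.cast_sum,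
    Fintype.sum_prod_type]
  refine Finset.sum_congr rfl (fun x _ => ?_)
  unfold csum
  rw [Finset.sum_mul_sum, Finset.mul_sum, Fintype.sum_prod_type]
  refine Finset.sum_congr rfl (fun y _ => ?_)
  rw [Finset.mul_sum]
  refine Finset.sum_congr rfl (fun z _ => ?_)
  by_cases h1 : x ∈ E <;> by_cases h2 : y ∈ E <;> by_cases h3 : z ∈ E <;>
    by_cases h4 : fnorm (x - y) = a <;> by_cases h5 : fnorm (x - z) = b <;>
    simp [h1, h2, h3, h4, h5]

theorem corr_bound {V : Type} [Fintype V] (f R : V → ℝ) (q v r : ℝ) (hq : 0 ≤ q) (hr : 0 ≤ r)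
    (hr2 : r ^ 2 = q) (hv : ∑ x, f x ^ 2 = v) (hR : ∑ x, R x ^ 2 ≤ 4 * q * v) :
    |∑ x, f x * R x| ≤ 2 * r * v := by
  have hv0 : 0 ≤ v := by rw [← hv]; exact Finset.sum_nonneg (fun x _ => sq_nonneg _)
  apply abs_le_of_sq_le_sq _ (by positivity)
  refine (Finset.sum_mul_sq_le_sq_mul_sq _ _ _).trans ?_
  rw [hv]
  calc v * ∑ x, R x ^ 2 ≤ v * (4 * q * v) := by gcongr
    _ = (2 * r * v) ^ 2 := by rw [← hr2]; ring

theorem stmt_13 (F : Type) [Field F] [Fintype F] (hq : Odd (Fintype.card F))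
    (E : Set (Fin 2 → F)) (a b : F) (ha : a ≠ 0) (hb : b ≠ 0) :
    |(Set.ncard {t : (Fin 2 → F) × (Fin 2 → F) × (Fin 2 → F) |
          t.1 ∈ E ∧ t.2.1 ∈ E ∧ t.2.2 ∈ E ∧
          fnorm (t.1 - t.2.1) = a ∧ fnorm (t.1 - t.2.2) = b} : ℝ) -
        (E.ncard : ℝ) ^ 3 / (Fintype.card F : ℝ) ^ 2| ≤
      4 * Real.sqrt (Fintype.card F) * ((Fintype.card F : ℝ) + 1) /
          (Fintype.card F : ℝ) ^ 2 * (E.ncard : ℝ) ^ 2 +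
        4 * (Fintype.card F : ℝ) * (E.ncard : ℝ) := by
  classical
  have hF : ringChar F ≠ 2 := by
    intro h
    have h2 := FiniteField.even_card_iff_char_two.1 h
    have h3 := Nat.odd_iff.1 hq
    omega
  obtain ⟨ψ, hψ⟩ : ∃ ψ : AddChar F ℂ, ψ ≠ 1 := by
    obtain ⟨e, he⟩ := (AddChar.exists_apply_ne_zero (α := F) (a := 1)).2 one_ne_zero
    exact ⟨e, fun h => he (by rw [h]; rfl)⟩
  obtain ⟨ε, hε, hcirc⟩ := circ_zero hF ψ hψ
  rw [triple_count]
  set e : (Fin 2 → F) → ℝ := fun y => if y ∈ E then (1 : ℝ) else 0 with he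
  have hn : ∑ x, e x = (E.ncard : ℝ) := by
    rw [Set.ncard_eq_toFinset_card']
    simp [he, Finset.sum_ite, Set.toFinset]
  have hee : ∀ x, e x * e x = e x := by
    intro x
    simp only [he]
    split_ifs <;> simp
  have he01 : ∀ x, 0 ≤ e x ∧ e x ≤ 1 := by
    intro x
    simp only [he]
    split_ifs <;> norm_num
  have hcard : (1 : ℝ) ≤ Fintype.card F := by exact_mod_cast Fintype.card_pos
  have hV : ∑ x : Fin 2 → F, (1 : ℝ) = (Fintype.card F : ℝ) ^ 2 := by simp
  generalize (E.ncard : ℝ) = n at hn ⊢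
  have hn0 : 0 ≤ n := by rw [← hn]; exact Finset.sum_nonneg (fun x _ => (he01 x).1)
  set q : ℝ := (Fintype.card F : ℝ) with hqdef
  obtain ⟨δ, hδ⟩ : ∃ δ : ℝ, q ^ 2 * δ = n := ⟨n / q ^ 2, by field_simp⟩
  have hδ0 : 0 ≤ δ := by
    have : δ = n / q ^ 2 := by rw [← hδ]; field_simp
    rw [this]; positivity
  set f : (Fin 2 → F) → ℝ := fun y => e y - δ with hf
  have hf0 : ∑ x, f x = 0 := by
    simp only [hf, Finset.sum_sub_distrib]
    rw [hn, ← hδ, ← hV, Finset.sum_mul]; simp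
  have hf2 : ∑ x, f x ^ 2 = n * (1 - δ) := by
    have : ∀ x, f x ^ 2 = e x - δ * e x - δ * f x := by
      intro x
      simp only [hf]
      linear_combination hee x
    simp only [this, Finset.sum_sub_distrib, ← Finset.mul_sum, hf0, hn]
    ring
  have hv0 : 0 ≤ n * (1 - δ) := by rw [← hf2]; exact Finset.sum_nonneg (fun x _ => sq_nonneg _)
  have key : ∀ c : F, c ≠ 0 → (∀ x, csum c e x = (q + ε) * δ + csum c f x) ∧
      (∑ x, csum c f x ^ 2 ≤ 4 * q * (n * (1 - δ))) ∧
      |∑ x, e x * csum c f x| ≤ 2 * √q * (n * (1 - δ)) := by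
    intro c hc
    have h1 := csum_l2 hF ψ hψ c hc f hf0
    rw [hf2] at h1
    refine ⟨?_, h1, ?_⟩
    · intro x
      rw [csum_lin c e δ x, csum_one ψ c _ (hcirc c hc) x]
      ring
    · have h2 := csum_sum ψ c _ (hcirc c hc) f
      rw [hf0, mul_zero] at h2
      have h3 : ∑ x, e x * csum c f x = ∑ x, f x * csum c f x := by
        have : ∀ x, e x * csum c f x = f x * csum c f x + δ * csum c f x := by
          intro x; simp only [hf]; ring
        simp only [this, Finset.sum_add_distrib, ← Finset.mul_sum, h2]
        simp
      rw [h3]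
      exact corr_bound f _ q _ _ (by linarith) (Real.sqrt_nonneg _)
        (Real.sq_sqrt (by linarith)) hf2 h1
  obtain ⟨ka1, ka2, ka3⟩ := key a ha
  obtain ⟨kb1, kb2, kb3⟩ := key b hb
  have hC : |∑ x, e x * (csum a f x * csum b f x)| ≤ 4 * q * (n * (1 - δ)) := by
    refine (Finset.abs_sum_le_sum_abs _ _).trans ?_
    have : ∀ x, |e x * (csum a f x * csum b f x)| ≤ (csum a f x ^ 2 + csum b f x ^ 2) / 2 := by
      intro x
      rw [abs_mul, abs_of_nonneg (he01 x).1]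
      refine (mul_le_of_le_one_left (abs_nonneg _) (he01 x).2).trans ?_
      rw [abs_le]
      constructor <;> nlinarith [sq_nonneg (csum a f x + csum b f x), sq_nonneg (csum a f x - csum b f x)]
    refine (Finset.sum_le_sum (fun x _ => this x)).trans ?_
    rw [← Finset.sum_div, Finset.sum_add_distrib]
    linarith
  have hN : ∑ x, e x * (csum a e x * csum b e x) = (q + ε) ^ 2 * δ ^ 2 * n +
      (q + ε) * δ * (∑ x, e x * csum a f x + ∑ x, e x * csum b f x) +
      ∑ x, e x * (csum a f x * csum b f x) := by
    rw [← hn, Finset.mul_sum, ← Finset.sum_add_distrib, Finset.mul_sum, ← Finset.sum_add_distrib,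
      ← Finset.sum_add_distrib]
    refine Finset.sum_congr rfl (fun x _ => ?_)
    rw [ka1, kb1]
    ring
  rw [hN]
  exact final_arith q (√q) (q + ε) ε n δ (n * (1 - δ)) _ _ _ hcard (Real.one_le_sqrt.2 hcard)
    (Real.sq_sqrt (by linarith)) hε rfl hn0 hδ hδ0 rfl hv0 ka3 kb3 hC
end

section
/- Let q be an odd prime power, Q a non-degenerate quadratic form on F_q², E ⊆ F_q², and a, b ∈ F_q with a ≠ 0 and b ≠ 0. Then the number N of ordered triples (x,y,z) ∈ E × E × E with Q(x−y) = a and Q(x−z) = b satisfies |N − |E|³/q²| ≤ (4√q·(q+1)/q²)·|E|² + 4q·|E|. -/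
open Polynomial in
lemma exists_relation {F ι : Type*} [Field F] [Fintype ι] (p : ι → F[X]) (D : ℕ)
    (hp : ∀ i, (p i).natDegree < D) (hD : D < Fintype.card ι) :
    ∃ u : ι → F, u ≠ 0 ∧ ∑ i, C (u i) * p i = 0 := by
  let f : (ι → F) →ₗ[F] (Fin D → F) :=
    { toFun := fun u k => ∑ i, u i * (p i).coeff k
      map_add' := by
        intro u v; ext k; simp [add_mul, Finset.sum_add_distrib]
      map_smul' := by
        intro c u; ext k; simp [Finset.mul_sum, mul_assoc] }
  have h : LinearMap.ker f ≠ ⊥ := LinearMap.ker_ne_bot_of_finrank_lt (by simpa using hD)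
  obtain ⟨u, hu, hu0⟩ := (Submodule.ne_bot_iff _).1 h
  refine ⟨u, hu0, ?_⟩
  ext k
  simp only [finsetSum_coeff, coeff_C_mul, coeff_zero]
  by_cases hk : k < D
  · exact congrFun (LinearMap.mem_ker.1 hu) ⟨k, hk⟩
  · refine Finset.sum_eq_zero fun i _ => ?_
    rw [coeff_eq_zero_of_natDegree_lt (lt_of_lt_of_le (hp i) (not_lt.1 hk)), mul_zero]

open Polynomial in
lemma indep_of_degree {F ι : Type*} [Field F] [Fintype ι] (p : ι → F[X])
    (hp : ∀ i, p i ≠ 0) (hinj : ∀ i j, (p i).natDegree = (p j).natDegree → i = j)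
    (u : ι → F) (h : ∑ i, C (u i) * p i = 0) : u = 0 := by
  have h1 := degree_sum_eq_of_disjoint (fun i => C (u i) * p i) Finset.univ (by
    intro i hi j hj hij heq
    apply hij
    apply hinj
    have e := natDegree_eq_of_degree_eq heq
    have hi' : u i ≠ 0 := by rintro h0; exact hi.2 (by simp [h0])
    have hj' : u j ≠ 0 := by rintro h0; exact hj.2 (by simp [h0])
    simpa [natDegree_C_mul hi', natDegree_C_mul hj'] using e)
  rw [h, degree_zero] at h1
  ext i
  have h2 := (Finset.sup_eq_bot_iff _ _).1 h1.symm i (Finset.mem_univ i)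
  rw [degree_eq_bot] at h2
  simpa [hp i] using h2

/-- half trace -/
noncomputable def gfun {F L : Type*} [Field F] [Fintype F] [Field L] [Algebra F L] (a b : F)
    (m : ℕ) (x : L) : L :=
  ∑ i ∈ Finset.range m, (algebraMap F L a * x + algebraMap F L b * x⁻¹) ^ (Fintype.card F ^ i)

lemma frob_pow {F L : Type*} [Field F] [Fintype F] [Field L] [Algebra F L] (m : ℕ) :
    ∃ φ : L →ₐ[F] L, ∀ z, φ z = z ^ (Fintype.card F ^ m) :=
  ⟨FiniteField.frobeniusAlgHom F L ^ m, fun z => by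
    rw [AlgHom.coe_pow, FiniteField.coe_frobeniusAlgHom, pow_iterate]⟩

lemma gfun_pow {F L : Type*} [Field F] [Fintype F] [Field L] [Algebra F L] (a b : F)
    (m k : ℕ) (x : L) : (gfun a b m x) ^ (Fintype.card F ^ k)
      = gfun a b m (x ^ (Fintype.card F ^ k)) := by
  obtain ⟨φ, hφ⟩ := frob_pow (F := F) (L := L) k
  rw [← hφ, ← hφ, gfun, gfun, map_sum]
  simp

open Polynomial in
noncomputable def Ppoly {F : Type*} [Field F] [Fintype F] (a b : F) (μ : ℕ) : F[X] :=
  ∑ i ∈ Finset.range (μ + 1), (C a * X ^ (Fintype.card F ^ μ + Fintype.card F ^ i)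
    + C b * X ^ (Fintype.card F ^ μ - Fintype.card F ^ i))

open Polynomial in
lemma Ppoly_natDegree {F : Type*} [Field F] [Fintype F] (a b : F) (ha : a ≠ 0) (μ : ℕ) :
    (Ppoly a b μ).natDegree = 2 * Fintype.card F ^ μ := by
  have hq : 1 < Fintype.card F := Fintype.one_lt_card
  unfold Ppoly
  set q := Fintype.card F
  have hpos : 0 < q ^ μ := by positivity
  apply natDegree_eq_of_le_of_coeff_ne_zero
  · apply natDegree_sum_le_of_forall_le
    intro i hi
    have hi' : q ^ i ≤ q ^ μ := Nat.pow_le_pow_right (by omega) (by simpa [Nat.lt_succ_iff] using hi)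
    refine natDegree_add_le_of_degree_le ?_ ?_
    · exact (natDegree_C_mul_X_pow_le _ _).trans (by omega)
    · exact (natDegree_C_mul_X_pow_le _ _).trans (by omega)
  · rw [finsetSum_coeff, Finset.sum_range_succ, Finset.sum_eq_zero]
    · simp only [coeff_add, coeff_C_mul, coeff_X_pow]
      rw [if_pos (by omega), if_neg (by omega)]
      simpa using ha
    · intro i hi
      have hi' : q ^ i < q ^ μ := Nat.pow_lt_pow_right hq (by simpa using hi)
      simp only [coeff_add, coeff_C_mul, coeff_X_pow]
      rw [if_neg (by omega), if_neg (by omega)]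
      simp

open Polynomial in
lemma Ppoly_aeval {F L : Type*} [Field F] [Fintype F] [Field L] [Algebra F L] (a b : F) (μ : ℕ)
    (x : L) (hx : x ≠ 0) :
    aeval x (Ppoly a b μ) = x ^ (Fintype.card F ^ μ) * gfun a b (μ + 1) x := by
  have hq : 1 < Fintype.card F := Fintype.one_lt_card
  rw [Ppoly, gfun, map_sum, Finset.mul_sum]
  refine Finset.sum_congr rfl fun i hi => ?_
  obtain ⟨φ, hφ⟩ := frob_pow (F := F) (L := L) i
  have hi' : Fintype.card F ^ i ≤ Fintype.card F ^ μ :=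
    Nat.pow_le_pow_right (by omega) (by simpa [Nat.lt_succ_iff] using hi)
  rw [← hφ, map_add φ, map_mul φ, map_mul φ, AlgHom.commutes, AlgHom.commutes, map_inv₀, hφ]
  simp only [map_add, map_mul, aeval_C, aeval_X, map_pow]
  rw [pow_sub₀ x hx hi', pow_add]
  ring

lemma digits_inj {d q s s' j j' i i' : ℕ} (hs : s < d) (hs' : s' < d) (hj : j < q) (hj' : j' < q)
    (h : s + d * (j + q * i) = s' + d * (j' + q * i')) : s = s' ∧ j = j' ∧ i = i' := by
  have hd : 0 < d := by omega
  have hq : 0 < q := by omega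
  have h1 : s = s' := by
    have := congrArg (· % d) h
    simpa [Nat.add_mul_mod_self_left, Nat.mod_eq_of_lt hs, Nat.mod_eq_of_lt hs'] using this
  subst h1
  have h2 : j + q * i = j' + q * i' := by
    have := Nat.add_left_cancel h
    exact Nat.eq_of_mul_eq_mul_left hd this
  have h3 : j = j' := by
    have := congrArg (· % q) h2
    simpa [Nat.add_mul_mod_self_left, Nat.mod_eq_of_lt hj, Nat.mod_eq_of_lt hj'] using this
  subst h3
  exact ⟨rfl, rfl, Nat.eq_of_mul_eq_mul_left hq (Nat.add_left_cancel h2)⟩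

open Polynomial in
lemma stepanov_s14 {F L : Type*} [Field F] [Fintype F] [Field L] [Fintype L] [Algebra F L]
    (hodd : 2 < Fintype.card F) (a b c : F)
    (ha : a ≠ 0) (μ : ℕ) (hμ : 1 ≤ μ) (hL : Module.finrank F L = 2 * (μ + 1)) (T : Finset L)
    (hT : ∀ x ∈ T, x ≠ 0 ∧
      Algebra.trace F L (algebraMap F L a * x + algebraMap F L b * x⁻¹) = c) :
    T.card ≤ Fintype.card F ^ (2 * μ + 1) + 3 * Fintype.card F ^ (μ + 1) := by
  have hcardL : ∀ x : L, x ^ (Fintype.card F ^ (2 * (μ + 1))) = x := by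
    intro x
    rw [← hL, ← Module.card_eq_pow_finrank, FiniteField.pow_card]
  have htr : ∀ x ∈ T, gfun a b (μ + 1) x =
      algebraMap F L c - gfun a b (μ + 1) (x ^ (Fintype.card F ^ (μ + 1))) := by
    intro x hx
    have h := FiniteField.algebraMap_trace_eq_sum_pow F L
      (algebraMap F L a * x + algebraMap F L b * x⁻¹)
    rw [(hT x hx).2, hL, two_mul, Finset.sum_range_add, Nat.card_eq_fintype_card] at h
    rw [← gfun_pow, h, gfun, eq_sub_iff_add_eq]
    congr 1
    obtain ⟨φ, hφ⟩ := frob_pow (F := F) (L := L) (μ + 1)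
    rw [← hφ, map_sum]
    refine Finset.sum_congr rfl fun i _ => ?_
    rw [hφ, ← pow_mul, ← pow_add, add_comm i]
  set q := Fintype.card F with hqdef
  set d := q ^ μ with hd
  have hr : q ^ (μ + 1) = d * q := pow_succ _ _
  have hdpos : 1 < d := Nat.one_lt_pow (by omega) (by omega)
  have hdeg := Ppoly_natDegree a b ha μ
  rw [← hqdef, ← hd] at hdeg
  set P := Ppoly a b μ with hP
  have hP0 : P ≠ 0 := by
    intro h0
    rw [h0, natDegree_zero] at hdeg
    omega
  set r := q ^ (μ + 1) with hrdef
  let ι := Fin (d + 2) × Fin q × Fin d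
  let Hp : ι → F[X] := fun k => X ^ (r * k.2.2.1 + d * (q - 1 - k.2.1.1) + k.1.1) *
    (C c * X ^ d - P) ^ k.2.1.1
  let Gp : ι → F[X] := fun k => X ^ (k.2.2.1 + d * (q - 1 - k.2.1.1) + r * k.1.1) * P ^ k.2.1.1
  obtain ⟨u, hu0, hu⟩ := exists_relation Hp ((d + 1) * r + (d + 2)) (by
    rintro ⟨i, j, s⟩
    have h1 : (C c * X ^ d - P).natDegree ≤ 2 * d := by
      refine (natDegree_sub_le _ _).trans (max_le ?_ hdeg.le)
      exact (natDegree_C_mul_X_pow_le _ _).trans (by omega)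
    have h2 : (Hp ⟨i, j, s⟩).natDegree ≤ (r * s + d * (q - 1 - j) + i) + j * (2 * d) := by
      refine natDegree_mul_le.trans (add_le_add (natDegree_X_pow_le _) ?_)
      exact natDegree_pow_le.trans (Nat.mul_le_mul_left _ h1)
    refine lt_of_le_of_lt h2 ?_
    have hi := i.2
    have hj := j.2
    have hs := s.2
    obtain ⟨t, ht⟩ : ∃ t, q = j + 1 + t := ⟨q - (j + 1), by omega⟩
    have e1 : q - 1 - (j : ℕ) = t := by omega
    rw [e1, hr]
    have h3 : d * q * s + d * q ≤ d * q * d := by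
      rw [← Nat.mul_succ]; exact Nat.mul_le_mul_left _ hs
    have h4 : d * t + j * (2 * d) ≤ 2 * (d * q) := by
      have h5 : d * q = d * (j + 1 + t) := congrArg (d * ·) ht
      nlinarith
    nlinarith) (by
    simp only [ι, Fintype.card_prod, Fintype.card_fin, hr]
    nlinarith [Nat.mul_le_mul_left d (show 3 ≤ q by omega)])
  let G : F[X] := ∑ k, C (u k) * Gp k
  have hGdeg : ∀ k : ι, (Gp k).natDegree =
      (k.2.2.1 + d * (q - 1 - k.2.1.1) + r * k.1.1) + k.2.1.1 * (2 * d) := by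
    intro k
    rw [natDegree_mul (pow_ne_zero _ X_ne_zero) (pow_ne_zero _ hP0), natDegree_X_pow,
      natDegree_pow, hdeg]
  have hGdeg' : ∀ k : ι, (Gp k).natDegree =
      d * (q - 1) + (k.2.2.1 + d * (k.2.1.1 + q * k.1.1)) := by
    rintro ⟨i, j, s⟩
    rw [hGdeg]
    have hj := j.2
    obtain ⟨t, ht⟩ : ∃ t, q = j + 1 + t := ⟨q - (j + 1), by omega⟩
    have e1 : q - 1 - (j : ℕ) = t := by omega
    have e2 : q - 1 = j + t := by omega
    rw [e1, e2, hr]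
    ring
  have hG0 : G ≠ 0 := by
    intro h0
    refine hu0 (indep_of_degree Gp (fun k => mul_ne_zero (pow_ne_zero _ X_ne_zero)
      (pow_ne_zero _ hP0)) ?_ u h0)
    rintro ⟨i, j, s⟩ ⟨i', j', s'⟩ h
    rw [hGdeg', hGdeg'] at h
    obtain ⟨h1, h2, h3⟩ := digits_inj s.2 s'.2 j.2 j'.2 (Nat.add_left_cancel h)
    exact Prod.ext (Fin.ext h3) (Prod.ext (Fin.ext h2) (Fin.ext h1))
  have hGle : G.natDegree ≤ q ^ (2 * μ + 1) + 3 * r := by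
    apply natDegree_sum_le_of_forall_le
    rintro ⟨i, j, s⟩ _
    refine (natDegree_C_mul_le _ _).trans ?_
    rw [hGdeg']
    have e : q ^ (2 * μ + 1) = d * (d * q) := by rw [hd]; ring
    rw [e, hr]
    have hi := i.2
    have hj := j.2
    have hs := s.2
    have h1 : (s : ℕ) + d * j ≤ d * q := by
      have : d * (j + 1) ≤ d * q := Nat.mul_le_mul_left _ hj
      nlinarith
    have h2 : d * q * i ≤ d * q * (d + 1) := Nat.mul_le_mul_left _ (by omega)
    have h3 : d * (q - 1) ≤ d * q := Nat.mul_le_mul_left _ (by omega)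
    nlinarith
  refine le_trans ?_ hGle
  have hroots : T.val ⊆ (G.map (algebraMap F L)).roots := by
    intro x hx
    have hx' : x ∈ T := hx
    have hx0 := (hT x hx').1
    rw [mem_roots (Polynomial.map_ne_zero hG0), IsRoot, eval_map_algebraMap]
    set y := x ^ r with hy
    have hy0 : y ≠ 0 := pow_ne_zero _ hx0
    have hyr : y ^ r = x := by
      rw [hy, ← pow_mul, hrdef, ← pow_add, ← two_mul]; exact hcardL x
    have hg : gfun a b (μ + 1) x = algebraMap F L c - gfun a b (μ + 1) y := htr x hx'
    have hHy := congrArg (aeval y) hu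
    rw [map_zero, map_sum] at hHy
    have key : ∀ k : ι, y ^ (d * (q - 1)) * aeval x (C (u k) * Gp k)
        = x ^ (d * (q - 1)) * aeval y (C (u k) * Hp k) := by
      rintro ⟨i, j, s⟩
      simp only [Gp, Hp, map_mul, map_pow, map_sub, aeval_C, aeval_X]
      rw [hP, Ppoly_aeval a b μ x hx0, Ppoly_aeval a b μ y hy0, ← hqdef, ← hd, hg]
      have hj := j.2
      obtain ⟨t, ht⟩ : ∃ t, q = j + 1 + t := ⟨q - (j + 1), by omega⟩
      have e1 : q - 1 - (j : ℕ) = t := by omega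
      have e2 : q - 1 = j + t := by omega
      rw [e1, e2]
      have hxs : x ^ (s : ℕ) = y ^ (r * s) := by rw [pow_mul, hyr]
      have hxi : x ^ (r * i) = y ^ (i : ℕ) := by rw [pow_mul]
      rw [pow_add x, pow_add x, hxs, hxi]
      have e3 : algebraMap F L c * y ^ d - y ^ d * gfun a b (μ + 1) y
        = y ^ d * (algebraMap F L c - gfun a b (μ + 1) y) := by ring
      rw [e3]
      simp only [mul_pow, pow_add, mul_add, pow_mul]
      ring
    have : y ^ (d * (q - 1)) * aeval x G = 0 := by
      rw [map_sum, Finset.mul_sum, Finset.sum_congr rfl fun k _ => key k, ← Finset.mul_sum, hHy,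
        mul_zero]
    exact (mul_eq_zero.1 this).resolve_left (pow_ne_zero _ hy0)
  exact (card_le_degree_of_subset_roots hroots).trans (natDegree_map_le)
/-- Kloosterman sum -/
noncomputable def kl {L : Type*} [Field L] [Fintype L] (ψ : AddChar L ℂ) (a b : L) : ℂ :=
  ∑ x : L, open Classical in if x = 0 then 0 else ψ (a * x + b * x⁻¹)

noncomputable def trChar {F : Type*} (L : Type*) [Field F] [Field L] [Algebra F L]
    (ψ : AddChar F ℂ) : AddChar L ℂ :=
  ψ.compAddMonoidHom (Algebra.trace F L).toAddMonoidHom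

lemma trChar_apply {F L : Type*} [Field F] [Field L] [Algebra F L]
    (ψ : AddChar F ℂ) (x : L) : trChar L ψ x = ψ (Algebra.trace F L x) := rfl

lemma kl_bound_weak {F L : Type*} [Field F] [Fintype F] [Field L] [Fintype L] [Algebra F L]
    (hodd : 2 < Fintype.card F) (ψ : AddChar F ℂ) (hψ : ψ ≠ 1) (a b : F)
    (ha : a ≠ 0) (μ : ℕ) (hμ : 1 ≤ μ) (hL : Module.finrank F L = 2 * (μ + 1)) :
    ‖kl (trChar L ψ) (algebraMap F L a) (algebraMap F L b)‖
      ≤ 4 * Fintype.card F * (Fintype.card F : ℝ) ^ (μ + 1) := by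
  classical
  set q := Fintype.card F with hq
  let f : L → F := fun x => Algebra.trace F L (algebraMap F L a * x + algebraMap F L b * x⁻¹)
  let T : F → Finset L := fun c => Finset.univ.filter (fun x => x ≠ 0 ∧ f x = c)
  set B : ℕ := q ^ (2 * μ + 1) + 3 * q ^ (μ + 1) with hB
  have hT : ∀ c, (T c).card ≤ B := fun c =>
    stepanov_s14 hodd a b c ha μ hμ hL (T c) (fun x hx => (Finset.mem_filter.1 hx).2)
  have hS : kl (trChar L ψ) (algebraMap F L a) (algebraMap F L b) = ∑ c, (T c).card * ψ c := by
    unfold kl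
    have : ∀ x : L, (if x = 0 then (0 : ℂ) else
        trChar L ψ (algebraMap F L a * x + algebraMap F L b * x⁻¹))
        = ∑ c, if x ≠ 0 ∧ f x = c then ψ c else 0 := by
      intro x
      by_cases hx : x = 0
      · simp [hx]
      · simp [hx, f, trChar_apply]
    rw [Finset.sum_congr rfl fun x _ => this x, Finset.sum_comm]
    refine Finset.sum_congr rfl fun c _ => ?_
    rw [← Finset.sum_filter, Finset.sum_const, nsmul_eq_mul]
  have hsum : ∑ c, (T c).card = Fintype.card L - 1 := by
    have h1 : (Finset.univ.filter (fun x : L => x ≠ 0)).card = ∑ c, (T c).card := by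
      rw [Finset.card_eq_sum_card_fiberwise (f := f) (t := Finset.univ) (by intro x _; simp)]
      refine Finset.sum_congr rfl fun c _ => ?_
      rw [Finset.filter_filter]
    rw [← h1, Finset.filter_ne', Finset.card_erase_of_mem (Finset.mem_univ _), Finset.card_univ]
  have hcard : Fintype.card L = q ^ (2 * (μ + 1)) := by rw [Module.card_eq_pow_finrank (K := F), hL]
  have hψs : ∑ c, ψ c = 0 := AddChar.sum_eq_zero_of_ne_one hψ
  have hS2 : kl (trChar L ψ) (algebraMap F L a) (algebraMap F L b)
      = - ∑ c, ((B : ℂ) - (T c).card) * ψ c := by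
    rw [hS]
    simp only [sub_mul, Finset.sum_sub_distrib, ← Finset.mul_sum, hψs]
    ring
  rw [hS2, norm_neg]
  have h1 : ∀ c ∈ Finset.univ, ‖((B : ℂ) - (T c).card) * ψ c‖ ≤ (B : ℝ) - (T c).card := by
    intro c _
    rw [norm_mul, AddChar.norm_apply, mul_one, ← Nat.cast_sub (hT c), Complex.norm_natCast,
      Nat.cast_sub (hT c)]
  refine (norm_sum_le_of_le _ h1).trans ?_
  have hsum' : ∑ c, ((T c).card : ℝ) = (q : ℝ) ^ (2 * (μ + 1)) - 1 := by
    rw [← Nat.cast_sum, hsum, Nat.cast_sub Fintype.card_pos, hcard]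
    push_cast; ring
  rw [Finset.sum_sub_distrib, hsum', Finset.sum_const, Finset.card_univ, ← hq, nsmul_eq_mul, hB]
  push_cast
  have h2 : (1 : ℝ) ≤ q * (q : ℝ) ^ (μ + 1) := by
    have : (1 : ℝ) ≤ q := by exact_mod_cast (show 1 ≤ q by omega)
    exact one_le_mul_of_one_le_of_one_le this (one_le_pow₀ this)
  have h3 : (q : ℝ) * (q : ℝ) ^ (2 * μ + 1) = (q : ℝ) ^ (2 * (μ + 1)) := by ring
  nlinarith

lemma sum_sq {L : Type*} [Field L] [Fintype L] [DecidableEq L] (h2 : ringChar L ≠ 2) (f : L → ℂ) :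
    ∑ v, f (v ^ 2) = ∑ w, (1 + (quadraticChar L w : ℂ)) * f w := by
  have : ∀ v, f (v ^ 2) = ∑ w, if v ^ 2 = w then f w else 0 := by intro v; simp
  rw [Finset.sum_congr rfl fun v _ => this v, Finset.sum_comm]
  refine Finset.sum_congr rfl fun w _ => ?_
  rw [← Finset.sum_filter, Finset.sum_const, nsmul_eq_mul]
  congr 1
  have h := quadraticChar_card_sqrts h2 w
  have e : {x : L | x ^ 2 = w}.toFinset = Finset.univ.filter (fun x => x ^ 2 = w) := by
    ext; simp
  rw [e] at h
  have h' := congrArg (Int.cast : ℤ → ℂ) h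
  push_cast at h'
  rw [h', add_comm]

lemma sum_two_cover {L : Type*} [Field L] [Fintype L] (h2 : ringChar L ≠ 2) (ω : L)
    (hω : ¬ IsSquare ω) (f : L → ℂ) :
    ∑ v, f (v ^ 2) + ∑ v, f (ω * v ^ 2) = 2 * ∑ w, f w := by
  classical
  have hω0 : ω ≠ 0 := by rintro rfl; exact hω IsSquare.zero
  rw [sum_sq h2 f, sum_sq h2 (fun w => f (ω * w))]
  have : ∑ w, (1 + (quadraticChar L w : ℂ)) * f (ω * w)
      = ∑ w, (1 - (quadraticChar L w : ℂ)) * f w := by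
    refine Fintype.sum_equiv (Equiv.mulLeft₀ ω hω0) _ _ fun w => ?_
    simp only [Equiv.mulLeft₀_apply, map_mul, quadraticChar_neg_one_iff_not_isSquare.2 hω]
    push_cast; ring
  rw [this, ← Finset.sum_add_distrib, Finset.mul_sum]
  exact Finset.sum_congr rfl fun w _ => by ring

lemma kl_sq {L : Type*} [Field L] [Fintype L] (h2 : ringChar L ≠ 2)
    (ψ : AddChar L ℂ) (a b : L) : kl ψ a b ^ 2 = ∑ u : L, ∑ v : L,
      open Classical in if u ^ 2 - v ^ 2 = 0 then 0 else
        ψ (2 * u * (a + b * (u ^ 2 - v ^ 2)⁻¹)) := by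
  classical
  have h20 : (2 : L) ≠ 0 := Ring.two_ne_zero h2
  rw [sq, kl, Finset.sum_mul_sum, ← Finset.sum_product', ← Finset.sum_product']
  symm
  let e : L × L ≃ L × L :=
    { toFun := fun p => (p.1 + p.2, p.1 - p.2)
      invFun := fun p => ((p.1 + p.2) / 2, (p.1 - p.2) / 2)
      left_inv := by
        rintro ⟨x, y⟩
        simp only [Prod.mk.injEq]
        constructor <;> field_simp <;> ring
      right_inv := by
        rintro ⟨x, y⟩
        simp only [Prod.mk.injEq]
        constructor <;> field_simp <;> ring }
  refine Finset.sum_equiv e (by simp) ?_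
  rintro ⟨u, v⟩ _
  simp only [e, Equiv.coe_fn_mk]
  have hf : u ^ 2 - v ^ 2 = (u + v) * (u - v) := by ring
  rw [hf]
  by_cases h1 : u + v = 0
  · simp [h1]
  by_cases h1' : u - v = 0
  · simp [h1']
  rw [if_neg (mul_ne_zero h1 h1'), if_neg h1, if_neg h1', ← AddChar.map_add_eq_mul]
  congr 1
  field_simp
  ring

lemma sum_uw {L : Type*} [Field L] [Fintype L] (h2 : ringChar L ≠ 2)
    (ψ : AddChar L ℂ) (hψ : ψ ≠ 1) (a b : L) (ha : a ≠ 0) (hb : b ≠ 0) : (∑ u : L, ∑ w : L,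
      open Classical in if u ^ 2 - w = 0 then (0 : ℂ) else
        ψ (2 * u * (a + b * (u ^ 2 - w)⁻¹))) = Fintype.card L := by
  classical
  have h20 : (2 : L) ≠ 0 := Ring.two_ne_zero h2
  have h1 : ∀ u : L, (∑ w : L, if u ^ 2 - w = 0 then (0 : ℂ) else
        ψ (2 * u * (a + b * (u ^ 2 - w)⁻¹))) = ∑ n : L, if n = 0 then 0 else
        ψ (u * (2 * (a + b * n⁻¹))) := by
    intro u
    refine Fintype.sum_equiv (Equiv.subLeft (u ^ 2)) _ _ fun w => ?_
    simp only [Equiv.subLeft_apply]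
    congr 2
    ring
  rw [Finset.sum_congr rfl fun u _ => h1 u, Finset.sum_comm]
  have hprim := AddChar.IsPrimitive.of_ne_one hψ
  have h3 : ∀ n : L, (∑ u : L, if n = 0 then (0 : ℂ) else ψ (u * (2 * (a + b * n⁻¹))))
      = if n = - b / a then (Fintype.card L : ℂ) else 0 := by
    intro n
    by_cases hn : n = 0
    · rw [if_neg]
      · simp [hn]
      · rw [hn]; exact (div_ne_zero (neg_ne_zero.2 hb) ha).symm
    simp only [hn, if_false]
    rw [AddChar.sum_mulShift _ hprim]
    push_cast
    refine if_congr ?_ rfl rfl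
    simp only [mul_eq_zero, h20, false_or]
    rw [eq_div_iff ha]
    constructor
    · intro h
      field_simp at h
      linear_combination h
    · intro h
      field_simp
      linear_combination h
  rw [Finset.sum_congr rfl fun n _ => h3 n]
  simp

noncomputable instance {L : Type*} [Fintype L] (a b : L) : Fintype (QuadraticAlgebra L a b) :=
  Fintype.ofEquiv _ (QuadraticAlgebra.equivProd a b).symm

lemma qa_trace {L : Type*} [Field L] (ω : L) (z : QuadraticAlgebra L ω 0) :
    Algebra.trace L (QuadraticAlgebra L ω 0) z = 2 * z.re := by
  rw [Algebra.trace_eq_matrix_trace (QuadraticAlgebra.basis ω 0), Matrix.trace_fin_two,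
    Algebra.leftMulMatrix_eq_repr_mul, Algebra.leftMulMatrix_eq_repr_mul]
  have h0 : (QuadraticAlgebra.basis ω 0) 0 = ⟨1, 0⟩ := by
    simp [QuadraticAlgebra.basis]
  have h1 : (QuadraticAlgebra.basis ω 0) 1 = ⟨0, 1⟩ := by
    simp [QuadraticAlgebra.basis]
  rw [h0, h1]
  simp [QuadraticAlgebra.basis_repr_apply]
  ring

lemma kl_quad {L : Type*} [Field L] [Fintype L] (h2 : ringChar L ≠ 2)
    (ψ : AddChar L ℂ) (hψ : ψ ≠ 1) (a b : L) (ha : a ≠ 0) (hb : b ≠ 0) (ω : L)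
    (hω : ¬ IsSquare ω) [Fact (∀ r : L, r ^ 2 ≠ ω + 0 * r)] :
    kl (trChar (QuadraticAlgebra L ω 0) ψ) (algebraMap _ _ a) (algebraMap _ _ b)
      = 2 * Fintype.card L - kl ψ a b ^ 2 := by
  classical
  rw [eq_sub_iff_add_eq, kl_sq h2, ← sum_uw h2 ψ hψ a b ha hb, Finset.mul_sum]
  have key : kl (trChar (QuadraticAlgebra L ω 0) ψ) (algebraMap _ _ a) (algebraMap _ _ b)
      = ∑ u : L, ∑ v : L, if u ^ 2 - ω * v ^ 2 = 0 then (0 : ℂ) else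
        ψ (2 * u * (a + b * (u ^ 2 - ω * v ^ 2)⁻¹)) := by
    rw [kl, ← Finset.sum_product']
    refine Finset.sum_equiv (QuadraticAlgebra.equivProd ω 0) (by simp) ?_
    rintro ⟨u, v⟩ _
    change _ =
      (if u ^ 2 - ω * v ^ 2 = 0 then (0 : ℂ) else ψ (2 * u * (a + b * (u ^ 2 - ω * v ^ 2)⁻¹)))
    have hn : (QuadraticAlgebra.norm (⟨u, v⟩ : QuadraticAlgebra L ω 0)) = u ^ 2 - ω * v ^ 2 := by
      rw [QuadraticAlgebra.norm_def]; simp; ring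
    have hz : (⟨u, v⟩ : QuadraticAlgebra L ω 0) = 0 ↔ u ^ 2 - ω * v ^ 2 = 0 := by
      rw [← hn, QuadraticAlgebra.norm_eq_zero_iff_eq_zero]
    by_cases h : u ^ 2 - ω * v ^ 2 = 0
    · rw [if_pos (hz.2 h), if_pos h]
    rw [if_neg (fun h' => h (hz.1 h')), if_neg h, trChar_apply, qa_trace]
    congr 1
    simp [QuadraticAlgebra.re_inv, hn]
    ring
  rw [key, ← Finset.sum_add_distrib]
  refine Finset.sum_congr rfl fun u _ => ?_
  rw [add_comm]
  exact sum_two_cover h2 ω hω (fun w => if u ^ 2 - w = 0 then (0 : ℂ) else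
        ψ (2 * u * (a + b * (u ^ 2 - w)⁻¹)))
lemma trChar_ne_one {F L : Type*} [Field F] [Finite F] [Field L] [Finite L] [Algebra F L]
    (ψ : AddChar F ℂ) (hψ : ψ ≠ 1) : trChar L ψ ≠ 1 := by
  intro h
  apply hψ
  ext x
  obtain ⟨y, hy⟩ := Algebra.trace_surjective F L x
  rw [← hy, ← trChar_apply, h]
  simp

lemma tower_s14 {F : Type} [Field F] [Fintype F] (hodd : Odd (Fintype.card F)) (ψ : AddChar F ℂ)
    (hψ : ψ ≠ 1) (a b : F) (ha : a ≠ 0) (hb : b ≠ 0) (δ : ℝ) (hδ : 0 < δ)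
    (h : (2 + δ) * Real.sqrt (Fintype.card F) ≤ ‖kl ψ a b‖) (k : ℕ) :
    ∃ (L : Type) (_ : Field L) (_ : Fintype L) (_ : Algebra F L), Module.finrank F L = 2 ^ k ∧
      (2 + 4 ^ k * δ) * Real.sqrt (Fintype.card L) ≤
        ‖kl (trChar L ψ) (algebraMap F L a) (algebraMap F L b)‖ := by
  induction k with
  | zero =>
    refine ⟨F, inferInstance, inferInstance, inferInstance, by simp, ?_⟩
    have : trChar F ψ = ψ := by ext x; simp [trChar_apply]
    rw [this]
    simpa using h
  | succ k ih =>
    obtain ⟨L, _, _, _, hfin, hL⟩ := ih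
    have hoddL : Odd (Fintype.card L) := by
      rw [Module.card_eq_pow_finrank (K := F)]; exact hodd.pow
    have h2 : ringChar L ≠ 2 := by
      intro h2
      have := FiniteField.even_card_of_char_two h2
      rw [Nat.odd_iff] at hoddL
      omega
    obtain ⟨ω, hω⟩ := FiniteField.exists_nonsquare h2
    have : Fact (∀ r : L, r ^ 2 ≠ ω + 0 * r) := ⟨fun r hr => hω ⟨r, by
      rw [← sq, hr]; ring⟩⟩
    have hq := kl_quad h2 (trChar L ψ) (trChar_ne_one ψ hψ) (algebraMap F L a) (algebraMap F L b)
      (by simpa using ha) (by simpa using hb) ω hω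
    have htr : trChar (QuadraticAlgebra L ω 0) (trChar L ψ) = trChar (QuadraticAlgebra L ω 0) ψ := by
      ext x
      rw [trChar_apply, trChar_apply, trChar_apply, Algebra.trace_trace]
    refine ⟨QuadraticAlgebra L ω 0, inferInstance, inferInstance, inferInstance, ?_, ?_⟩
    · rw [← Module.finrank_mul_finrank F L, hfin, QuadraticAlgebra.finrank_eq_two, pow_succ]
    · rw [htr, ← IsScalarTower.algebraMap_apply, ← IsScalarTower.algebraMap_apply] at hq
      rw [hq]
      have hcard : Fintype.card (QuadraticAlgebra L ω 0) = Fintype.card L ^ 2 := by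
        rw [Module.card_eq_pow_finrank (K := L), QuadraticAlgebra.finrank_eq_two]
      rw [hcard]
      push_cast
      rw [Real.sqrt_sq (by positivity)]
      have h3 := norm_sub_norm_le (kl (trChar L ψ) (algebraMap F L a) (algebraMap F L b) ^ 2)
        (2 * (Fintype.card L : ℂ))
      rw [norm_sub_rev, norm_pow] at h3
      have h4 : ‖(2 * (Fintype.card L : ℂ))‖ = 2 * Fintype.card L := by simp
      rw [h4] at h3
      refine le_trans ?_ h3
      have h5 : ((2 + 4 ^ k * δ) * Real.sqrt (Fintype.card L)) ^ 2 ≤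
        ‖kl (trChar L ψ) (algebraMap F L a) (algebraMap F L b)‖ ^ 2 :=
        pow_le_pow_left₀ (by positivity) hL 2
      rw [mul_pow, Real.sq_sqrt (by positivity)] at h5
      have h6 : 0 ≤ (4 ^ k * δ) ^ 2 * (Fintype.card L : ℝ) := by positivity
      rw [pow_succ]
      nlinarith

lemma weil_s14 {F : Type} [Field F] [Fintype F] (hodd : Odd (Fintype.card F)) (ψ : AddChar F ℂ)
    (hψ : ψ ≠ 1) (a b : F) (ha : a ≠ 0) (hb : b ≠ 0) :
    ‖kl ψ a b‖ ≤ 2 * Real.sqrt (Fintype.card F) := by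
  by_contra! hlt
  have hq2 : 2 < Fintype.card F := by
    have := Fintype.one_lt_card (α := F)
    obtain ⟨t, ht⟩ := hodd
    omega
  have hsq : 0 < Real.sqrt (Fintype.card F) := Real.sqrt_pos.2 (by positivity)
  set δ : ℝ := ‖kl ψ a b‖ / Real.sqrt (Fintype.card F) - 2 with hδdef
  have hδ : 0 < δ := by
    rw [hδdef, sub_pos, lt_div_iff₀ hsq]; exact hlt
  have hT := tower_s14 hodd ψ hψ a b ha hb δ hδ (by
    rw [hδdef, add_sub_cancel, div_mul_cancel₀ _ hsq.ne'])
  obtain ⟨k, hk⟩ := pow_unbounded_of_one_lt (4 * (Fintype.card F : ℝ) / δ) (by norm_num : (1 : ℝ) < 4)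
  obtain ⟨L, _, _, _, hfin, hL⟩ := hT (k + 2)
  have hpos : 2 ≤ 2 ^ (k + 1) := by
    rw [pow_succ]; have := Nat.one_le_two_pow (n := k); omega
  have hw := kl_bound_weak (L := L) hq2 ψ hψ a b ha (2 ^ (k + 1) - 1) (by omega) (by
    rw [hfin, Nat.sub_add_cancel (by omega)]; ring)
  rw [Nat.sub_add_cancel (by omega)] at hw
  have hc : Real.sqrt (Fintype.card L) = (Fintype.card F : ℝ) ^ (2 ^ (k + 1)) := by
    rw [Module.card_eq_pow_finrank (K := F), hfin, show 2 ^ (k + 2) = 2 ^ (k + 1) * 2 by ring,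
      pow_mul]
    push_cast
    rw [Real.sqrt_sq (by positivity)]
  rw [hc] at hL
  have h1 := le_of_mul_le_mul_right (hL.trans hw) (by positivity)
  rw [div_lt_iff₀ hδ] at hk
  rw [pow_add] at h1
  have : 0 < (4 : ℝ) ^ k * δ := by positivity
  nlinarith
lemma addChar_sum {F ι : Type*} [Field F] (ψ : AddChar F ℂ) (s : Finset ι) (f : ι → F) :
    ψ (∑ i ∈ s, f i) = ∏ i ∈ s, ψ (f i) := by
  classical
  induction s using Finset.induction_on with
  | empty => simp
  | insert a s ha ih => rw [Finset.sum_insert ha, Finset.prod_insert ha, AddChar.map_add_eq_mul, ih]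

lemma sum_psi_sq {F : Type} [Field F] [Fintype F] [DecidableEq F] (h2 : ringChar F ≠ 2)
    (ψ : AddChar F ℂ) (hψ : ψ ≠ 1) :
    ∃ g : ℂ, g ^ 2 = (quadraticChar F (-1) : ℂ) * Fintype.card F ∧
      ∀ t : F, t ≠ 0 → ∑ x, ψ (t * x ^ 2) = (quadraticChar F t : ℂ) * g := by
  let χ : MulChar F ℂ := (quadraticChar F).ringHomComp (Int.castRingHom ℂ)
  have hχ : ∀ x, χ x = (quadraticChar F x : ℂ) := fun x => by simp [χ, MulChar.ringHomComp_apply]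
  have hprim := AddChar.IsPrimitive.of_ne_one hψ
  refine ⟨gaussSum χ ψ, ?_, ?_⟩
  · rw [← hχ]
    refine gaussSum_sq ?_ ?_ hprim
    · exact (MulChar.ringHomComp_ne_one_iff (Int.castRingHom ℂ).injective_int).2
        (quadraticChar_ne_one h2)
    · exact (quadraticChar_isQuadratic F).comp _
  · intro t ht
    rw [sum_sq h2 (fun w => ψ (t * w))]
    simp only [add_mul, one_mul, Finset.sum_add_distrib]
    have h1 : ∑ w, ψ (t * w) = 0 := by
      simp only [mul_comm t]
      rw [AddChar.sum_mulShift _ hprim]; simp [ht]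
    rw [h1, zero_add, gaussSum, Finset.mul_sum]
    refine Fintype.sum_equiv (Equiv.mulLeft₀ t ht) _ _ fun w => ?_
    simp only [Equiv.mulLeft₀_apply, hχ, map_mul]
    have : (quadraticChar F t : ℂ) ^ 2 = 1 := by exact_mod_cast quadraticChar_sq_one ht
    push_cast
    linear_combination (-(quadraticChar F w : ℂ) * ψ (t * w)) * this

lemma sum_psi_Q {F : Type} [Field F] [Fintype F] (h2 : ringChar F ≠ 2)
    (ψ : AddChar F ℂ) (hψ : ψ ≠ 1) (Q : QuadraticForm F (Fin 2 → F))
    (hQ : ∀ x : Fin 2 → F, (∀ y : Fin 2 → F, Q (x + y) - Q x - Q y = 0) → x = 0) :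
    ∃ ε : ℝ, (ε = 1 ∨ ε = -1) ∧ ∀ s : F, s ≠ 0 →
      ∑ z, ψ (s * Q z) = (ε : ℂ) * Fintype.card F := by
  classical
  have h20 : (2 : F) ≠ 0 := Ring.two_ne_zero h2
  letI : Invertible (2 : F) := invertibleOfNonzero h20
  obtain ⟨g, hg, hsum⟩ := sum_psi_sq h2 ψ hψ
  obtain ⟨w, ⟨e⟩⟩ := QuadraticForm.equivalent_weightedSumSquares_units_of_nondegenerate' Q (by
    intro x hx
    apply hQ
    intro y
    have h := hx y
    have h3 := congrArg (fun B => B x y) (QuadraticMap.two_nsmul_associated (S := F) Q)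
    have h4 : QuadraticMap.polar Q x y = 2 • (QuadraticMap.associated Q x y) := h3.symm
    rw [h, smul_zero] at h4
    exact h4)
  let ε0 : ℤ := quadraticChar F (-1) * ∏ i, quadraticChar F (w i : F)
  have hε0 : ε0 ^ 2 = 1 := by
    simp only [ε0, mul_pow, ← Finset.prod_pow]
    rw [quadraticChar_sq_one (by simp), Finset.prod_eq_one, one_mul]
    intro i _
    exact quadraticChar_sq_one (w i).ne_zero
  refine ⟨(ε0 : ℝ), ?_, ?_⟩
  · rcases sq_eq_one_iff.1 hε0 with h | h <;> simp [h]
  · intro s hs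
    have h1 : ∑ z, ψ (s * Q z) = ∑ v : Fin (Module.finrank F (Fin 2 → F)) → F,
        ∏ i, ψ ((s * w i) * (v i) ^ 2) := by
      refine Fintype.sum_equiv e.toEquiv _ _ fun z => ?_
      have : Q z = QuadraticMap.weightedSumSquares F w (e z) := (e.map_app z).symm
      rw [this, QuadraticMap.weightedSumSquares_apply, Finset.mul_sum, addChar_sum]
      refine Finset.prod_congr rfl fun i _ => ?_
      congr 1
      simp only [Units.smul_def, smul_eq_mul]
      change s * (w i * (e z i * e z i)) = s * w i * (e z i) ^ 2
      ring
    have h3 : ∑ v : Fin (Module.finrank F (Fin 2 → F)) → F,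
        ∏ i, ψ ((s * w i) * (v i) ^ 2) = ∏ i, ∑ x : F, ψ ((s * w i) * x ^ 2) := by
      rw [Finset.prod_univ_sum, Fintype.piFinset_univ]
    rw [h1, h3, Finset.prod_congr rfl fun i _ => hsum (s * w i) (mul_ne_zero hs (w i).ne_zero)]
    simp only [map_mul, Int.cast_mul, Finset.prod_mul_distrib, Finset.prod_const, Finset.card_univ,
      Fintype.card_fin, Module.finrank_fin_fun]
    have hs2 : (quadraticChar F s : ℂ) ^ 2 = 1 := by exact_mod_cast quadraticChar_sq_one hs
    rw [hg, hs2]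
    simp only [ε0]
    push_cast
    ring

section main
variable {F : Type} [Field F] [Fintype F]

noncomputable def lam (ψ : AddChar F ℂ) (Q : QuadraticForm F (Fin 2 → F)) (a : F)
    (m : Fin 2 → F) : ℂ :=
  ∑ z, open Classical in if Q z = a then ψ (QuadraticMap.polar Q m z) else 0

noncomputable def ft (ψ : AddChar F ℂ) (Q : QuadraticForm F (Fin 2 → F)) (φ : (Fin 2 → F) → ℂ)
    (m : Fin 2 → F) : ℂ :=
  ∑ z, φ z * ψ (QuadraticMap.polar Q m z)

lemma sum_polar (ψ : AddChar F ℂ) (hψ : ψ ≠ 1) (Q : QuadraticForm F (Fin 2 → F))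
    (hQ : ∀ x : Fin 2 → F, (∀ y : Fin 2 → F, Q (x + y) - Q x - Q y = 0) → x = 0)
    (m : Fin 2 → F) : ∑ z, ψ (QuadraticMap.polar Q m z)
      = open Classical in if m = 0 then (Fintype.card F : ℂ) ^ 2 else 0 := by
  classical
  split_ifs with hm
  · subst hm
    simp [QuadraticMap.polar_zero_left]
  · let Φ : AddChar (Fin 2 → F) ℂ :=
      ψ.compAddMonoidHom (QuadraticMap.polarBilin Q m).toAddMonoidHom
    have hΦ : ∀ z, Φ z = ψ (QuadraticMap.polar Q m z) := fun z => rfl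
    simp only [← hΦ]
    apply AddChar.sum_eq_zero_of_ne_one
    intro h1
    obtain ⟨y, hy⟩ : ∃ y, QuadraticMap.polar Q m y ≠ 0 := by
      by_contra! h
      exact hm (hQ m h)
    apply hψ
    ext t
    have : Φ ((t / QuadraticMap.polar Q m y) • y) = ψ t := by
      rw [hΦ, QuadraticMap.polar_smul_right, smul_eq_mul, div_mul_cancel₀ _ hy]
    rw [← this, h1]; simp

lemma kl_zero (ψ : AddChar F ℂ) (hψ : ψ ≠ 1) (a : F) (ha : a ≠ 0) : kl ψ a 0 = -1 := by
  classical
  have h := AddChar.sum_mulShift a (AddChar.IsPrimitive.of_ne_one hψ)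
  simp only [ha, if_false] at h
  rw [← Finset.add_sum_erase _ _ (Finset.mem_univ (0 : F))] at h
  rw [kl, ← Finset.add_sum_erase _ _ (Finset.mem_univ (0 : F))]
  rw [if_pos rfl, zero_add]
  have h1 : ∀ x ∈ Finset.univ.erase (0 : F), (if x = 0 then (0 : ℂ) else ψ (a * x + 0 * x⁻¹))
      = ψ (x * a) := by
    intro x hx
    rw [if_neg (Finset.ne_of_mem_erase hx)]; congr 1; ring
  rw [Finset.sum_congr rfl h1]
  rw [zero_mul, AddChar.map_zero_eq_one] at h
  push_cast at h
  linear_combination h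

lemma lam_eq (ψ : AddChar F ℂ) (hψ : ψ ≠ 1) (Q : QuadraticForm F (Fin 2 → F))
    (hQ : ∀ x : Fin 2 → F, (∀ y : Fin 2 → F, Q (x + y) - Q x - Q y = 0) → x = 0)
    (ε : ℝ) (hε : ∀ s : F, s ≠ 0 → ∑ z, ψ (s * Q z) = (ε : ℂ) * Fintype.card F)
    (a : F) (m : Fin 2 → F) :
    lam ψ Q a m = (open Classical in if m = 0 then (Fintype.card F : ℂ) else 0)
      + ε * kl ψ (-a) (- Q m) := by
  classical
  have hq0 : (Fintype.card F : ℂ) ≠ 0 := by exact_mod_cast Fintype.card_ne_zero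
  have hprim := AddChar.IsPrimitive.of_ne_one hψ
  have h1 : (Fintype.card F : ℂ) * lam ψ Q a m
      = ∑ s : F, ∑ z, ψ (s * (Q z - a)) * ψ (QuadraticMap.polar Q m z) := by
    rw [Finset.sum_comm, lam, Finset.mul_sum]
    refine Finset.sum_congr rfl fun z _ => ?_
    rw [← Finset.sum_mul, AddChar.sum_mulShift _ hprim]
    by_cases h : Q z = a
    · simp [h]
    · simp [h, sub_eq_zero]
  have h2 : ∀ s : F, s ≠ 0 → ∑ z, ψ (s * (Q z - a)) * ψ (QuadraticMap.polar Q m z)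
      = ε * Fintype.card F * ψ (-a * s + -Q m * s⁻¹) := by
    intro s hs
    rw [← hε s hs, Finset.sum_mul]
    refine Fintype.sum_equiv (Equiv.addRight (s⁻¹ • m)) _ _ fun z => ?_
    rw [← AddChar.map_add_eq_mul, ← AddChar.map_add_eq_mul]
    congr 1
    simp only [Equiv.coe_addRight]
    rw [QuadraticMap.map_add Q z (s⁻¹ • m), QuadraticMap.map_smul, QuadraticMap.polar_smul_right,
      QuadraticMap.polar_comm Q z m]
    simp only [smul_eq_mul]
    field_simp
    ring
  apply mul_left_cancel₀ hq0
  rw [h1, ← Finset.add_sum_erase _ _ (Finset.mem_univ (0 : F)),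
    Finset.sum_congr rfl fun s hs => h2 s (Finset.ne_of_mem_erase hs)]
  have h3 : kl ψ (-a) (- Q m) = ∑ s ∈ Finset.univ.erase (0 : F), ψ (-a * s + -Q m * s⁻¹) := by
    rw [kl, ← Finset.add_sum_erase _ _ (Finset.mem_univ (0 : F)), if_pos rfl, zero_add]
    exact Finset.sum_congr rfl fun s hs => if_neg (Finset.ne_of_mem_erase hs)
  rw [h3, ← Finset.mul_sum]
  simp only [zero_mul, AddChar.map_zero_eq_one, one_mul]
  rw [sum_polar ψ hψ Q hQ]
  split_ifs <;> ring

lemma lam_zero (ψ : AddChar F ℂ) (hψ : ψ ≠ 1) (Q : QuadraticForm F (Fin 2 → F))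
    (hQ : ∀ x : Fin 2 → F, (∀ y : Fin 2 → F, Q (x + y) - Q x - Q y = 0) → x = 0)
    (ε : ℝ) (hε : ∀ s : F, s ≠ 0 → ∑ z, ψ (s * Q z) = (ε : ℂ) * Fintype.card F)
    (a : F) (ha : a ≠ 0) :
    lam ψ Q a 0 = (((Fintype.card F : ℝ) - ε : ℝ) : ℂ) := by
  rw [lam_eq ψ hψ Q hQ ε hε, QuadraticMap.map_zero, neg_zero, kl_zero ψ hψ _ (neg_ne_zero.2 ha)]
  push_cast
  simp
  ring

lemma lam_bound (hq : Odd (Fintype.card F)) (ψ : AddChar F ℂ) (hψ : ψ ≠ 1)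
    (Q : QuadraticForm F (Fin 2 → F))
    (hQ : ∀ x : Fin 2 → F, (∀ y : Fin 2 → F, Q (x + y) - Q x - Q y = 0) → x = 0)
    (ε : ℝ) (hε1 : ε = 1 ∨ ε = -1)
    (hε : ∀ s : F, s ≠ 0 → ∑ z, ψ (s * Q z) = (ε : ℂ) * Fintype.card F)
    (a : F) (ha : a ≠ 0) (m : Fin 2 → F) (hm : m ≠ 0) :
    ‖lam ψ Q a m‖ ≤ 2 * Real.sqrt (Fintype.card F) := by
  rw [lam_eq ψ hψ Q hQ ε hε, if_neg hm, zero_add, norm_mul]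
  have : ‖(ε : ℂ)‖ = 1 := by rcases hε1 with h | h <;> simp [h]
  rw [this, one_mul]
  by_cases h : Q m = 0
  · rw [h, neg_zero, kl_zero ψ hψ _ (neg_ne_zero.2 ha), norm_neg, norm_one]
    have : 1 ≤ Real.sqrt (Fintype.card F) := by
      rw [Real.one_le_sqrt]; exact_mod_cast Fintype.card_pos
    linarith
  · exact weil_s14 hq ψ hψ _ _ (neg_ne_zero.2 ha) (neg_ne_zero.2 h)

lemma plancherel (ψ : AddChar F ℂ) (hψ : ψ ≠ 1) (Q : QuadraticForm F (Fin 2 → F))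
    (hQ : ∀ x : Fin 2 → F, (∀ y : Fin 2 → F, Q (x + y) - Q x - Q y = 0) → x = 0)
    (φ χ : (Fin 2 → F) → ℂ) :
    ∑ m, ft ψ Q φ m * (starRingEnd ℂ) (ft ψ Q χ m)
      = (Fintype.card F : ℂ) ^ 2 * ∑ x, φ x * (starRingEnd ℂ) (χ x) := by
  classical
  have h1 : ∀ m, ft ψ Q φ m * (starRingEnd ℂ) (ft ψ Q χ m)
      = ∑ x, ∑ y, φ x * (starRingEnd ℂ) (χ y) * ψ (QuadraticMap.polar Q (x - y) m) := by
    intro m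
    rw [ft, ft, map_sum, Finset.sum_mul_sum]
    refine Finset.sum_congr rfl fun x _ => Finset.sum_congr rfl fun y _ => ?_
    rw [map_mul, ← AddChar.map_neg_eq_conj, QuadraticMap.polar_comm Q (x - y),
      QuadraticMap.polar_sub_right, sub_eq_add_neg, AddChar.map_add_eq_mul]
    ring
  rw [Finset.sum_congr rfl fun m _ => h1 m, Finset.sum_comm, Finset.mul_sum]
  refine Finset.sum_congr rfl fun x _ => ?_
  rw [Finset.sum_comm]
  simp only [← Finset.mul_sum, sum_polar ψ hψ Q hQ, sub_eq_zero]
  simp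
  ring

lemma ft_conv (ψ : AddChar F ℂ) (Q : QuadraticForm F (Fin 2 → F)) (φ : (Fin 2 → F) → ℂ) (a : F)
    (m : Fin 2 → F) :
    ft ψ Q (fun x => ∑ y, open Classical in if Q (x - y) = a then φ y else 0) m
      = lam ψ Q a m * ft ψ Q φ m := by
  classical
  rw [ft, ft, Finset.mul_sum]
  simp only [Finset.sum_mul]
  rw [Finset.sum_comm]
  refine Finset.sum_congr rfl fun y _ => ?_
  rw [lam, Finset.sum_mul]
  refine Fintype.sum_equiv (Equiv.subRight y) _ _ fun x => ?_
  simp only [Equiv.subRight_apply]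
  split_ifs with h
  · have : ψ (QuadraticMap.polar Q m x) = ψ (QuadraticMap.polar Q m (x - y)) *
        ψ (QuadraticMap.polar Q m y) := by
      rw [← AddChar.map_add_eq_mul, ← QuadraticMap.polar_add_right, sub_add_cancel]
    rw [this]; ring
  · simp

end main

section final
variable {F : Type} [Field F] [Fintype F]

lemma norm_facts (ψ : AddChar F ℂ) (hψ : ψ ≠ 1) (Q : QuadraticForm F (Fin 2 → F))
    (hQ : ∀ x : Fin 2 → F, (∀ y : Fin 2 → F, Q (x + y) - Q x - Q y = 0) → x = 0)
    (φ : (Fin 2 → F) → ℂ) :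
    ∑ m, ‖ft ψ Q φ m‖ ^ 2 = (Fintype.card F : ℝ) ^ 2 * ∑ x, ‖φ x‖ ^ 2 := by
  have h := plancherel ψ hψ Q hQ φ φ
  simp only [Complex.mul_conj'] at h
  exact_mod_cast h

lemma ft_zero (ψ : AddChar F ℂ) (Q : QuadraticForm F (Fin 2 → F)) (φ : (Fin 2 → F) → ℂ) :
    ft ψ Q φ 0 = ∑ x, φ x := by
  simp [ft, QuadraticMap.polar_zero_left]

open Classical in
lemma key (hq : Odd (Fintype.card F)) (ψ : AddChar F ℂ) (hψ : ψ ≠ 1)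
    (Q : QuadraticForm F (Fin 2 → F))
    (hQ : ∀ x : Fin 2 → F, (∀ y : Fin 2 → F, Q (x + y) - Q x - Q y = 0) → x = 0)
    (ε : ℝ) (hε1 : ε = 1 ∨ ε = -1)
    (hε : ∀ s : F, s ≠ 0 → ∑ z, ψ (s * Q z) = (ε : ℂ) * Fintype.card F)
    (a : F) (ha : a ≠ 0) (E : Finset (Fin 2 → F)) (n q : ℝ) (hn : n = E.card)
    (hqq : q = Fintype.card F) (d : (Fin 2 → F) → ℝ)
    (hd : ∀ x, d x = ∑ y, if Q (x - y) = a then (if y ∈ E then 1 else 0) else 0) :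
    ∑ x, d x = (q - ε) * n ∧
    |∑ x ∈ E, d x - (q - ε) * n ^ 2 / q ^ 2| ≤ 2 * Real.sqrt q * (n - n ^ 2 / q ^ 2) ∧
    ∑ x, d x ^ 2 - (q - ε) ^ 2 * n ^ 2 / q ^ 2 ≤ 4 * q * (n - n ^ 2 / q ^ 2) := by
  have hq0 : 0 < q := by rw [hqq]; exact_mod_cast Fintype.card_pos
  have hqC : (Fintype.card F : ℂ) = (q : ℂ) := by rw [hqq]; simp
  let e : (Fin 2 → F) → ℂ := fun y => if y ∈ E then 1 else 0
  let D : (Fin 2 → F) → ℂ := fun x => (d x : ℂ)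
  have hD : D = fun x => ∑ y, if Q (x - y) = a then e y else 0 := by
    funext x
    simp only [D, e, hd, Complex.ofReal_sum]
    refine Finset.sum_congr rfl fun y _ => ?_
    split_ifs <;> simp
  have hl0 : lam ψ Q a 0 = ((q - ε : ℝ) : ℂ) := by
    rw [lam_zero ψ hψ Q hQ ε hε a ha, hqq]
  have hlb : ∀ m, m ≠ 0 → ‖lam ψ Q a m‖ ≤ 2 * Real.sqrt q := by
    rw [hqq]; exact lam_bound hq ψ hψ Q hQ ε hε1 hε a ha
  have hfD : ∀ m, ft ψ Q D m = lam ψ Q a m * ft ψ Q e m := by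
    intro m
    rw [hD]
    exact ft_conv ψ Q e a m
  have he0 : ft ψ Q e 0 = (n : ℂ) := by
    rw [ft_zero, hn]
    simp [e]
  have hsumD : ∑ x, d x = (q - ε) * n := by
    have h := hfD 0
    rw [ft_zero, hl0, he0] at h
    simp only [D] at h
    exact_mod_cast h
  have hP : ∑ m, ‖ft ψ Q e m‖ ^ 2 = q ^ 2 * n := by
    rw [norm_facts ψ hψ Q hQ, hqq, hn]
    congr 1
    have : ∀ x, ‖e x‖ ^ 2 = if x ∈ E then 1 else 0 := by
      intro x; simp only [e]; split_ifs <;> simp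
    simp [this]
  have hP' : ∑ m ∈ Finset.univ.erase (0 : Fin 2 → F), ‖ft ψ Q e m‖ ^ 2 = q ^ 2 * n - n ^ 2 := by
    rw [← Finset.add_sum_erase _ _ (Finset.mem_univ (0 : Fin 2 → F)), he0] at hP
    simp only [Complex.norm_real, Real.norm_eq_abs, sq_abs] at hP
    linarith
  refine ⟨hsumD, ?_, ?_⟩
  · have h := plancherel ψ hψ Q hQ D e
    have h1 : ∑ x, D x * (starRingEnd ℂ) (e x) = ((∑ x ∈ E, d x : ℝ) : ℂ) := by
      have : ∀ x, D x * (starRingEnd ℂ) (e x) = if x ∈ E then (d x : ℂ) else 0 := by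
        intro x; simp only [e, D]; split_ifs <;> simp
      simp [this]
    rw [h1, hqC] at h
    simp only [hfD, mul_assoc, Complex.mul_conj'] at h
    rw [← Finset.add_sum_erase _ _ (Finset.mem_univ (0 : Fin 2 → F)), he0, hl0] at h
    have hb : ‖∑ m ∈ Finset.univ.erase (0 : Fin 2 → F),
        lam ψ Q a m * (‖ft ψ Q e m‖ : ℂ) ^ 2‖ ≤ 2 * Real.sqrt q * (q ^ 2 * n - n ^ 2) := by
      rw [← hP', Finset.mul_sum]
      refine (norm_sum_le _ _).trans (Finset.sum_le_sum fun m hm => ?_)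
      rw [norm_mul, norm_pow, Complex.norm_real, norm_norm]
      exact mul_le_mul_of_nonneg_right (hlb m (Finset.ne_of_mem_erase hm)) (by positivity)
    have h5 : ∑ m ∈ Finset.univ.erase (0 : Fin 2 → F),
        lam ψ Q a m * (‖ft ψ Q e m‖ : ℂ) ^ 2
        = ((q ^ 2 * ∑ x ∈ E, d x - (q - ε) * n ^ 2 : ℝ) : ℂ) := by
      have hnn : ((‖(n : ℂ)‖ : ℝ) : ℂ) ^ 2 = (n : ℂ) ^ 2 := by
        rw [Complex.norm_real, Real.norm_eq_abs]
        exact_mod_cast sq_abs n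
      rw [hnn] at h
      push_cast at h ⊢
      linear_combination h
    rw [h5, Complex.norm_real, Real.norm_eq_abs] at hb
    have h6 : ∑ x ∈ E, d x - (q - ε) * n ^ 2 / q ^ 2
        = (q ^ 2 * ∑ x ∈ E, d x - (q - ε) * n ^ 2) / q ^ 2 := by field_simp
    rw [h6, abs_div, abs_of_pos (by positivity : 0 < q ^ 2), div_le_iff₀ (by positivity)]
    refine hb.trans (le_of_eq ?_)
    field_simp
  · have h := norm_facts ψ hψ Q hQ D
    rw [← hqq] at h
    simp only [hfD, norm_mul, mul_pow, D, Complex.norm_real, Real.norm_eq_abs, sq_abs] at h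
    rw [← Finset.add_sum_erase _ _ (Finset.mem_univ (0 : Fin 2 → F)), he0, hl0] at h
    simp only [Complex.norm_real, Real.norm_eq_abs, sq_abs] at h
    have hb : ∑ m ∈ Finset.univ.erase (0 : Fin 2 → F),
        ‖lam ψ Q a m‖ ^ 2 * ‖ft ψ Q e m‖ ^ 2 ≤ 4 * q * (q ^ 2 * n - n ^ 2) := by
      rw [← hP', Finset.mul_sum]
      refine Finset.sum_le_sum fun m hm => ?_
      refine mul_le_mul_of_nonneg_right ?_ (by positivity)
      have h1 := hlb m (Finset.ne_of_mem_erase hm)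
      have h2 := pow_le_pow_left₀ (norm_nonneg _) h1 2
      rw [mul_pow, Real.sq_sqrt hq0.le] at h2
      linarith
    have h6 : ∑ x, d x ^ 2 - (q - ε) ^ 2 * n ^ 2 / q ^ 2
        = (q ^ 2 * ∑ x, d x ^ 2 - (q - ε) ^ 2 * n ^ 2) / q ^ 2 := by field_simp
    rw [h6, div_le_iff₀ (by positivity)]
    have h7 : 4 * q * (n - n ^ 2 / q ^ 2) * q ^ 2 = 4 * q * (q ^ 2 * n - n ^ 2) := by field_simp
    rw [h7]
    linarith

lemma final_ineq (n q ε c r Sa Sb T N : ℝ) (hn : 0 ≤ n) (hq : 1 ≤ q) (hnq : n ≤ q ^ 2)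
    (hε : ε = 1 ∨ ε = -1) (hc : c = (q - ε) * n / q ^ 2) (hr : 1 ≤ r)
    (hSa : |Sa| ≤ 2 * r * (n - n ^ 2 / q ^ 2)) (hSb : |Sb| ≤ 2 * r * (n - n ^ 2 / q ^ 2))
    (hT : |T| ≤ 4 * q * (n - n ^ 2 / q ^ 2)) (hN : N = c ^ 2 * n + c * (Sa + Sb) + T) :
    |N - n ^ 3 / q ^ 2| ≤ 4 * r * (q + 1) / q ^ 2 * n ^ 2 + 4 * q * n := by
  have hq0 : 0 < q := by linarith
  have hc1 : |c| ≤ (q + 1) * n / q ^ 2 := by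
    rw [hc, abs_div, abs_mul, abs_of_nonneg hn, abs_of_pos (by positivity : 0 < q ^ 2)]
    gcongr
    rw [abs_le]; rcases hε with h | h <;> constructor <;> linarith
  have hmain : |c ^ 2 * n - n ^ 3 / q ^ 2| ≤ (2 * q + 1) * n ^ 3 / q ^ 4 := by
    have : c ^ 2 * n - n ^ 3 / q ^ 2 = ((q - ε) ^ 2 - q ^ 2) * (n ^ 3 / q ^ 4) := by
      rw [hc]; field_simp
    rw [this, abs_mul, abs_of_nonneg (by positivity : 0 ≤ n ^ 3 / q ^ 4), mul_div_assoc]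
    gcongr
    rw [abs_le]; rcases hε with h | h <;> subst h <;> constructor <;> nlinarith
  have h1 : |c * (Sa + Sb)| ≤ (q + 1) * n / q ^ 2 * (4 * r * (n - n ^ 2 / q ^ 2)) := by
    rw [abs_mul]
    have : |Sa + Sb| ≤ 4 * r * (n - n ^ 2 / q ^ 2) := (abs_add_le _ _).trans (by linarith)
    gcongr
  have h2 : |N - n ^ 3 / q ^ 2| ≤ (2 * q + 1) * n ^ 3 / q ^ 4 +
      (q + 1) * n / q ^ 2 * (4 * r * (n - n ^ 2 / q ^ 2)) + 4 * q * (n - n ^ 2 / q ^ 2) := by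
    have : N - n ^ 3 / q ^ 2 = (c ^ 2 * n - n ^ 3 / q ^ 2) + c * (Sa + Sb) + T := by
      rw [hN]; ring
    rw [this]
    refine (abs_add_three _ _ _).trans ?_
    linarith
  refine h2.trans ?_
  have h3 : (q + 1) * n / q ^ 2 * (4 * r * (n - n ^ 2 / q ^ 2))
      = 4 * r * (q + 1) / q ^ 2 * n ^ 2 - 4 * r * (q + 1) * (n ^ 3 / q ^ 4) := by
    field_simp
  rw [h3, mul_div_assoc]
  have h4 : (2 * q + 1) * (n ^ 3 / q ^ 4) ≤ 4 * r * (q + 1) * (n ^ 3 / q ^ 4) := by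
    gcongr
    nlinarith
  have h5 : 4 * q * (n - n ^ 2 / q ^ 2) ≤ 4 * q * n := by
    gcongr
    have : 0 ≤ n ^ 2 / q ^ 2 := by positivity
    linarith
  linarith

end final

set_option maxHeartbeats 1000000 in
theorem stmt_14 (F : Type) [Field F] [Fintype F] (hq : Odd (Fintype.card F))
    (Q : QuadraticForm F (Fin 2 → F))
    (hQ : ∀ x : Fin 2 → F, (∀ y : Fin 2 → F, Q (x + y) - Q x - Q y = 0) → x = 0)
    (E : Set (Fin 2 → F)) (a b : F) (ha : a ≠ 0) (hb : b ≠ 0) :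
    |(Set.ncard {t : (Fin 2 → F) × (Fin 2 → F) × (Fin 2 → F) |
          t.1 ∈ E ∧ t.2.1 ∈ E ∧ t.2.2 ∈ E ∧
          Q (t.1 - t.2.1) = a ∧ Q (t.1 - t.2.2) = b} : ℝ) -
        (E.ncard : ℝ) ^ 3 / (Fintype.card F : ℝ) ^ 2| ≤
      4 * Real.sqrt (Fintype.card F) * ((Fintype.card F : ℝ) + 1) /
          (Fintype.card F : ℝ) ^ 2 * (E.ncard : ℝ) ^ 2 +
        4 * (Fintype.card F : ℝ) * (E.ncard : ℝ) := by
  classical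
  have h2 : ringChar F ≠ 2 := by
    intro h
    have := FiniteField.even_card_of_char_two h
    obtain ⟨k, hk⟩ := hq
    omega
  obtain ⟨ψ, hψ1⟩ := (AddChar.exists_apply_ne_zero (a := (1 : F))).2 one_ne_zero
  have hψ : ψ ≠ 1 := by rintro rfl; simp at hψ1
  obtain ⟨ε, hε1, hε⟩ := sum_psi_Q h2 ψ hψ Q hQ
  set q : ℝ := (Fintype.card F : ℝ) with hqq
  let S : Finset (Fin 2 → F) := E.toFinset
  have hS : ∀ x, x ∈ S ↔ x ∈ E := fun x => Set.mem_toFinset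
  have hn : (E.ncard : ℝ) = S.card := by rw [Set.ncard_eq_toFinset_card']
  set n : ℝ := (E.ncard : ℝ) with hnn
  have hnq : n ≤ q ^ 2 := by
    rw [hn, hqq]
    have : S.card ≤ Fintype.card F ^ 2 := by
      refine (Finset.card_le_univ S).trans ?_
      simp
    exact_mod_cast this
  have hq1 : 1 ≤ q := by rw [hqq]; exact_mod_cast Fintype.card_pos
  let d : F → (Fin 2 → F) → ℝ := fun a x =>
    ∑ y, if Q (x - y) = a then (if y ∈ S then 1 else 0) else 0
  obtain ⟨a1, a2, a3⟩ := key hq ψ hψ Q hQ ε hε1 hε a ha S n q hn hqq (d a) (fun _ => rfl)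
  obtain ⟨b1, b2, b3⟩ := key hq ψ hψ Q hQ ε hε1 hε b hb S n q hn hqq (d b) (fun _ => rfl)
  let c : ℝ := (q - ε) * n / q ^ 2
  have hN : (Set.ncard {t : (Fin 2 → F) × (Fin 2 → F) × (Fin 2 → F) |
          t.1 ∈ E ∧ t.2.1 ∈ E ∧ t.2.2 ∈ E ∧
          Q (t.1 - t.2.1) = a ∧ Q (t.1 - t.2.2) = b} : ℝ) = ∑ x ∈ S, d a x * d b x := by
    rw [Set.ncard_eq_toFinset_card', Set.toFinset_ofPred, Finset.card_filter]
    push_cast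
    rw [Fintype.sum_prod_type, ← Finset.sum_subset (Finset.subset_univ S)]
    · refine Finset.sum_congr rfl fun x hx => ?_
      rw [Fintype.sum_prod_type, Finset.sum_mul_sum]
      refine Finset.sum_congr rfl fun y _ => Finset.sum_congr rfl fun z _ => ?_
      have hx' := (hS x).1 hx
      simp only [hS, hx', true_and]
      by_cases h1 : Q (x - y) = a <;> by_cases h2 : Q (x - z) = b <;> by_cases h3 : y ∈ E <;>
        by_cases h4 : z ∈ E <;> simp [h1, h2, h3, h4]
    · intro x _ hx
      have hx' : x ∉ E := fun h => hx ((hS x).2 h)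
      simp [hx']
  have hcard : (Fintype.card (Fin 2 → F) : ℝ) = q ^ 2 := by rw [hqq]; simp
  have hsq : ∀ t : F, ∑ x, d t x = (q - ε) * n →
      ∑ x, d t x ^ 2 - (q - ε) ^ 2 * n ^ 2 / q ^ 2 ≤ 4 * q * (n - n ^ 2 / q ^ 2) →
      ∑ x, (d t x - c) ^ 2 ≤ 4 * q * (n - n ^ 2 / q ^ 2) := by
    intro t h1 h2
    refine le_trans (le_of_eq ?_) h2
    have h3 : ∀ x, (d t x - c) ^ 2 = d t x ^ 2 - 2 * c * d t x + c ^ 2 := fun x => by ring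
    simp only [h3, Finset.sum_add_distrib, Finset.sum_sub_distrib, ← Finset.mul_sum, h1,
      Finset.sum_const, Finset.card_univ, nsmul_eq_mul, hcard]
    simp only [c]
    field_simp
    ring
  have hE : ∀ t : F, ∑ x ∈ S, (d t x - c) = ∑ x ∈ S, d t x - (q - ε) * n ^ 2 / q ^ 2 := by
    intro t
    rw [Finset.sum_sub_distrib, Finset.sum_const, nsmul_eq_mul, ← hn]
    simp only [c]; ring
  have hT : |∑ x ∈ S, (d a x - c) * (d b x - c)| ≤ 4 * q * (n - n ^ 2 / q ^ 2) := by
    calc |∑ x ∈ S, (d a x - c) * (d b x - c)|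
        ≤ ∑ x ∈ S, |(d a x - c) * (d b x - c)| := Finset.abs_sum_le_sum_abs _ _
      _ ≤ ∑ x, |(d a x - c) * (d b x - c)| :=
          Finset.sum_le_sum_of_subset_of_nonneg (Finset.subset_univ S) fun _ _ _ => abs_nonneg _
      _ ≤ ∑ x, ((d a x - c) ^ 2 + (d b x - c) ^ 2) / 2 := by
          refine Finset.sum_le_sum fun x _ => ?_
          rw [abs_le]
          constructor
          · nlinarith [sq_nonneg ((d a x - c) + (d b x - c))]
          · nlinarith [sq_nonneg ((d a x - c) - (d b x - c))]
      _ ≤ 4 * q * (n - n ^ 2 / q ^ 2) := by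
          rw [← Finset.sum_div, Finset.sum_add_distrib]
          linarith [hsq a a1 a3, hsq b b1 b3]
  rw [hN]
  refine final_ineq n q ε c (Real.sqrt q) (∑ x ∈ S, (d a x - c)) (∑ x ∈ S, (d b x - c))
    (∑ x ∈ S, (d a x - c) * (d b x - c)) _ (Nat.cast_nonneg _) hq1 hnq hε1 rfl
    (Real.one_le_sqrt.2 hq1) (by rw [hE]; exact a2) (by rw [hE]; exact b2) hT ?_
  have h3 : ∀ x, d a x * d b x = c ^ 2 + (c * (d a x - c) + c * (d b x - c))
      + (d a x - c) * (d b x - c) := fun x => by ring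
  rw [Finset.sum_congr rfl fun x _ => h3 x]
  simp only [Finset.sum_add_distrib, ← Finset.mul_sum, Finset.sum_const, nsmul_eq_mul, ← hn]
  ring
end
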